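/- Let (u, w, b, Π) be a smooth solution of the stationary magneto-micropolar equations on ℝ³ satisfying the potential growth hypothesis: there exist smooth Φ, Ψ, Υ : ℝ³ → ℝ^{3×3} with div Φ = u, div Ψ = b, div Υ = w, an exponent s ∈ (3, 6], and a constant C₀ > 0 such that the sum of the s-mean oscillations of Φ, Ψ, Υ over B_r is at most C₀ r^{1/3 − 1/s} for all r > 1. Then ρ^{−1} ∫_{B_{2ρ}∖B_ρ} (|u|³ + |b|³ + |w|³) dx → 0 as ρ → ∞. -/

import Mathlib

open MeasureTheory Real Filter Metric
open scoped Topology ENNReal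

noncomputable section

/-- Three-dimensional Euclidean space. -/
abbrev E3 := EuclideanSpace ℝ (Fin 3)

/-- Partial derivative in the `i`-th coordinate direction. -/
def pd (i : Fin 3) (f : E3 → ℝ) (x : E3) : ℝ := fderiv ℝ f x (EuclideanSpace.single i 1)

/-- Laplacian of a scalar function. -/
def lap (f : E3 → ℝ) (x : E3) : ℝ := ∑ i, pd i (fun y => pd i f y) x

/-- Divergence of a vector field. -/
def vdiv (v : E3 → E3) (x : E3) : ℝ := ∑ i, pd i (fun y => v y i) x

/-- Curl of a vector field on ℝ³. -/
def curl3 (v : E3 → E3) (x : E3) : Fin 3 → ℝ :=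
  ![pd 1 (fun y => v y 2) x - pd 2 (fun y => v y 1) x,
    pd 2 (fun y => v y 0) x - pd 0 (fun y => v y 2) x,
    pd 0 (fun y => v y 1) x - pd 1 (fun y => v y 0) x]

/-- Squared norm of the full gradient of a vector field: |∇v|² = Σᵢⱼ (∂ᵢ vⱼ)². -/
def gradSq (v : E3 → E3) (x : E3) : ℝ := ∑ j, ∑ i, (pd i (fun y => v y j) x) ^ 2

/-- The open ball of radius `r` centered at the origin. -/
def ball3 (r : ℝ) : Set E3 := Metric.ball (0 : E3) r

/-- `(u, w, b, Π)` is a smooth solution of the stationary magneto-micropolar equations on ℝ³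
(with all physical constants set to 1):
−Δu + (u·∇)u + ∇Π = ∇×w + (b·∇)b; −Δw + (u·∇)w = ∇(div w) + ∇×u − 2w;
−Δb + (u·∇)b = (b·∇)u; div u = 0, div b = 0. -/
structure IsMMPSolution (u w b : E3 → E3) (P : E3 → ℝ) : Prop where
  smooth_u : ContDiff ℝ (⊤ : ℕ∞) u
  smooth_w : ContDiff ℝ (⊤ : ℕ∞) w
  smooth_b : ContDiff ℝ (⊤ : ℕ∞) b
  smooth_P : ContDiff ℝ (⊤ : ℕ∞) P
  eq_u : ∀ x : E3, ∀ j : Fin 3,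
    -(lap (fun y => u y j) x) + (∑ i, u x i * pd i (fun y => u y j) x) + pd j P x
      = curl3 w x j + ∑ i, b x i * pd i (fun y => b y j) x
  eq_w : ∀ x : E3, ∀ j : Fin 3,
    -(lap (fun y => w y j) x) + (∑ i, u x i * pd i (fun y => w y j) x)
      = pd j (fun y => vdiv w y) x + curl3 u x j - 2 * w x j
  eq_b : ∀ x : E3, ∀ j : Fin 3,
    -(lap (fun y => b y j) x) + (∑ i, u x i * pd i (fun y => b y j) x)
      = ∑ i, b x i * pd i (fun y => u y j) x
  div_u : ∀ x : E3, vdiv u x = 0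
  div_b : ∀ x : E3, vdiv b x = 0

/-- Divergence of a matrix-valued function: (div Φ)ⱼ = Σᵢ ∂ᵢ Φᵢⱼ. -/
def mdiv (Φ : E3 → Fin 3 → Fin 3 → ℝ) (x : E3) (j : Fin 3) : ℝ :=
  ∑ i, pd i (fun y => Φ y i j) x

/-- Mean value of a matrix-valued function over the ball of radius `r`. -/
def mavg (Φ : E3 → Fin 3 → Fin 3 → ℝ) (r : ℝ) (i j : Fin 3) : ℝ :=
  (volume (ball3 r)).toReal⁻¹ * ∫ x in ball3 r, Φ x i j

/-- Frobenius norm of a 3×3 matrix. -/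
def frob (A : Fin 3 → Fin 3 → ℝ) : ℝ := Real.sqrt (∑ i, ∑ j, (A i j) ^ 2)

/-- The `s`-mean oscillation of `Φ` over the ball of radius `r`:
`(|B_r|⁻¹ ∫_{B_r} |Φ − Φ_{B_r}|^s dx)^(1/s)`. -/
def meanOsc (Φ : E3 → Fin 3 → Fin 3 → ℝ) (s r : ℝ) : ℝ :=
  ((volume (ball3 r)).toReal⁻¹ *
      ∫ x in ball3 r, (frob fun i j => Φ x i j - mavg Φ r i j) ^ s) ^ (1 / s)
section Basics

variable {f g : E3 → ℝ} {x : E3}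

lemma pd_add (i : Fin 3) (hf : DifferentiableAt ℝ f x) (hg : DifferentiableAt ℝ g x) :
    pd i (fun y => f y + g y) x = pd i f x + pd i g x := by
  simp only [pd]
  rw [fderiv_fun_add hf hg]; rfl

lemma pd_sub (i : Fin 3) (hf : DifferentiableAt ℝ f x) (hg : DifferentiableAt ℝ g x) :
    pd i (fun y => f y - g y) x = pd i f x - pd i g x := by
  simp only [pd]
  rw [fderiv_fun_sub hf hg]; rfl

lemma pd_mul (i : Fin 3) (hf : DifferentiableAt ℝ f x) (hg : DifferentiableAt ℝ g x) :
    pd i (fun y => f y * g y) x = pd i f x * g x + f x * pd i g x := by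
  simp only [pd]
  rw [fderiv_fun_mul hf hg]
  simp
  ring

lemma pd_neg (i : Fin 3) : pd i (fun y => - f y) x = - pd i f x := by
  simp only [pd]
  rw [fderiv_fun_neg]; rfl

lemma pd_const (i : Fin 3) (c : ℝ) : pd i (fun _ => c) x = 0 := by
  simp [pd]

lemma pd_sub_const (i : Fin 3) (c : ℝ) : pd i (fun y => f y - c) x = pd i f x := by
  simp only [pd, fderiv_sub_const]

lemma pd_sum {ι : Type*} (s : Finset ι) (i : Fin 3) {F : ι → E3 → ℝ}
    (hF : ∀ k ∈ s, DifferentiableAt ℝ (F k) x) :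
    pd i (fun y => ∑ k ∈ s, F k y) x = ∑ k ∈ s, pd i (F k) x := by
  simp only [pd]
  rw [fderiv_fun_sum hF]
  simp

/-- Chain rule for a partial derivative of a scalar function of a scalar function. -/
lemma pd_comp (i : Fin 3) {h : ℝ → ℝ} {h' : ℝ} (hh : HasDerivAt h h' (f x))
    (hf : DifferentiableAt ℝ f x) : pd i (fun y => h (f y)) x = h' * pd i f x := by
  have := (hh.comp_hasFDerivAt x hf.hasFDerivAt).fderiv
  simp only [pd]
  change fderiv ℝ (h ∘ f) x _ = _
  rw [this]
  simp

lemma pd_pow (i : Fin 3) (n : ℕ) (hf : DifferentiableAt ℝ f x) :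
    pd i (fun y => f y ^ n) x = n * f x ^ (n - 1) * pd i f x :=
  pd_comp i (hasDerivAt_pow n (f x)) hf

lemma contDiff_pd (i : Fin 3) (hf : ContDiff ℝ (⊤ : ℕ∞) f) :
    ContDiff ℝ (⊤ : ℕ∞) (pd i f) := by
  have : ContDiff ℝ (⊤ : ℕ∞) (fderiv ℝ f) := hf.fderiv_right (by simp)
  exact this.clm_apply contDiff_const

lemma continuous_pd (i : Fin 3) (hf : ContDiff ℝ 1 f) : Continuous (pd i f) :=
  (hf.continuous_fderiv (by simp)).clm_apply continuous_const

lemma pd_comm (i j : Fin 3) (hf : ContDiff ℝ (⊤ : ℕ∞) f) :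
    pd i (fun y => pd j f y) x = pd j (fun y => pd i f y) x := by
  have hd : DifferentiableAt ℝ (fderiv ℝ f) x :=
    ((hf.fderiv_right (m := (⊤ : ℕ∞)) (by simp)).differentiable (by simp)).differentiableAt
  have key : ∀ v w : E3, fderiv ℝ (fun y => fderiv ℝ f y v) x w = fderiv ℝ (fderiv ℝ f) x w v := by
    intro v w
    rw [fderiv_clm_apply hd (differentiableAt_const v)]
    simp
  have hs : IsSymmSndFDerivAt ℝ f x :=
    (hf.contDiffAt (x := x)).isSymmSndFDerivAt (by
      simp only [minSmoothness_of_isRCLikeNormedField]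
      exact WithTop.coe_le_coe.2 (le_top : (2 : ℕ∞) ≤ ⊤))
  simp only [pd, key]
  exact hs _ _

lemma pd_eq_zero_of_notMem_tsupport (i : Fin 3) (hx : x ∉ tsupport f) : pd i f x = 0 := by
  simp [pd, fderiv_of_notMem_tsupport (𝕜 := ℝ) hx]

lemma HasCompactSupport.pd (i : Fin 3) (hf : HasCompactSupport f) :
    HasCompactSupport (_root_.pd i f) :=
  hf.fderiv_apply ℝ _

lemma pd_comp_sub (i : Fin 3) (h : E3) : pd i (fun y => f (y - h)) x = pd i f (x - h) := by
  simp only [pd]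
  rw [fderiv_comp_sub]

lemma norm_fderiv_le (f : E3 → ℝ) (x : E3) : ‖fderiv ℝ f x‖ ≤ ∑ i, |pd i f x| := by
  refine ContinuousLinearMap.opNorm_le_bound _ (Finset.sum_nonneg fun i _ => abs_nonneg _) ?_
  intro v
  have hv : v = ∑ i, v i • EuclideanSpace.single i (1 : ℝ) := by
    ext j
    simp [Finset.sum_apply, Pi.single_apply]
  have : fderiv ℝ f x v = ∑ i, v i * pd i f x := by
    conv_lhs => rw [hv]
    simp [pd]
  rw [this, Finset.sum_mul]
  refine (norm_sum_le _ _).trans (Finset.sum_le_sum fun i _ => ?_)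
  rw [norm_mul, mul_comm, Real.norm_eq_abs]
  exact mul_le_mul_of_nonneg_left (by simpa using PiLp.norm_apply_le v i) (abs_nonneg _)

lemma fderiv_apply_eq_sum (f : E3 → ℝ) (x v : E3) : fderiv ℝ f x v = ∑ i, v i * pd i f x := by
  have hv : v = ∑ i, v i • EuclideanSpace.single i (1 : ℝ) := by
    ext j
    simp [Finset.sum_apply, Pi.single_apply]
  conv_lhs => rw [hv]
  simp [pd]

/-- Integration by parts against a compactly supported function. -/
lemma integral_pd_mul (i : Fin 3) (hf : ContDiff ℝ 1 f) (hg : ContDiff ℝ 1 g)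
    (hc : HasCompactSupport g) : ∫ x, pd i f x * g x = - ∫ x, f x * pd i g x := by
  have h1 : Integrable (fun x => pd i f x * g x) :=
    ((continuous_pd i hf).mul hg.continuous).integrable_of_hasCompactSupport hc.mul_left
  have h2 : Integrable (fun x => f x * pd i g x) :=
    (hf.continuous.mul (continuous_pd i hg)).integrable_of_hasCompactSupport (hc.pd i).mul_left
  have h3 : Integrable (fun x => f x * g x) :=
    (hf.continuous.mul hg.continuous).integrable_of_hasCompactSupport hc.mul_left
  have := integral_mul_fderiv_eq_neg_fderiv_mul_of_integrable (μ := (volume : Measure E3))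
    (v := EuclideanSpace.single i (1 : ℝ)) h1 h2 h3
    (fun x _ => (hf.differentiable (by simp)).differentiableAt)
    (fun x _ => (hg.differentiable (by simp)).differentiableAt)
  simp only [pd] at *
  rw [this, neg_neg]

end Basics

section Holder

variable {α : Type*} [MeasurableSpace α] {μ : Measure α}

lemma integral_le_prod_rpow {ι : Type*} (s : Finset ι) {f : ι → α → ℝ} {F : α → ℝ} {p A : ι → ℝ}
    (hf : ∀ i ∈ s, Integrable (f i) μ) (h0 : ∀ i ∈ s, ∀ x, 0 ≤ f i x)
    (hp : ∑ i ∈ s, p i = 1) (hp0 : ∀ i ∈ s, 0 ≤ p i)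
    (hA : ∀ i ∈ s, ∫ x, f i x ∂μ ≤ A i)
    (hF : ∀ x, |F x| ≤ ∏ i ∈ s, f i x ^ p i) : |∫ x, F x ∂μ| ≤ ∏ i ∈ s, A i ^ p i := by
  have hA0 : ∀ i ∈ s, 0 ≤ A i := fun i hi =>
    (integral_nonneg (h0 i hi)).trans (hA i hi)
  have hB : 0 ≤ ∏ i ∈ s, A i ^ p i := Finset.prod_nonneg fun i hi => Real.rpow_nonneg (hA0 i hi) _
  have h1 : ‖∫ x, F x ∂μ‖ₑ ≤ ENNReal.ofReal (∏ i ∈ s, A i ^ p i) := by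
    calc ‖∫ x, F x ∂μ‖ₑ ≤ ∫⁻ x, ‖F x‖ₑ ∂μ := enorm_integral_le_lintegral_enorm _
      _ ≤ ∫⁻ x, ∏ i ∈ s, ENNReal.ofReal (f i x) ^ p i ∂μ := by
          refine lintegral_mono fun x => ?_
          rw [Real.enorm_eq_ofReal_abs]
          refine (ENNReal.ofReal_le_ofReal (hF x)).trans ?_
          rw [ENNReal.ofReal_prod_of_nonneg fun i hi => Real.rpow_nonneg (h0 i hi x) _]
          refine le_of_eq (Finset.prod_congr rfl fun i hi => ?_)
          rw [ENNReal.ofReal_rpow_of_nonneg (h0 i hi x) (hp0 i hi)]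
      _ ≤ ∏ i ∈ s, (∫⁻ x, ENNReal.ofReal (f i x) ∂μ) ^ p i :=
          ENNReal.lintegral_prod_norm_pow_le s
            (fun i hi => (hf i hi).aestronglyMeasurable.aemeasurable.ennreal_ofReal) hp hp0
      _ ≤ ∏ i ∈ s, ENNReal.ofReal (A i) ^ p i := by
          refine Finset.prod_le_prod' fun i hi => ENNReal.rpow_le_rpow ?_ (hp0 i hi)
          rw [← ofReal_integral_eq_lintegral_ofReal (hf i hi) (ae_of_all _ (h0 i hi))]
          exact ENNReal.ofReal_le_ofReal (hA i hi)
      _ = ENNReal.ofReal (∏ i ∈ s, A i ^ p i) := by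
          rw [ENNReal.ofReal_prod_of_nonneg fun i hi => Real.rpow_nonneg (hA0 i hi) _]
          refine Finset.prod_congr rfl fun i hi => ?_
          rw [ENNReal.ofReal_rpow_of_nonneg (hA0 i hi) (hp0 i hi)]
  rw [Real.enorm_eq_ofReal_abs] at h1
  exact (ENNReal.ofReal_le_ofReal_iff hB).1 h1

lemma abs_integral_le_holder2 {f₁ f₂ F : α → ℝ} {p₁ p₂ A₁ A₂ : ℝ}
    (hf₁ : Integrable f₁ μ) (hf₂ : Integrable f₂ μ)
    (h₁ : ∀ x, 0 ≤ f₁ x) (h₂ : ∀ x, 0 ≤ f₂ x)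
    (hp₁ : 0 ≤ p₁) (hp₂ : 0 ≤ p₂) (hp : p₁ + p₂ = 1)
    (hA₁ : ∫ x, f₁ x ∂μ ≤ A₁) (hA₂ : ∫ x, f₂ x ∂μ ≤ A₂)
    (hF : ∀ x, |F x| ≤ f₁ x ^ p₁ * f₂ x ^ p₂) :
    |∫ x, F x ∂μ| ≤ A₁ ^ p₁ * A₂ ^ p₂ := by
  have := integral_le_prod_rpow (μ := μ) (F := F) Finset.univ (f := ![f₁, f₂]) (p := ![p₁, p₂])
    (A := ![A₁, A₂]) (by simp [Fin.forall_fin_succ, *]) (by simp [Fin.forall_fin_succ, *])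
    (by simp [Fin.sum_univ_succ, hp]) (by simp [Fin.forall_fin_succ, *])
    (by simp [Fin.forall_fin_succ, *]) (by simpa [Fin.prod_univ_succ] using hF)
  simpa [Fin.prod_univ_succ] using this

lemma abs_integral_le_holder3 {f₁ f₂ f₃ F : α → ℝ} {p₁ p₂ p₃ A₁ A₂ A₃ : ℝ}
    (hf₁ : Integrable f₁ μ) (hf₂ : Integrable f₂ μ) (hf₃ : Integrable f₃ μ)
    (h₁ : ∀ x, 0 ≤ f₁ x) (h₂ : ∀ x, 0 ≤ f₂ x) (h₃ : ∀ x, 0 ≤ f₃ x)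
    (hp₁ : 0 ≤ p₁) (hp₂ : 0 ≤ p₂) (hp₃ : 0 ≤ p₃) (hp : p₁ + p₂ + p₃ = 1)
    (hA₁ : ∫ x, f₁ x ∂μ ≤ A₁) (hA₂ : ∫ x, f₂ x ∂μ ≤ A₂) (hA₃ : ∫ x, f₃ x ∂μ ≤ A₃)
    (hF : ∀ x, |F x| ≤ f₁ x ^ p₁ * f₂ x ^ p₂ * f₃ x ^ p₃) :
    |∫ x, F x ∂μ| ≤ A₁ ^ p₁ * A₂ ^ p₂ * A₃ ^ p₃ := by
  have := integral_le_prod_rpow (μ := μ) (F := F) Finset.univ (f := ![f₁, f₂, f₃])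
    (p := ![p₁, p₂, p₃])
    (A := ![A₁, A₂, A₃]) (by simp [Fin.forall_fin_succ, *]) (by simp [Fin.forall_fin_succ, *])
    (by simp [Fin.sum_univ_succ, ← hp, add_assoc]) (by simp [Fin.forall_fin_succ, *])
    (by simp [Fin.forall_fin_succ, *]) (by simpa [Fin.prod_univ_succ, mul_assoc] using hF)
  simpa [Fin.prod_univ_succ, mul_assoc] using this

lemma abs_integral_le_holder4 {f₁ f₂ f₃ f₄ F : α → ℝ} {p₁ p₂ p₃ p₄ A₁ A₂ A₃ A₄ : ℝ}
    (hf₁ : Integrable f₁ μ) (hf₂ : Integrable f₂ μ) (hf₃ : Integrable f₃ μ)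
    (hf₄ : Integrable f₄ μ)
    (h₁ : ∀ x, 0 ≤ f₁ x) (h₂ : ∀ x, 0 ≤ f₂ x) (h₃ : ∀ x, 0 ≤ f₃ x) (h₄ : ∀ x, 0 ≤ f₄ x)
    (hp₁ : 0 ≤ p₁) (hp₂ : 0 ≤ p₂) (hp₃ : 0 ≤ p₃) (hp₄ : 0 ≤ p₄) (hp : p₁ + p₂ + p₃ + p₄ = 1)
    (hA₁ : ∫ x, f₁ x ∂μ ≤ A₁) (hA₂ : ∫ x, f₂ x ∂μ ≤ A₂) (hA₃ : ∫ x, f₃ x ∂μ ≤ A₃)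
    (hA₄ : ∫ x, f₄ x ∂μ ≤ A₄)
    (hF : ∀ x, |F x| ≤ f₁ x ^ p₁ * f₂ x ^ p₂ * f₃ x ^ p₃ * f₄ x ^ p₄) :
    |∫ x, F x ∂μ| ≤ A₁ ^ p₁ * A₂ ^ p₂ * A₃ ^ p₃ * A₄ ^ p₄ := by
  have := integral_le_prod_rpow (μ := μ) (F := F) Finset.univ (f := ![f₁, f₂, f₃, f₄])
    (p := ![p₁, p₂, p₃, p₄])
    (A := ![A₁, A₂, A₃, A₄]) (by simp [Fin.forall_fin_succ, *]) (by simp [Fin.forall_fin_succ, *])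
    (by simp [Fin.sum_univ_succ, ← hp, add_assoc]) (by simp [Fin.forall_fin_succ, *])
    (by simp [Fin.forall_fin_succ, *]) (by simpa [Fin.prod_univ_succ, mul_assoc] using hF)
  simpa [Fin.prod_univ_succ, mul_assoc] using this

end Holder
section Cutoff

lemma exists_bound_deriv_smoothTransition :
    ∃ M : ℝ, 0 ≤ M ∧ (∀ t, |deriv Real.smoothTransition t| ≤ M) ∧
      (∀ t, |deriv (deriv Real.smoothTransition) t| ≤ M) ∧
      (∀ t < 0, deriv Real.smoothTransition t = 0) ∧
      (∀ t < 0, deriv (deriv Real.smoothTransition) t = 0) := by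
  have hS : ContDiff ℝ (⊤ : ℕ∞) Real.smoothTransition := Real.smoothTransition.contDiff
  have hS1 : ContDiff ℝ (⊤ : ℕ∞) (deriv Real.smoothTransition) :=
    (contDiff_infty_iff_deriv.1 hS).2
  have hS2 : ContDiff ℝ (⊤ : ℕ∞) (deriv (deriv Real.smoothTransition)) :=
    (contDiff_infty_iff_deriv.1 hS1).2
  have n1 : ∀ t < 0, Real.smoothTransition =ᶠ[𝓝 t] fun _ => 0 := fun t ht => by
    filter_upwards [Iio_mem_nhds ht] with y hy using Real.smoothTransition.zero_of_nonpos hy.le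
  have p1 : ∀ t > 1, Real.smoothTransition =ᶠ[𝓝 t] fun _ => 1 := fun t ht => by
    filter_upwards [Ioi_mem_nhds ht] with y hy using Real.smoothTransition.one_of_one_le hy.le
  have n2 : ∀ t < 0, deriv Real.smoothTransition t = 0 := fun t ht => by
    rw [(n1 t ht).deriv_eq]; simp
  have p2 : ∀ t > 1, deriv Real.smoothTransition t = 0 := fun t ht => by
    rw [(p1 t ht).deriv_eq]; simp
  have n3 : ∀ t < 0, deriv (deriv Real.smoothTransition) t = 0 := fun t ht => by
    have : deriv Real.smoothTransition =ᶠ[𝓝 t] fun _ => 0 := by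
      filter_upwards [Iio_mem_nhds ht] with y hy using n2 y hy
    rw [this.deriv_eq]; simp
  have p3 : ∀ t > 1, deriv (deriv Real.smoothTransition) t = 0 := fun t ht => by
    have : deriv Real.smoothTransition =ᶠ[𝓝 t] fun _ => 0 := by
      filter_upwards [Ioi_mem_nhds ht] with y hy using p2 y hy
    rw [this.deriv_eq]; simp
  obtain ⟨M₁, h₁⟩ := (isCompact_Icc (a := (0 : ℝ)) (b := 1)).exists_bound_of_continuousOn
    hS1.continuous.continuousOn
  obtain ⟨M₂, h₂⟩ := (isCompact_Icc (a := (0 : ℝ)) (b := 1)).exists_bound_of_continuousOn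
    hS2.continuous.continuousOn
  refine ⟨max (max M₁ M₂) 0, le_max_right _ _, fun t => ?_, fun t => ?_, n2, n3⟩
  · rcases lt_or_ge t 0 with h | h
    · rw [n2 t h]; simp
    rcases lt_or_ge 1 t with h' | h'
    · rw [p2 t h']; simp
    exact (h₁ t ⟨h, h'⟩).trans ((le_max_left _ _).trans (le_max_left _ _))
  · rcases lt_or_ge t 0 with h | h
    · rw [n3 t h]; simp
    rcases lt_or_ge 1 t with h' | h'
    · rw [p3 t h']; simp
    exact (h₂ t ⟨h, h'⟩).trans ((le_max_right _ _).trans (le_max_left _ _))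

lemma pd_norm_sq (i : Fin 3) (x : E3) : pd i (fun y => ‖y‖ ^ 2) x = 2 * x i := by
  simp only [pd]
  have := (hasStrictFDerivAt_norm_sq x).hasFDerivAt.fderiv
  rw [this]
  simp [EuclideanSpace.inner_single_right]

lemma pd_coord (i j : Fin 3) (x : E3) : pd i (fun y => y j) x = if i = j then 1 else 0 := by
  simp only [pd]
  have : fderiv ℝ (fun y : E3 => y j) x = EuclideanSpace.proj (𝕜 := ℝ) j :=
    (EuclideanSpace.proj (𝕜 := ℝ) j : E3 →L[ℝ] ℝ).hasFDerivAt.fderiv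
  rw [this]
  simp [eq_comm]

/-- Smooth radial cutoff functions with derivative bounds uniform in the radii. -/
lemma exists_cutoff : ∃ C : ℝ, 1 ≤ C ∧ ∀ a b : ℝ, 0 < a → a < b → ∃ φ : E3 → ℝ,
    ContDiff ℝ (⊤ : ℕ∞) φ ∧ (∀ x, 0 ≤ φ x) ∧ (∀ x, φ x ≤ 1) ∧ (∀ x, ‖x‖ ≤ a → φ x = 1) ∧
    (∀ x, b ≤ ‖x‖ → φ x = 0) ∧ (∀ i x, |pd i φ x| ≤ C / (b - a)) ∧
    (∀ i j x, |pd i (fun y => pd j φ y) x| ≤ C / (b - a) ^ 2) := by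
  obtain ⟨M, hM0, hM1, hM2, hz1, hz2⟩ := exists_bound_deriv_smoothTransition
  refine ⟨6 * M + 1, by linarith, fun a b ha hab => ?_⟩
  set S := Real.smoothTransition with hSdef
  have hS : ContDiff ℝ (⊤ : ℕ∞) S := Real.smoothTransition.contDiff
  have hS1 : ContDiff ℝ (⊤ : ℕ∞) (deriv S) := (contDiff_infty_iff_deriv.1 hS).2
  have hw : 0 < b ^ 2 - a ^ 2 := by nlinarith
  set c : ℝ := (b ^ 2 - a ^ 2)⁻¹ with hc
  have hc0 : 0 < c := inv_pos.2 hw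
  set q : E3 → ℝ := fun x => b ^ 2 * c - c * ‖x‖ ^ 2 with hq
  have hqs : ContDiff ℝ (⊤ : ℕ∞) q :=
    contDiff_const.sub (contDiff_const.mul (contDiff_norm_sq ℝ))
  have hqd : ∀ x, DifferentiableAt ℝ q x := fun x =>
    (hqs.differentiable (by simp)).differentiableAt
  have hpq : ∀ i x, pd i q x = -(2 * c) * x i := by
    intro i x
    have hn : DifferentiableAt ℝ (fun y : E3 => ‖y‖ ^ 2) x :=
      ((contDiff_norm_sq ℝ (n := 1)).differentiable (by simp)).differentiableAt
    rw [hq, pd_sub i (by fun_prop) (hn.const_mul c), pd_const,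
      pd_mul i (differentiableAt_const _) hn, pd_const, pd_norm_sq]
    ring
  have hpd : ∀ i x, pd i (fun y => S (q y)) x = deriv S (q x) * (-(2 * c) * x i) := by
    intro i x
    rw [pd_comp i ((hS.differentiable (by simp)).differentiableAt.hasDerivAt) (hqd x), hpq]
  have hqneg : ∀ x : E3, b < ‖x‖ → q x < 0 := by
    intro x hx
    have : b ^ 2 < ‖x‖ ^ 2 := by nlinarith [norm_nonneg x]
    simp only [hq]
    nlinarith
  have hcoord : ∀ (x : E3) i, |x i| ≤ ‖x‖ := fun x i => by
    simpa using PiLp.norm_apply_le x i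
  have hcb : c * b ≤ 1 / (b - a) := by
    rw [hc, inv_mul_eq_div, div_le_div_iff₀ hw (by linarith)]
    nlinarith
  have hcb2 : c ≤ 1 / (b - a) ^ 2 := by
    rw [hc, ← one_div]
    exact one_div_le_one_div_of_le (by nlinarith) (by nlinarith)
  have hba : 0 < b - a := by linarith
  refine ⟨fun x => S (q x), hS.comp hqs, fun x => Real.smoothTransition.nonneg _,
    fun x => Real.smoothTransition.le_one _, fun x hx => ?_, fun x hx => ?_, fun i x => ?_,
    fun i j x => ?_⟩
  · apply Real.smoothTransition.one_of_one_le
    have : ‖x‖ ^ 2 ≤ a ^ 2 := by nlinarith [norm_nonneg x]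
    have h2 : c * (b ^ 2 - a ^ 2) = 1 := inv_mul_cancel₀ hw.ne'
    simp only [hq]
    nlinarith
  · apply Real.smoothTransition.zero_of_nonpos
    have : b ^ 2 ≤ ‖x‖ ^ 2 := by nlinarith [norm_nonneg x]
    simp only [hq]
    nlinarith
  · rw [hpd]
    rcases lt_or_ge b ‖x‖ with h | h
    · rw [hz1 _ (hqneg x h)]
      simp only [zero_mul, abs_zero]
      positivity
    · have h1 := hM1 (q x)
      have h2 : |-(2 * c) * x i| ≤ 2 / (b - a) := by
        rw [abs_mul, abs_neg, abs_of_pos (by linarith : 0 < 2 * c)]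
        calc 2 * c * |x i| ≤ 2 * c * b := by gcongr; exact (hcoord x i).trans h
          _ = 2 * (c * b) := by ring
          _ ≤ 2 * (1 / (b - a)) := by gcongr
          _ = _ := by ring
      rw [abs_mul]
      calc _ ≤ M * (2 / (b - a)) := by gcongr
        _ = (2 * M) / (b - a) := by ring
        _ ≤ _ := by gcongr; linarith
  · have hfun : (fun y => pd j (fun y => S (q y)) y)
        = fun y => deriv S (q y) * (-(2 * c) * y j) := funext fun y => hpd j y
    have hd1 : DifferentiableAt ℝ (fun y => deriv S (q y)) x :=
      ((hS1.comp hqs).differentiable (by simp)).differentiableAt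
    have hd2 : DifferentiableAt ℝ (fun y : E3 => y j) x :=
      (EuclideanSpace.proj (𝕜 := ℝ) j : E3 →L[ℝ] ℝ).differentiableAt
    rw [hfun, pd_mul i hd1 (hd2.const_mul _),
      pd_comp i ((hS1.differentiable (by simp)).differentiableAt.hasDerivAt) (hqd x), hpq,
      pd_mul i (differentiableAt_const _) hd2, pd_const, pd_coord]
    rcases lt_or_ge b ‖x‖ with h | h
    · rw [hz1 _ (hqneg x h), hz2 _ (hqneg x h)]
      simp only [zero_mul, add_zero, abs_zero]
      positivity
    · have e1 : ∀ k, |-(2 * c) * x k| ≤ 2 / (b - a) := by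
        intro k
        rw [abs_mul, abs_neg, abs_of_pos (by linarith : 0 < 2 * c)]
        calc 2 * c * |x k| ≤ 2 * c * b := by gcongr; exact (hcoord x k).trans h
          _ = 2 * (c * b) := by ring
          _ ≤ 2 * (1 / (b - a)) := by gcongr
          _ = _ := by ring
      have e2 : |0 * x j + -(2 * c) * (if i = j then (1 : ℝ) else 0)| ≤ 2 / (b - a) ^ 2 := by
        have h3 : 2 * c ≤ 2 / (b - a) ^ 2 := by
          calc 2 * c ≤ 2 * (1 / (b - a) ^ 2) := by gcongr
            _ = _ := by ring
        split_ifs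
        · rw [zero_mul, zero_add, mul_one, abs_neg, abs_of_pos (by linarith)]
          exact h3
        · simp; positivity
      calc _ ≤ |deriv (deriv S) (q x) * (-(2 * c) * x i) * (-(2 * c) * x j)|
            + |deriv S (q x) * (0 * x j + -(2 * c) * (if i = j then (1 : ℝ) else 0))| :=
            abs_add_le _ _
        _ ≤ M * (2 / (b - a)) * (2 / (b - a)) + M * (2 / (b - a) ^ 2) := by
            refine add_le_add ?_ ?_
            · rw [abs_mul, abs_mul]
              exact mul_le_mul (mul_le_mul (hM2 _) (e1 i) (abs_nonneg _) hM0) (e1 j)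
                (abs_nonneg _) (by positivity)
            · rw [abs_mul]
              exact mul_le_mul (hM1 _) e2 (abs_nonneg _) hM0
        _ = 6 * M / (b - a) ^ 2 := by field_simp; ring
        _ ≤ _ := by gcongr; linarith

end Cutoff

section Sobolev

/-- The Sobolev inequality on three-dimensional space for compactly supported functions. -/
lemma exists_sobolev : ∃ C : ℝ, 0 ≤ C ∧ ∀ g : E3 → ℝ, ContDiff ℝ 1 g → HasCompactSupport g →
    ∫ x, g x ^ 6 ≤ C * (∑ i, ∫ x, pd i g x ^ 2) ^ 3 := by
  set K : ℝ := (eLpNormLESNormFDerivOfEqInnerConst (volume : Measure E3) ((2 : NNReal) : ℝ) : ℝ)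
    with hK
  have hK0 : 0 ≤ K := NNReal.coe_nonneg _
  refine ⟨K ^ 6 * 27, by positivity, fun g hg hc => ?_⟩
  have hfin : Module.finrank ℝ E3 = 3 := by simp
  have key := eLpNorm_le_eLpNorm_fderiv_of_eq_inner (volume : Measure E3) hg hc
    (p := 2) (p' := 6) (by norm_num) (by rw [hfin]; norm_num)
    (by rw [hfin]; norm_num)
  have hcd : Continuous (fderiv ℝ g) := hg.continuous_fderiv (by simp)
  have hm6 : MemLp g ((6 : NNReal) : ℝ≥0∞) volume := hg.continuous.memLp_of_hasCompactSupport hc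
  have hm2 : MemLp (fderiv ℝ g) ((2 : NNReal) : ℝ≥0∞) volume :=
    hcd.memLp_of_hasCompactSupport (hc.fderiv ℝ)
  rw [hm6.eLpNorm_eq_integral_rpow_norm (by norm_num) (by norm_num),
    hm2.eLpNorm_eq_integral_rpow_norm (by norm_num) (by norm_num)] at key
  simp only [ENNReal.coe_toReal, NNReal.coe_ofNat] at key
  set A := ∫ x, ‖g x‖ ^ (6 : ℝ) with hA
  set B := ∫ x, ‖fderiv ℝ g x‖ ^ (2 : ℝ) with hB
  have hA0 : 0 ≤ A := integral_nonneg fun x => by positivity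
  have hB0 : 0 ≤ B := integral_nonneg fun x => by positivity
  have key2 : A ^ (6 : ℝ)⁻¹ ≤ K * B ^ (2 : ℝ)⁻¹ := by
    rw [← ENNReal.ofReal_le_ofReal_iff (by positivity), ENNReal.ofReal_mul hK0]
    convert key using 2
    rw [hK, ENNReal.ofReal_coe_nnreal]
    rfl
  have key3 : A ≤ K ^ 6 * B ^ 3 := by
    have := pow_le_pow_left₀ (by positivity) key2 6
    rw [mul_pow, ← Real.rpow_natCast (A ^ _), ← Real.rpow_mul hA0,
      ← Real.rpow_natCast (B ^ _), ← Real.rpow_mul hB0] at this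
    norm_num at this
    simpa using this
  have hAe : A = ∫ x, g x ^ 6 := by
    refine integral_congr_ae (ae_of_all _ fun x => ?_)
    simp only
    rw [show (6 : ℝ) = ((6 : ℕ) : ℝ) by norm_num, Real.rpow_natCast, Real.norm_eq_abs,
      Even.pow_abs (by decide)]
  have hIntg : ∀ i, Integrable (fun x => pd i g x ^ 2) := fun i => by
    refine ((continuous_pd i hg).pow 2).integrable_of_hasCompactSupport ?_
    have := hc.pd i
    simp only [pow_two]
    exact this.mul_left
  have hBe : B ≤ 3 * ∑ i, ∫ x, pd i g x ^ 2 := by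
    rw [← integral_finsetSum _ fun i _ => hIntg i, ← integral_const_mul]
    refine integral_mono ?_ ((integrable_finsetSum _ fun i _ => hIntg i).const_mul _) fun x => ?_
    · have : Integrable (fun x => ‖fderiv ℝ g x‖ ^ (2 : ℕ)) := by
        refine (hcd.norm.pow 2).integrable_of_hasCompactSupport ?_
        simp only [pow_two]
        exact ((hc.fderiv ℝ).norm).mul_left
      refine this.congr (ae_of_all _ fun x => ?_)
      simp only
      rw [← Real.rpow_natCast]; norm_num
    · simp only
      rw [show (2 : ℝ) = ((2 : ℕ) : ℝ) by norm_num, Real.rpow_natCast]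
      calc ‖fderiv ℝ g x‖ ^ 2 ≤ (∑ i, |pd i g x|) ^ 2 := by
            gcongr; exact norm_fderiv_le g x
        _ ≤ _ := by
          have := sq_sum_le_card_mul_sum_sq (s := Finset.univ) (f := fun i => |pd i g x|)
          simpa using this
  rw [← hAe]
  calc A ≤ K ^ 6 * B ^ 3 := key3
    _ ≤ K ^ 6 * (3 * ∑ i, ∫ x, pd i g x ^ 2) ^ 3 := by gcongr
    _ = _ := by ring

end Sobolev
section LocalEstimates

lemma integrableOn_of_subset_ball3 {S : Set E3} {R : ℝ} (hS : S ⊆ ball3 R) {f : E3 → ℝ}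
    (hf : Continuous f) : IntegrableOn f S :=
  (hf.continuousOn.integrableOn_compact (isCompact_closedBall (0 : E3) R)).mono_set
    (hS.trans Metric.ball_subset_closedBall)

lemma volume_ball3_toReal {R : ℝ} (hR : 0 ≤ R) :
    (volume (ball3 R)).toReal = 4 / 3 * π * R ^ 3 := by
  rw [ball3, EuclideanSpace.volume_ball_fin_three]
  rw [ENNReal.toReal_mul, ← ENNReal.ofReal_pow hR, ENNReal.toReal_ofReal (by positivity),
    ENNReal.toReal_ofReal (by positivity)]
  ring

lemma volume_ball3_le {R : ℝ} (hR : 0 ≤ R) : (volume (ball3 R)).toReal ≤ 5 * R ^ 3 := by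
  rw [volume_ball3_toReal hR]
  have := Real.pi_lt_d2
  gcongr
  linarith

lemma setIntegral_const_one_le {S : Set E3} {R : ℝ} (hR : 0 ≤ R) (hS : S ⊆ ball3 R) :
    ∫ _ in S, (1 : ℝ) ≤ 5 * R ^ 3 := by
  rw [setIntegral_const, smul_eq_mul, mul_one, measureReal_def]
  refine (ENNReal.toReal_mono ?_ (measure_mono hS)).trans (volume_ball3_le hR)
  exact measure_ball_lt_top.ne

lemma hasDerivAt_mul_abs_self (t : ℝ) : HasDerivAt (fun t : ℝ => t * |t|) (2 * |t|) t := by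
  rcases lt_trichotomy t 0 with h | h | h
  · have h1 : HasDerivAt (fun t : ℝ => -t ^ 2) (2 * |t|) t := by
      rw [abs_of_neg h]
      simpa using (hasDerivAt_pow 2 t).fun_neg
    refine h1.congr_of_eventuallyEq ?_
    filter_upwards [eventually_lt_nhds h] with y hy
    rw [abs_of_neg hy]; ring
  · subst h
    rw [hasDerivAt_iff_isLittleO_nhds_zero]
    simp only [zero_add, abs_zero, mul_zero, sub_zero, smul_zero]
    have : (fun h : ℝ => h * |h|) =o[𝓝 0] fun h : ℝ => h * 1 := by
      refine (Asymptotics.isBigO_refl _ _).mul_isLittleO ?_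
      rw [Asymptotics.isLittleO_one_iff]
      simpa using (continuous_abs (G := ℝ)).tendsto 0
    simpa using this
  · have h1 : HasDerivAt (fun t : ℝ => t ^ 2) (2 * |t|) t := by
      rw [abs_of_pos h]
      simpa using hasDerivAt_pow 2 t
    refine h1.congr_of_eventuallyEq ?_
    filter_upwards [eventually_gt_nhds h] with y hy
    rw [abs_of_pos hy]; ring

lemma contDiff_mul_abs_self : ContDiff ℝ 1 (fun t : ℝ => t * |t|) := by
  rw [contDiff_one_iff_deriv]
  refine ⟨fun t => (hasDerivAt_mul_abs_self t).differentiableAt, ?_⟩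
  have : deriv (fun t : ℝ => t * |t|) = fun t => 2 * |t| :=
    funext fun t => (hasDerivAt_mul_abs_self t).deriv
  rw [this]
  fun_prop

/-- Absorbing sublinear powers. -/
lemma le_of_le_rpow_add_rpow {J A B a : ℝ} (hJ : 0 ≤ J) (hA : 0 ≤ A) (hB : 0 ≤ B)
    (ha1 : a < 1) (h : J ≤ A * J ^ a + B * J ^ (2 / 3 : ℝ)) :
    J ≤ (2 * A) ^ (1 / (1 - a)) + (2 * B) ^ 3 := by
  have aux : ∀ {T c : ℝ}, 0 ≤ T → c < 1 → 0 < J → J ≤ T * J ^ c → J ≤ T ^ (1 / (1 - c)) := by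
    intro T c hT hc hJ' hle
    have h1 : J ^ (1 - c) ≤ T := by
      rw [Real.rpow_sub hJ', Real.rpow_one, div_le_iff₀ (Real.rpow_pos_of_pos hJ' _)]
      exact hle
    have h2 := Real.rpow_le_rpow (Real.rpow_nonneg hJ _) h1
      (one_div_nonneg.2 (by linarith : 0 ≤ 1 - c))
    rwa [← Real.rpow_mul hJ, mul_one_div_cancel (by linarith), Real.rpow_one] at h2
  rcases hJ.eq_or_lt with h0 | h0
  · rw [← h0]; positivity
  rcases le_total (B * J ^ (2 / 3 : ℝ)) (A * J ^ a) with hle | hle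
  · have := aux (T := 2 * A) (c := a) (by positivity) ha1 h0 (by linarith)
    have h3 : 0 ≤ (2 * B) ^ 3 := by positivity
    linarith
  · have := aux (T := 2 * B) (c := 2 / 3) (by positivity) (by norm_num) h0 (by linarith)
    have h3 : 0 ≤ (2 * A) ^ (1 / (1 - a)) := by positivity
    rw [show (1 / (1 - 2 / 3) : ℝ) = (3 : ℕ) by norm_num, Real.rpow_natCast] at this
    linarith

lemma pd_eq_zero_of_nonneg_of_eq_zero {η : E3 → ℝ} (h0 : ∀ x, 0 ≤ η x) (i : Fin 3) {x : E3}
    (hx : η x = 0) : pd i η x = 0 := by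
  have : IsLocalMin η x := Filter.Eventually.of_forall fun y => by rw [hx]; exact h0 y
  simp [pd, this.fderiv_eq_zero]

/-- The square integral is controlled by the integral of the power `s`. -/
lemma setIntegral_sq_le_of_rpow {s K R : ℝ} {f : E3 → ℝ} {S : Set E3} (hs : 3 < s) (hK : 1 ≤ K)
    (hR : 1 ≤ R) (hS : S ⊆ ball3 R) (hf : Continuous f)
    (h : ∫ x in S, |f x| ^ s ≤ K * R ^ (s / 3 + 2)) :
    ∫ x in S, f x ^ 2 ≤ (5 * K * R ^ (11 / 6 - 1 / s)) ^ 2 := by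
  have hR0 : 0 < R := by linarith
  have hs0 : (0 : ℝ) < s := by linarith
  have hs2 : 2 / s ≤ 1 := by rw [div_le_one hs0]; linarith
  have := abs_integral_le_holder2 (μ := volume.restrict S) (F := fun x => f x ^ 2)
    (f₁ := fun x => |f x| ^ s) (f₂ := fun _ => 1) (p₁ := 2 / s) (p₂ := 1 - 2 / s)
    (integrableOn_of_subset_ball3 hS (hf.abs.rpow_const fun x => Or.inr hs0.le))
    (integrableOn_of_subset_ball3 hS continuous_const)
    (fun x => by positivity) (fun x => by positivity) (by positivity) (by linarith) (by ring)
    h (setIntegral_const_one_le hR0.le hS) (fun x => by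
      rw [← Real.rpow_mul (abs_nonneg _), mul_div_cancel₀ _ hs0.ne', Real.one_rpow, mul_one,
        abs_pow, Real.rpow_two])
  refine (le_abs_self _).trans (this.trans ?_)
  have e1 : K ^ (2 / s) ≤ K := by
    simpa using Real.rpow_le_rpow_of_exponent_le hK hs2
  have e2 : (5 : ℝ) ^ (1 - 2 / s) ≤ 5 := by
    have : 1 - 2 / s ≤ 1 := by have : 0 ≤ 2 / s := by positivity
                               linarith
    simpa using Real.rpow_le_rpow_of_exponent_le (by norm_num : (1 : ℝ) ≤ 5) this
  rw [Real.mul_rpow (by linarith) (by positivity), Real.mul_rpow (by norm_num) (by positivity),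
    ← Real.rpow_mul hR0.le, ← Real.rpow_natCast R 3, ← Real.rpow_mul hR0.le]
  have e3 : R ^ ((s / 3 + 2) * (2 / s)) * R ^ (((3 : ℕ) : ℝ) * (1 - 2 / s))
      = (R ^ (11 / 6 - 1 / s)) ^ 2 := by
    rw [← Real.rpow_add hR0, ← Real.rpow_natCast (R ^ _), ← Real.rpow_mul hR0.le]
    congr 1
    push_cast
    field_simp
    ring
  calc _ = (K ^ (2 / s) * 5 ^ (1 - 2 / s)) *
        (R ^ ((s / 3 + 2) * (2 / s)) * R ^ (((3 : ℕ) : ℝ) * (1 - 2 / s))) := by ring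
    _ ≤ (K * 5) * (R ^ (11 / 6 - 1 / s)) ^ 2 := by
        rw [e3]; gcongr
    _ ≤ _ := by
        rw [mul_pow]
        gcongr
        nlinarith

/-- Data of a scalar function written as a divergence, localized by a cutoff. -/
structure LocalData (s K : ℝ) (φ : Fin 3 → E3 → ℝ) (f η : E3 → ℝ) (S : Set E3) (R κ D : ℝ) :
    Prop where
  one_le_R : 1 ≤ R
  one_le_κ : 1 ≤ κ
  le_D : R ^ (-1 / 3 : ℝ) ≤ D
  smooth_φ : ∀ i, ContDiff ℝ (⊤ : ℕ∞) (φ i)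
  smooth_f : ContDiff ℝ (⊤ : ℕ∞) f
  div_eq : ∀ x, f x = ∑ i, pd i (φ i) x
  smooth_η : ContDiff ℝ (⊤ : ℕ∞) η
  η_nonneg : ∀ x, 0 ≤ η x
  η_le_one : ∀ x, η x ≤ 1
  η_eq_zero : ∀ x, x ∉ S → η x = 0
  subset_ball : S ⊆ ball3 R
  meas_S : MeasurableSet S
  pd_η_le : ∀ i x, |pd i η x| ≤ κ / R
  φ_le : ∀ i, ∫ x in ball3 R, |φ i x| ^ s ≤ K * R ^ (s / 3 + 2)
  grad_le : ∀ i, ∫ x in S, pd i f x ^ 2 ≤ D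

namespace LocalData

variable {s K : ℝ} {φ : Fin 3 → E3 → ℝ} {f η : E3 → ℝ} {S : Set E3} {R κ D : ℝ}

lemma D_pos (h : LocalData s K φ f η S R κ D) : 0 < D :=
  (Real.rpow_pos_of_pos (by linarith [h.one_le_R]) _).trans_le h.le_D

lemma integrableOn (h : LocalData s K φ f η S R κ D) {g : E3 → ℝ} (hg : Continuous g) :
    IntegrableOn g S :=
  integrableOn_of_subset_ball3 h.subset_ball hg

lemma hasCompactSupport (h : LocalData s K φ f η S R κ D) : HasCompactSupport η :=
  HasCompactSupport.intro (isCompact_closedBall (0 : E3) R) fun x hx =>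
    h.η_eq_zero x fun hxS => hx (Metric.ball_subset_closedBall (h.subset_ball hxS))

lemma setIntegral_eq (h : LocalData s K φ f η S R κ D) {g : E3 → ℝ}
    (hg : ∀ x, x ∉ S → g x = 0) : ∫ x, g x = ∫ x in S, g x :=
  (setIntegral_eq_integral_of_forall_compl_eq_zero fun x hx => hg x hx).symm

lemma φ_le_S (hs : 3 < s) (h : LocalData s K φ f η S R κ D) (i : Fin 3) :
    ∫ x in S, |φ i x| ^ s ≤ K * R ^ (s / 3 + 2) := by
  refine le_trans ?_ (h.φ_le i)
  refine setIntegral_mono_set (integrableOn_of_subset_ball3 (subset_refl _) ?_) ?_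
    h.subset_ball.eventuallyLE
  · exact ((h.smooth_φ i).continuous.abs).rpow_const fun x => Or.inr (by linarith)
  · exact ae_of_all _ fun x => by positivity

lemma φ_sq_le (hs : 3 < s) (hK : 1 ≤ K) (h : LocalData s K φ f η S R κ D) (i : Fin 3) :
    ∫ x in S, φ i x ^ 2 ≤ (5 * K * R ^ (11 / 6 - 1 / s)) ^ 2 :=
  setIntegral_sq_le_of_rpow hs hK h.one_le_R h.subset_ball (h.smooth_φ i).continuous
    (h.φ_le_S hs i)

lemma scale_le (hs : 3 < s) (h : LocalData s K φ f η S R κ D) :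
    R ^ (11 / 6 - 1 / s) ≤ R ^ 2 * D ^ (1 / 2 : ℝ) := by
  have hR0 : 0 < R := by linarith [h.one_le_R]
  have h1 : R ^ (-1 / 6 : ℝ) ≤ D ^ (1 / 2 : ℝ) := by
    have := Real.rpow_le_rpow (by positivity) h.le_D (by norm_num : (0 : ℝ) ≤ 1 / 2)
    rw [← Real.rpow_mul hR0.le] at this
    norm_num at this ⊢
    exact this
  calc R ^ (11 / 6 - 1 / s) ≤ R ^ (2 + -1 / 6 : ℝ) := by
        apply Real.rpow_le_rpow_of_exponent_le h.one_le_R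
        have : 0 ≤ 1 / s := by positivity
        linarith
    _ = R ^ 2 * R ^ (-1 / 6 : ℝ) := by
        rw [Real.rpow_add hR0]; norm_num
    _ ≤ _ := by gcongr

/-- Interpolated local square-integral bound. -/
lemma sq_le (hs : 3 < s) (hK : 1 ≤ K) (h : LocalData s K φ f η S R κ D) :
    ∫ x, (f x * η x) ^ 2 ≤ 1000 * K ^ 2 * κ ^ 2 * R ^ (11 / 6 - 1 / s) * D ^ (1 / 2 : ℝ) := by
  have hR := h.one_le_R
  have hR0 : 0 < R := by linarith
  have hκ := h.one_le_κ
  have hD := h.D_pos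
  set Y := R ^ (11 / 6 - 1 / s) with hY
  have hY0 : 0 < Y := by positivity
  set X := ∫ x, (f x * η x) ^ 2 with hX
  have hX0 : 0 ≤ X := integral_nonneg fun x => by positivity
  have hfc := h.smooth_f.continuous
  have hηc := h.smooth_η.continuous
  have hXS : X = ∫ x in S, (f x * η x) ^ 2 :=
    h.setIntegral_eq fun x hx => by simp [h.η_eq_zero x hx]
  have hf1 : ContDiff ℝ 1 f := h.smooth_f.of_le (by simp)
  have hη1 : ContDiff ℝ 1 η := h.smooth_η.of_le (by simp)
  have hg1 : ContDiff ℝ 1 (fun x => f x * η x ^ 2) := hf1.mul (hη1.pow 2)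
  have hgc : HasCompactSupport (fun x => f x * η x ^ 2) := by
    have := h.hasCompactSupport
    simp only [pow_two]
    exact (this.mul_left).mul_left
  have hpg : ∀ i x, pd i (fun x => f x * η x ^ 2) x
      = pd i f x * η x ^ 2 + 2 * (f x * η x) * pd i η x := by
    intro i x
    have d1 : DifferentiableAt ℝ f x := (hf1.differentiable (by simp)).differentiableAt
    have d2 : DifferentiableAt ℝ η x := (hη1.differentiable (by simp)).differentiableAt
    rw [pd_mul i d1 (g := fun y => η y ^ 2) (by fun_prop), pd_pow i 2 d2]
    norm_num
    ring
  have hterm : ∀ i, |∫ x, φ i x * pd i (fun x => f x * η x ^ 2) x|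
      ≤ 5 * K * Y * D ^ (1 / 2 : ℝ) + 2 * (κ / R) * (5 * K * Y * X ^ (1 / 2 : ℝ)) := by
    intro i
    have hφc := (h.smooth_φ i).continuous
    have hsq : ((5 * K * Y) ^ 2) ^ (1 / 2 : ℝ) = 5 * K * Y := by
      rw [← Real.sqrt_eq_rpow, Real.sqrt_sq (by positivity)]
    have habs : ∀ t : ℝ, |t| = (t ^ 2) ^ (1 / 2 : ℝ) := fun t => by
      rw [← Real.sqrt_eq_rpow, Real.sqrt_sq_eq_abs]
    have hpf := continuous_pd i hf1
    have hpη := continuous_pd i hη1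
    have b1 := abs_integral_le_holder2 (μ := volume.restrict S)
      (F := fun x => φ i x * (pd i f x * η x ^ 2))
      (f₁ := fun x => φ i x ^ 2) (f₂ := fun x => pd i f x ^ 2) (p₁ := 1 / 2) (p₂ := 1 / 2)
      (h.integrableOn (hφc.pow 2)) (h.integrableOn (hpf.pow 2))
      (fun x => by positivity) (fun x => by positivity) (by norm_num) (by norm_num) (by norm_num)
      (h.φ_sq_le hs hK i) (h.grad_le i) (fun x => by
        rw [← habs, ← habs, abs_mul, abs_mul, abs_of_nonneg (by positivity : 0 ≤ η x ^ 2)]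
        have : η x ^ 2 ≤ 1 := pow_le_one₀ (h.η_nonneg x) (h.η_le_one x)
        calc |φ i x| * (|pd i f x| * η x ^ 2) ≤ |φ i x| * (|pd i f x| * 1) := by gcongr
          _ = _ := by ring)
    have b2 : |∫ x in S, (|φ i x * (f x * η x)|)| ≤ 5 * K * Y * X ^ (1 / 2 : ℝ) := by
      have := abs_integral_le_holder2 (μ := volume.restrict S)
        (F := fun x => |φ i x * (f x * η x)|)
        (f₁ := fun x => φ i x ^ 2) (f₂ := fun x => (f x * η x) ^ 2) (p₁ := 1 / 2) (p₂ := 1 / 2)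
        (h.integrableOn (hφc.pow 2)) (h.integrableOn ((hfc.mul hηc).pow 2))
        (fun x => by positivity) (fun x => by positivity) (by norm_num) (by norm_num)
        (by norm_num)
        (h.φ_sq_le hs hK i) hXS.ge (fun x => by rw [← habs, ← habs, abs_abs, abs_mul])
      rwa [hsq] at this
    have b3 : |∫ x in S, 2 * (φ i x * (f x * η x)) * pd i η x|
        ≤ 2 * (κ / R) * (5 * K * Y * X ^ (1 / 2 : ℝ)) := by
      calc _ ≤ ∫ x in S, 2 * (κ / R) * |φ i x * (f x * η x)| := by
            rw [← Real.norm_eq_abs]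
            refine norm_integral_le_of_norm_le ((h.integrableOn (by fun_prop)).const_mul _)
              (ae_of_all _ fun x => ?_)
            rw [Real.norm_eq_abs, abs_mul, abs_mul, abs_two]
            calc 2 * |φ i x * (f x * η x)| * |pd i η x|
                ≤ 2 * |φ i x * (f x * η x)| * (κ / R) := by gcongr; exact h.pd_η_le i x
              _ = _ := by ring
        _ = 2 * (κ / R) * ∫ x in S, |φ i x * (f x * η x)| := integral_const_mul _ _
        _ ≤ _ := by gcongr; exact (le_abs_self _).trans b2
    rw [hsq] at b1
    have e : ∫ x, φ i x * pd i (fun x => f x * η x ^ 2) x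
        = (∫ x in S, φ i x * (pd i f x * η x ^ 2))
          + ∫ x in S, 2 * (φ i x * (f x * η x)) * pd i η x := by
      rw [h.setIntegral_eq, ← integral_add]
      · refine integral_congr_ae (ae_of_all _ fun x => ?_)
        simp only [hpg]; ring
      · exact h.integrableOn (by fun_prop)
      · exact h.integrableOn (by fun_prop)
      · intro x hx
        rw [hpg, h.η_eq_zero x hx]; ring
    rw [e]
    exact (abs_add_le _ _).trans (add_le_add b1 b3)
  have hsum : X = - ∑ i, ∫ x, φ i x * pd i (fun x => f x * η x ^ 2) x := by
    have e1 : X = ∫ x, ∑ i, pd i (φ i) x * (f x * η x ^ 2) := by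
      refine integral_congr_ae (ae_of_all _ fun x => ?_)
      simp only
      rw [← Finset.sum_mul, ← h.div_eq]; ring
    rw [e1, integral_finsetSum, ← Finset.sum_neg_distrib]
    · exact Finset.sum_congr rfl fun i _ =>
        integral_pd_mul i ((h.smooth_φ i).of_le (by simp)) hg1 hgc
    · intro i _
      exact ((continuous_pd i ((h.smooth_φ i).of_le (by simp))).mul
        hg1.continuous).integrable_of_hasCompactSupport hgc.mul_left
  have hmain : X ≤ 3 * (5 * K * Y * D ^ (1 / 2 : ℝ)
      + 2 * (κ / R) * (5 * K * Y * X ^ (1 / 2 : ℝ))) := by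
    calc X ≤ |X| := le_abs_self _
      _ ≤ ∑ i, |∫ x, φ i x * pd i (fun x => f x * η x ^ 2) x| := by
          conv_lhs => rw [hsum]
          rw [abs_neg]; exact Finset.abs_sum_le_sum_abs _ _
      _ ≤ ∑ _i : Fin 3, _ := Finset.sum_le_sum fun i _ => hterm i
      _ = _ := by simp; ring
  have hXX : X ^ (1 / 2 : ℝ) * X ^ (1 / 2 : ℝ) = X := by
    rw [← Real.sqrt_eq_rpow]; exact Real.mul_self_sqrt hX0
  have hsc := h.scale_le hs
  have hYR : Y / R ^ 2 ≤ D ^ (1 / 2 : ℝ) := by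
    rw [div_le_iff₀ (by positivity)]; linarith
  have h4 : 30 * (κ / R * K * Y) * X ^ (1 / 2 : ℝ) ≤ X / 2 + 450 * (κ / R * K * Y) ^ 2 := by
    nlinarith [sq_nonneg (X ^ (1 / 2 : ℝ) - 30 * (κ / R * K * Y))]
  have h5 : (κ / R * K * Y) ^ 2 ≤ κ ^ 2 * K ^ 2 * Y * D ^ (1 / 2 : ℝ) := by
    calc (κ / R * K * Y) ^ 2 = κ ^ 2 * K ^ 2 * Y * (Y / R ^ 2) := by field_simp
      _ ≤ _ := by gcongr
  have h6 : K * Y * D ^ (1 / 2 : ℝ) ≤ κ ^ 2 * K ^ 2 * Y * D ^ (1 / 2 : ℝ) := by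
    have : K ≤ κ ^ 2 * K ^ 2 := by nlinarith [one_le_pow₀ hκ (n := 2)]
    gcongr
  nlinarith

lemma sq_le' (hs : 3 < s) (hK : 1 ≤ K) (h : LocalData s K φ f η S R κ D) :
    ∫ x, (f x * η x) ^ 2 ≤ 1000 * K ^ 2 * κ ^ 2 * R ^ 2 * D := by
  have hD := h.D_pos
  have hDD : D ^ (1 / 2 : ℝ) * D ^ (1 / 2 : ℝ) = D := by
    rw [← Real.sqrt_eq_rpow]; exact Real.mul_self_sqrt hD.le
  have hR0 : 0 < R := by linarith [h.one_le_R]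
  have hκ := h.one_le_κ
  calc _ ≤ 1000 * K ^ 2 * κ ^ 2 * R ^ (11 / 6 - 1 / s) * D ^ (1 / 2 : ℝ) := h.sq_le hs hK
    _ ≤ 1000 * K ^ 2 * κ ^ 2 * (R ^ 2 * D ^ (1 / 2 : ℝ)) * D ^ (1 / 2 : ℝ) := by
        gcongr; exact h.scale_le hs
    _ = 1000 * K ^ 2 * κ ^ 2 * R ^ 2 * (D ^ (1 / 2 : ℝ) * D ^ (1 / 2 : ℝ)) := by ring
    _ = _ := by rw [hDD]

end LocalData
end LocalEstimates

section CubicEstimate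

lemma mul_cube_le_interp {s t e : ℝ} (hs1 : 3 < s) (ht : 0 ≤ t) (he : 0 ≤ e) (he1 : e ≤ 1) :
    t * e ^ 3 ≤ ((t * e) ^ 3) ^ (2 / 3 - 2 / s) * ((t * e ^ 2) ^ 6) ^ (1 / s - 1 / 6) := by
  have hs0 : (0 : ℝ) < s := by linarith
  rcases ht.eq_or_lt with h0 | h0
  · rw [← h0, zero_mul]; positivity
  rcases he.eq_or_lt with h1 | h1
  · rw [← h1]; simp only [ne_eq, OfNat.ofNat_ne_zero, not_false_eq_true, zero_pow, mul_zero]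
    positivity
  have h2 : 2 / s ≤ 2 / 3 := by gcongr
  have h3 : 6 / s ≤ 2 := by rw [div_le_iff₀ hs0]; linarith
  have e1 : ((t * e) ^ 3) ^ (2 / 3 - 2 / s) * ((t * e ^ 2) ^ 6) ^ (1 / s - 1 / 6)
      = t * e ^ (6 / s) := by
    rw [← Real.rpow_natCast (t * e) 3, ← Real.rpow_natCast (t * e ^ 2) 6,
      ← Real.rpow_mul (by positivity), ← Real.rpow_mul (by positivity),
      Real.mul_rpow h0.le h1.le, Real.mul_rpow h0.le (by positivity), ← Real.rpow_natCast e 2,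
      ← Real.rpow_mul h1.le]
    have e2 : ∀ a b c d : ℝ, t ^ a * e ^ b * (t ^ c * e ^ d) = t ^ (a + c) * e ^ (b + d) := by
      intro a b c d
      rw [Real.rpow_add h0, Real.rpow_add h1]; ring
    rw [e2]
    have e3 : ((3 : ℕ) : ℝ) * (2 / 3 - 2 / s) + ((6 : ℕ) : ℝ) * (1 / s - 1 / 6) = 1 := by
      push_cast; field_simp; ring
    have e4 : ((3 : ℕ) : ℝ) * (2 / 3 - 2 / s) + ((2 : ℕ) : ℝ) * (((6 : ℕ) : ℝ) * (1 / s - 1 / 6))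
        = 6 / s := by
      push_cast; field_simp; ring
    rw [e3, e4, Real.rpow_one]
  rw [e1, ← Real.rpow_natCast e 3]
  exact mul_le_mul_of_nonneg_left
    (Real.rpow_le_rpow_of_exponent_ge h1 he1 (by push_cast; linarith)) ht

namespace LocalData

variable {s K : ℝ} {φ : Fin 3 → E3 → ℝ} {f η : E3 → ℝ} {S : Set E3} {R κ D : ℝ}

/-- Local bound in `L⁶` from the Sobolev inequality. -/
lemma six_le {C : ℝ} (hC : 0 ≤ C)
    (hSob : ∀ g : E3 → ℝ, ContDiff ℝ 1 g → HasCompactSupport g →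
      ∫ x, g x ^ 6 ≤ C * (∑ i, ∫ x, pd i g x ^ 2) ^ 3)
    (hs : 3 < s) (hK : 1 ≤ K) (h : LocalData s K φ f η S R κ D) :
    ∫ x, (f x * η x ^ 2) ^ 6 ≤ C * (24006 * K ^ 2 * κ ^ 4 * D) ^ 3 := by
  have hR0 : 0 < R := by linarith [h.one_le_R]
  have hκ := h.one_le_κ
  have hD := h.D_pos
  have hf1 : ContDiff ℝ 1 f := h.smooth_f.of_le (by simp)
  have hη1 : ContDiff ℝ 1 η := h.smooth_η.of_le (by simp)
  have hfc := hf1.continuous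
  have hηc := hη1.continuous
  have hg1 : ContDiff ℝ 1 (fun x => f x * η x ^ 2) := hf1.mul (hη1.pow 2)
  have hgc : HasCompactSupport (fun x => f x * η x ^ 2) := by
    have := h.hasCompactSupport
    simp only [pow_two]
    exact (this.mul_left).mul_left
  refine (hSob _ hg1 hgc).trans ?_
  have hterm : ∀ i, ∫ x, pd i (fun x => f x * η x ^ 2) x ^ 2 ≤ 8002 * K ^ 2 * κ ^ 4 * D := by
    intro i
    have hpg : ∀ x, pd i (fun x => f x * η x ^ 2) x
        = pd i f x * η x ^ 2 + 2 * (f x * η x) * pd i η x := by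
      intro x
      have d1 : DifferentiableAt ℝ f x := (hf1.differentiable (by simp)).differentiableAt
      have d2 : DifferentiableAt ℝ η x := (hη1.differentiable (by simp)).differentiableAt
      rw [pd_mul i d1 (g := fun y => η y ^ 2) (by fun_prop), pd_pow i 2 d2]
      norm_num
      ring
    have hpf := continuous_pd i hf1
    rw [h.setIntegral_eq]
    · calc ∫ x in S, pd i (fun x => f x * η x ^ 2) x ^ 2
          ≤ ∫ x in S, (2 * pd i f x ^ 2 + 8 * (κ / R) ^ 2 * (f x * η x) ^ 2) := by
            refine integral_mono (h.integrableOn ((continuous_pd i hg1).pow 2))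
              (h.integrableOn (by fun_prop)) fun x => ?_
            simp only [hpg]
            have h1 : (pd i f x * η x ^ 2) ^ 2 ≤ pd i f x ^ 2 := by
              rw [mul_pow]
              have : (η x ^ 2) ^ 2 ≤ 1 :=
                pow_le_one₀ (by positivity) (pow_le_one₀ (h.η_nonneg x) (h.η_le_one x))
              nlinarith [sq_nonneg (pd i f x)]
            have h2 : pd i η x ^ 2 ≤ (κ / R) ^ 2 := sq_le_sq.2 (by
              rw [abs_of_nonneg (by positivity : 0 ≤ κ / R)]; exact h.pd_η_le i x)
            have h3 : (2 * (f x * η x) * pd i η x) ^ 2 ≤ 4 * (κ / R) ^ 2 * (f x * η x) ^ 2 := by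
              rw [mul_pow, mul_pow]
              nlinarith [sq_nonneg (f x * η x)]
            nlinarith [sq_nonneg (pd i f x * η x ^ 2 - 2 * (f x * η x) * pd i η x)]
        _ = 2 * (∫ x in S, pd i f x ^ 2) + 8 * (κ / R) ^ 2 * ∫ x in S, (f x * η x) ^ 2 := by
            rw [integral_add, integral_const_mul, integral_const_mul]
            · exact (h.integrableOn (by fun_prop))
            · exact (h.integrableOn (by fun_prop))
        _ ≤ 2 * D + 8 * (κ / R) ^ 2 * (1000 * K ^ 2 * κ ^ 2 * R ^ 2 * D) := by
            gcongr
            · exact h.grad_le i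
            · rw [← h.setIntegral_eq]
              · exact h.sq_le' hs hK
              · intro x hx; simp [h.η_eq_zero x hx]
        _ = 2 * D + 8000 * K ^ 2 * κ ^ 4 * D := by field_simp; ring
        _ ≤ _ := by
            have : 1 ≤ K ^ 2 * κ ^ 4 := one_le_mul_of_one_le_of_one_le (one_le_pow₀ hK)
              (one_le_pow₀ hκ)
            nlinarith
    · intro x hx
      rw [hpg, h.η_eq_zero x hx]; simp
  have hsum : ∑ i, ∫ x, pd i (fun x => f x * η x ^ 2) x ^ 2 ≤ 24006 * K ^ 2 * κ ^ 4 * D :=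
    (Finset.sum_le_sum fun i _ => hterm i).trans (by simp; linarith)
  have h0 : 0 ≤ ∑ i, ∫ x, pd i (fun x => f x * η x ^ 2) x ^ 2 :=
    Finset.sum_nonneg fun i _ => integral_nonneg fun x => by positivity
  gcongr

/-- Local cubic bound. -/
lemma cube_le {M : ℝ} (hM : 1 ≤ M) (hs : 3 < s) (hs6 : s ≤ 6) (hK : 1 ≤ K)
    (h : LocalData s K φ f η S R κ D) (h6 : ∫ x, (f x * η x ^ 2) ^ 6 ≤ M * κ ^ 12 * D ^ 3) :
    ∫ x, |f x * η x| ^ 3 ≤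
      ((12 * K * M) ^ 2 + 90 ^ 3 * K ^ 3) * κ ^ 3 * R * D ^ (9 / (s + 6)) := by
  have hR := h.one_le_R
  have hR0 : 0 < R := by linarith
  have hκ := h.one_le_κ
  have hD := h.D_pos
  have hs0 : 0 < s := by linarith
  have hf1 : ContDiff ℝ 1 f := h.smooth_f.of_le (by simp)
  have hη1 : ContDiff ℝ 1 η := h.smooth_η.of_le (by simp)
  have hfc := hf1.continuous
  have hηc := hη1.continuous
  have i1 : 2 / s ≤ 2 / 3 := by gcongr
  have i2 : 1 / 6 ≤ 1 / s := by gcongr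
  have i3 : 1 / s ≤ 1 / 3 := by gcongr
  have i0 : 0 < 1 / s := by positivity
  set J := ∫ x, |f x * η x| ^ 3 with hJ
  have hJ0 : 0 ≤ J := integral_nonneg fun x => by positivity
  have hJS : J = ∫ x in S, |f x * η x| ^ 3 :=
    h.setIntegral_eq fun x hx => by simp [h.η_eq_zero x hx]
  have h6S : ∫ x in S, (f x * η x ^ 2) ^ 6 ≤ M * κ ^ 12 * D ^ 3 := by
    rw [← h.setIntegral_eq]
    · exact h6
    · intro x hx; simp [h.η_eq_zero x hx]
  set g : E3 → ℝ := fun x => (f x * |f x|) * η x ^ 3 with hg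
  have hg1 : ContDiff ℝ 1 g := (contDiff_mul_abs_self.comp hf1).mul (hη1.pow 3)
  have hgc : HasCompactSupport g := by
    have := h.hasCompactSupport
    have h3 : HasCompactSupport (fun x => η x ^ 3) := by
      simp only [pow_succ, pow_zero, one_mul]
      exact this.mul_left
    exact h3.mul_left
  have hpg : ∀ i x, pd i g x
      = 2 * |f x| * pd i f x * η x ^ 3 + 3 * (f x * |f x| * η x ^ 2) * pd i η x := by
    intro i x
    have d1 : DifferentiableAt ℝ f x := (hf1.differentiable (by simp)).differentiableAt
    have d2 : DifferentiableAt ℝ η x := (hη1.differentiable (by simp)).differentiableAt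
    have d3 : DifferentiableAt ℝ (fun x => f x * |f x|) x :=
      ((contDiff_mul_abs_self.comp hf1).differentiable (by simp)).differentiableAt
    rw [hg, pd_mul i (f := fun x => f x * |f x|) d3 (g := fun y => η y ^ 3) (by fun_prop),
      pd_pow i 3 d2, pd_comp i (h := fun t => t * |t|) (hasDerivAt_mul_abs_self (f x)) d1]
    norm_num
    ring
  have hKR : (K * R ^ (s / 3 + 2)) ^ (1 / s) ≤ K * R ^ (1 / 3 + 2 / s) := by
    rw [Real.mul_rpow (by linarith) (by positivity), ← Real.rpow_mul hR0.le]
    have e : (s / 3 + 2) * (1 / s) = 1 / 3 + 2 / s := by field_simp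
    rw [e]
    gcongr
    simpa using Real.rpow_le_rpow_of_exponent_le hK (show 1 / s ≤ 1 by linarith)
  have hM4 : (M * κ ^ 12 * D ^ 3) ^ (1 / s - 1 / 6) ≤ M * κ ^ 2 * D ^ (3 / s - 1 / 2) := by
    rw [Real.mul_rpow (by positivity) (by positivity), Real.mul_rpow (by positivity)
      (by positivity), ← Real.rpow_natCast κ 12, ← Real.rpow_natCast D 3,
      ← Real.rpow_mul hD.le, ← Real.rpow_mul (by linarith), ← Real.rpow_natCast κ 2]
    have e : ((3 : ℕ) : ℝ) * (1 / s - 1 / 6) = 3 / s - 1 / 2 := by push_cast; ring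
    rw [e]
    gcongr
    · simpa using Real.rpow_le_rpow_of_exponent_le hM (show 1 / s - 1 / 6 ≤ 1 by linarith)
    · push_cast; linarith
  have habs2 : ∀ t : ℝ, (t ^ 2) ^ (1 / 2 : ℝ) = |t| := fun t => by
    rw [← Real.sqrt_eq_rpow, Real.sqrt_sq_eq_abs]
  have habss : ∀ t : ℝ, (|t| ^ s) ^ (1 / s) = |t| := fun t => by
    rw [← Real.rpow_mul (abs_nonneg _), mul_one_div_cancel hs0.ne', Real.rpow_one]
  have hterm : ∀ i, |∫ x, φ i x * pd i g x| ≤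
      2 * (K * M * κ ^ 2 * R ^ (1 / 3 + 2 / s) * D ^ (3 / s)) * J ^ (2 / 3 - 2 / s)
        + 15 * κ * K * R ^ (1 / 3 - 1 / s) * J ^ (2 / 3 : ℝ) := by
    intro i
    have hφc := (h.smooth_φ i).continuous
    have hpf := continuous_pd i hf1
    have hpη := continuous_pd i hη1
    have iφ := h.integrableOn (hφc.abs.rpow_const fun x => Or.inr hs0.le)
    have b1 := abs_integral_le_holder4 (μ := volume.restrict S)
      (F := fun x => φ i x * (|f x| * pd i f x * η x ^ 3))
      (f₁ := fun x => |φ i x| ^ s) (f₂ := fun x => pd i f x ^ 2)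
      (f₃ := fun x => |f x * η x| ^ 3) (f₄ := fun x => (f x * η x ^ 2) ^ 6)
      (p₁ := 1 / s) (p₂ := 1 / 2) (p₃ := 2 / 3 - 2 / s) (p₄ := 1 / s - 1 / 6)
      iφ (h.integrableOn (hpf.pow 2)) (h.integrableOn (by fun_prop))
      (h.integrableOn (by fun_prop))
      (fun x => by positivity) (fun x => by positivity) (fun x => by positivity)
      (fun x => by positivity) (by positivity) (by norm_num) (by linarith) (by linarith)
      (by ring) (h.φ_le_S hs i) (h.grad_le i) hJS.ge h6S (fun x => by
        rw [habss, habs2, abs_mul, abs_mul, abs_mul, abs_abs, abs_of_nonneg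
          (pow_nonneg (h.η_nonneg x) 3), abs_mul (f x), abs_of_nonneg (h.η_nonneg x)]
        have e6 : (f x * η x ^ 2) ^ 6 = (|f x| * η x ^ 2) ^ 6 := by
          rw [mul_pow, mul_pow, Even.pow_abs (by decide)]
        rw [e6]
        calc |φ i x| * (|f x| * |pd i f x| * η x ^ 3)
            = |φ i x| * |pd i f x| * (|f x| * η x ^ 3) := by ring
          _ ≤ |φ i x| * |pd i f x| * (((|f x| * η x) ^ 3) ^ (2 / 3 - 2 / s)
              * ((|f x| * η x ^ 2) ^ 6) ^ (1 / s - 1 / 6)) := by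
              refine mul_le_mul_of_nonneg_left ?_ (by positivity)
              exact mul_cube_le_interp hs (abs_nonneg _) (h.η_nonneg x) (h.η_le_one x)
          _ = _ := by ring)
    have b1' : |∫ x in S, φ i x * (|f x| * pd i f x * η x ^ 3)|
        ≤ K * M * κ ^ 2 * R ^ (1 / 3 + 2 / s) * D ^ (3 / s) * J ^ (2 / 3 - 2 / s) := by
      refine b1.trans ?_
      calc _ ≤ K * R ^ (1 / 3 + 2 / s) * D ^ (1 / 2 : ℝ) * J ^ (2 / 3 - 2 / s)
            * (M * κ ^ 2 * D ^ (3 / s - 1 / 2)) := by gcongr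
        _ = K * M * κ ^ 2 * R ^ (1 / 3 + 2 / s) * (D ^ (1 / 2 : ℝ) * D ^ (3 / s - 1 / 2))
            * J ^ (2 / 3 - 2 / s) := by ring
        _ = _ := by rw [← Real.rpow_add hD]; ring_nf
    have b2 := abs_integral_le_holder3 (μ := volume.restrict S)
      (F := fun x => |φ i x * (f x * η x) ^ 2|)
      (f₁ := fun x => |φ i x| ^ s) (f₂ := fun x => |f x * η x| ^ 3) (f₃ := fun _ => 1)
      (p₁ := 1 / s) (p₂ := 2 / 3) (p₃ := 1 / 3 - 1 / s)
      iφ (h.integrableOn (by fun_prop)) (h.integrableOn continuous_const)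
      (fun x => by positivity) (fun x => by positivity) (fun x => by positivity)
      (by positivity) (by norm_num) (by linarith) (by ring) (h.φ_le_S hs i) hJS.ge
      (setIntegral_const_one_le hR0.le h.subset_ball) (fun x => by
        rw [habss, Real.one_rpow, mul_one, abs_abs, abs_mul, abs_pow,
          ← Real.rpow_natCast _ 3, ← Real.rpow_mul (abs_nonneg _)]
        norm_num)
    have e5 : (5 * R ^ 3) ^ (1 / 3 - 1 / s) ≤ 5 * R ^ (1 - 3 / s) := by
      rw [Real.mul_rpow (by norm_num) (by positivity), ← Real.rpow_natCast R 3,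
        ← Real.rpow_mul hR0.le]
      have e : ((3 : ℕ) : ℝ) * (1 / 3 - 1 / s) = 1 - 3 / s := by push_cast; ring
      rw [e]
      gcongr
      simpa using Real.rpow_le_rpow_of_exponent_le (by norm_num : (1 : ℝ) ≤ 5)
        (show 1 / 3 - 1 / s ≤ 1 by linarith)
    have b2' : ∫ x in S, |φ i x * (f x * η x) ^ 2|
        ≤ K * R ^ (1 / 3 + 2 / s) * J ^ (2 / 3 : ℝ) * (5 * R ^ (1 - 3 / s)) := by
      refine (le_abs_self _).trans (b2.trans ?_)
      gcongr
    have b3 : |∫ x in S, φ i x * (3 * (f x * |f x| * η x ^ 2) * pd i η x)|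
        ≤ 15 * κ * K * R ^ (1 / 3 - 1 / s) * J ^ (2 / 3 : ℝ) := by
      calc _ ≤ ∫ x in S, 3 * (κ / R) * |φ i x * (f x * η x) ^ 2| := by
            rw [← Real.norm_eq_abs]
            refine norm_integral_le_of_norm_le ((h.integrableOn (by fun_prop)).const_mul _)
              (ae_of_all _ fun x => ?_)
            have e : |φ i x * (3 * (f x * |f x| * η x ^ 2) * pd i η x)|
                = 3 * |φ i x * (f x * η x) ^ 2| * |pd i η x| := by
              simp only [abs_mul, abs_abs, abs_pow]
              norm_num
              ring_nf
              simp only [sq_abs]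
              ring
            rw [Real.norm_eq_abs, e]
            calc 3 * |φ i x * (f x * η x) ^ 2| * |pd i η x|
                ≤ 3 * |φ i x * (f x * η x) ^ 2| * (κ / R) := by gcongr; exact h.pd_η_le i x
              _ = _ := by ring
        _ = 3 * (κ / R) * ∫ x in S, |φ i x * (f x * η x) ^ 2| := integral_const_mul _ _
        _ ≤ 3 * (κ / R) * (K * R ^ (1 / 3 + 2 / s) * J ^ (2 / 3 : ℝ) * (5 * R ^ (1 - 3 / s))) := by
            gcongr
        _ = 15 * κ * K * (R ^ (-1 : ℝ) * R ^ (1 / 3 + 2 / s) * R ^ (1 - 3 / s))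
            * J ^ (2 / 3 : ℝ) := by
            rw [Real.rpow_neg_one]; ring
        _ = _ := by
            rw [← Real.rpow_add hR0, ← Real.rpow_add hR0]
            ring_nf
    have e : ∫ x, φ i x * pd i g x
        = 2 * (∫ x in S, φ i x * (|f x| * pd i f x * η x ^ 3))
          + ∫ x in S, φ i x * (3 * (f x * |f x| * η x ^ 2) * pd i η x) := by
      rw [h.setIntegral_eq, ← integral_const_mul, ← integral_add]
      · refine integral_congr_ae (ae_of_all _ fun x => ?_)
        simp only [hpg]; ring
      · exact h.integrableOn (by fun_prop)
      · exact h.integrableOn (by fun_prop)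
      · intro x hx
        rw [hpg, h.η_eq_zero x hx]; ring
    rw [e]
    refine (abs_add_le _ _).trans (add_le_add ?_ b3)
    rw [abs_mul, abs_two]
    linarith
  have hsum : J = - ∑ i, ∫ x, φ i x * pd i g x := by
    have e1 : J = ∫ x, ∑ i, pd i (φ i) x * g x := by
      refine integral_congr_ae (ae_of_all _ fun x => ?_)
      simp only [hg]
      rw [← Finset.sum_mul, ← h.div_eq, abs_mul, abs_of_nonneg (h.η_nonneg x), mul_pow]
      have : |f x| ^ 3 = f x * (f x * |f x|) := by
        rw [pow_succ, sq_abs]; ring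
      rw [this]; ring
    rw [e1, integral_finsetSum, ← Finset.sum_neg_distrib]
    · exact Finset.sum_congr rfl fun i _ =>
        integral_pd_mul i ((h.smooth_φ i).of_le (by simp)) hg1 hgc
    · intro i _
      exact ((continuous_pd i ((h.smooth_φ i).of_le (by simp))).mul
        hg1.continuous).integrable_of_hasCompactSupport hgc.mul_left
  have hmain : J ≤ (6 * (K * M * κ ^ 2 * R ^ (1 / 3 + 2 / s) * D ^ (3 / s))) * J ^ (2 / 3 - 2 / s)
        + (45 * κ * K * R ^ (1 / 3 - 1 / s)) * J ^ (2 / 3 : ℝ) := by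
    calc J ≤ |J| := le_abs_self _
      _ ≤ ∑ i, |∫ x, φ i x * pd i g x| := by
          conv_lhs => rw [hsum]
          rw [abs_neg]; exact Finset.abs_sum_le_sum_abs _ _
      _ ≤ ∑ _i : Fin 3, _ := Finset.sum_le_sum fun i _ => hterm i
      _ = _ := by simp; ring
  refine (le_of_le_rpow_add_rpow hJ0 (by positivity) (by positivity)
    (by linarith [show 0 < 2 / s by positivity]) hmain).trans ?_
  have hp : 1 / (1 - (2 / 3 - 2 / s)) = 3 * s / (s + 6) := by
    have : 1 - (2 / 3 - 2 / s) = (s + 6) / (3 * s) := by field_simp; ring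
    rw [this, one_div_div]
  have hp2 : 3 * s / (s + 6) ≤ 3 / 2 := by
    rw [div_le_iff₀ (by linarith)]; linarith
  have hp0 : 0 < 3 * s / (s + 6) := by positivity
  have t1 : (2 * (6 * (K * M * κ ^ 2 * R ^ (1 / 3 + 2 / s) * D ^ (3 / s)))) ^
      (1 / (1 - (2 / 3 - 2 / s))) ≤ (12 * K * M) ^ 2 * κ ^ 3 * R * D ^ (9 / (s + 6)) := by
    rw [hp, show 2 * (6 * (K * M * κ ^ 2 * R ^ (1 / 3 + 2 / s) * D ^ (3 / s)))
      = (12 * K * M) * κ ^ 2 * R ^ (1 / 3 + 2 / s) * D ^ (3 / s) by ring,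
      Real.mul_rpow (by positivity) (by positivity), Real.mul_rpow (by positivity) (by positivity),
      Real.mul_rpow (by positivity) (by positivity), ← Real.rpow_mul hR0.le,
      ← Real.rpow_mul hD.le, ← Real.rpow_natCast κ 2, ← Real.rpow_mul (by linarith),
      ← Real.rpow_natCast κ 3, ← Real.rpow_natCast _ 2]
    have e1 : (1 / 3 + 2 / s) * (3 * s / (s + 6)) = 1 := by field_simp; norm_num
    have e2 : 3 / s * (3 * s / (s + 6)) = 9 / (s + 6) := by field_simp; norm_num
    rw [e1, e2, Real.rpow_one]
    have : 1 ≤ 12 * K * M := by nlinarith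
    gcongr
    · push_cast; linarith
    · push_cast; linarith
  have t2 : (2 * (45 * κ * K * R ^ (1 / 3 - 1 / s))) ^ 3
      ≤ 90 ^ 3 * K ^ 3 * κ ^ 3 * R * D ^ (9 / (s + 6)) := by
    have e1 : (R ^ (1 / 3 - 1 / s)) ^ 3 ≤ R * D ^ (9 / (s + 6)) := by
      have e2 := Real.rpow_le_rpow (by positivity) h.le_D
        (show 0 ≤ 9 / (s + 6) by positivity)
      rw [← Real.rpow_mul hR0.le] at e2
      calc (R ^ (1 / 3 - 1 / s)) ^ 3 = R ^ (1 - 3 / s) := by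
            rw [← Real.rpow_natCast _ 3, ← Real.rpow_mul hR0.le]
            congr 1; push_cast; ring
        _ ≤ R ^ (1 + -1 / 3 * (9 / (s + 6))) := by
            apply Real.rpow_le_rpow_of_exponent_le hR
            have : 3 / (s + 6) ≤ 3 / s := by gcongr; linarith
            have e3 : -1 / 3 * (9 / (s + 6)) = - (3 / (s + 6)) := by ring
            rw [e3]; linarith
        _ = R * R ^ (-1 / 3 * (9 / (s + 6))) := by rw [Real.rpow_add hR0, Real.rpow_one]
        _ ≤ _ := by gcongr
    calc _ = 90 ^ 3 * K ^ 3 * κ ^ 3 * (R ^ (1 / 3 - 1 / s)) ^ 3 := by ring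
      _ ≤ 90 ^ 3 * K ^ 3 * κ ^ 3 * (R * D ^ (9 / (s + 6))) := by gcongr
      _ = _ := by ring
  calc _ ≤ _ := add_le_add t1 t2
    _ = _ := by ring

end LocalData

/-- Uniform local estimates for a scalar function in divergence form. -/
lemma exists_local_estimates {s K : ℝ} (hs : 3 < s) (hs6 : s ≤ 6) (hK : 1 ≤ K) :
    ∃ C : ℝ, 1 ≤ C ∧ ∀ {φ : Fin 3 → E3 → ℝ} {f η : E3 → ℝ} {S : Set E3} {R κ D : ℝ},
      LocalData s K φ f η S R κ D →
      ∫ x, (f x * η x) ^ 2 ≤ C * κ ^ 2 * R ^ (11 / 6 - 1 / s) * D ^ (1 / 2 : ℝ) ∧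
      ∫ x, (f x * η x) ^ 2 ≤ C * κ ^ 2 * R ^ 2 * D ∧
      ∫ x, |f x * η x| ^ 3 ≤ C * κ ^ 3 * R * D ^ (9 / (s + 6)) ∧
      ∫ x, (f x * η x ^ 2) ^ 6 ≤ C * κ ^ 12 * D ^ 3 := by
  obtain ⟨C₁, hC₁, hSob⟩ := exists_sobolev
  set M := (C₁ + 1) * (24006 * K ^ 2) ^ 3 with hM
  have hM1 : 1 ≤ M := by
    refine one_le_mul_of_one_le_of_one_le (by linarith) (one_le_pow₀ ?_)
    nlinarith [one_le_pow₀ hK (n := 2)]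
  refine ⟨1000 * K ^ 2 + M + ((12 * K * M) ^ 2 + 90 ^ 3 * K ^ 3), ?_, ?_⟩
  · have : 0 ≤ (12 * K * M) ^ 2 + 90 ^ 3 * K ^ 3 := by positivity
    nlinarith [one_le_pow₀ hK (n := 2)]
  intro φ f η S R κ D h
  have hR0 : 0 < R := by linarith [h.one_le_R]
  have hκ := h.one_le_κ
  have hD := h.D_pos
  have h6 : ∫ x, (f x * η x ^ 2) ^ 6 ≤ M * κ ^ 12 * D ^ 3 := by
    refine (h.six_le hC₁ hSob hs hK).trans ?_
    calc C₁ * (24006 * K ^ 2 * κ ^ 4 * D) ^ 3 ≤ (C₁ + 1) * (24006 * K ^ 2 * κ ^ 4 * D) ^ 3 := by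
          gcongr; linarith
      _ = _ := by rw [hM]; ring
  have n1 : 0 ≤ M := by linarith
  have n2 : 0 ≤ (12 * K * M) ^ 2 + 90 ^ 3 * K ^ 3 := by positivity
  have n3 : 0 ≤ 1000 * K ^ 2 := by positivity
  refine ⟨(h.sq_le hs hK).trans ?_, (h.sq_le' hs hK).trans ?_,
    (h.cube_le hM1 hs hs6 hK h6).trans ?_, h6.trans ?_⟩ <;>
  (have : (0 : ℝ) ≤ D ^ (9 / (s + 6)) := by positivity) <;>
  repeat' first | linarith | refine mul_le_mul_of_nonneg_right ?_ (by positivity)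

end CubicEstimate

section CarriedMeasures

variable {α β : Type*} [TopologicalSpace α] [T2Space α] [SecondCountableTopology α]
  [MeasurableSpace α] [BorelSpace α] [TopologicalSpace β] [T2Space β]
  [SecondCountableTopology β] [MeasurableSpace β] [BorelSpace β]

/-- A finite measure concentrated on a compact set. -/
structure CompactlyCarried (μ : Measure α) : Prop where
  finite : IsFiniteMeasure μ
  carried : ∃ K, IsCompact K ∧ μ Kᶜ = 0

namespace CompactlyCarried

variable {μ : Measure α} {ν : Measure β}

lemma integrable (hμ : CompactlyCarried μ) {f : α → ℝ} (hf : Continuous f) : Integrable f μ := by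
  have := hμ.finite
  obtain ⟨K, hK, h0⟩ := hμ.carried
  have : μ.restrict K = μ := Measure.restrict_eq_self_of_ae_mem (by
    rw [ae_iff]; exact h0)
  rw [← this]
  exact hf.continuousOn.integrableOn_compact hK

lemma prod (hμ : CompactlyCarried μ) (hν : CompactlyCarried ν) :
    CompactlyCarried (μ.prod ν) := by
  have := hμ.finite
  have := hν.finite
  obtain ⟨K, hK, h0⟩ := hμ.carried
  obtain ⟨L, hL, h1⟩ := hν.carried
  refine ⟨inferInstance, K ×ˢ L, hK.prod hL, ?_⟩
  rw [Set.compl_prod_eq_union]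
  refine measure_union_null ?_ ?_
  · rw [Measure.prod_prod, h0, zero_mul]
  · rw [Measure.prod_prod, h1, mul_zero]

lemma integral_swap (hμ : CompactlyCarried μ) (hν : CompactlyCarried ν) {F : α → β → ℝ}
    (hF : Continuous (fun q : α × β => F q.1 q.2)) :
    ∫ a, ∫ b, F a b ∂ν ∂μ = ∫ b, ∫ a, F a b ∂μ ∂ν := by
  have := hμ.finite
  have := hν.finite
  exact integral_integral_swap ((hμ.prod hν).integrable hF)

lemma continuous_integral (hμ : CompactlyCarried μ) {F : E3 → α → ℝ}
    (hF : Continuous fun q : E3 × α => F q.1 q.2) : Continuous fun z => ∫ a, F z a ∂μ := by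
  have := hμ.finite
  obtain ⟨K, hK, h0⟩ := hμ.carried
  have hr : μ.restrict K = μ := Measure.restrict_eq_self_of_ae_mem (by rw [ae_iff]; exact h0)
  have := continuous_parametric_integral_of_continuous (μ := μ) (f := F) hF hK
  simpa only [hr] using this

end CompactlyCarried

lemma compactlyCarried_restrict_ball3 (R : ℝ) :
    CompactlyCarried ((volume : Measure E3).restrict (ball3 R)) := by
  refine ⟨⟨?_⟩, closedBall 0 R, isCompact_closedBall _ _, ?_⟩
  · rw [Measure.restrict_apply_univ]; exact measure_ball_lt_top
  · rw [Measure.restrict_apply isClosed_closedBall.measurableSet.compl]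
    have : (closedBall (0 : E3) R)ᶜ ∩ ball3 R = ∅ := by
      ext x
      simp only [Set.mem_inter_iff, Set.mem_compl_iff, Set.mem_empty_iff_false, iff_false, not_and]
      exact fun h1 h2 => h1 (ball_subset_closedBall h2)
    rw [this, measure_empty]

lemma compactlyCarried_restrict_Ioc :
    CompactlyCarried ((volume : Measure ℝ).restrict (Set.Ioc 0 1)) := by
  refine ⟨⟨?_⟩, Set.Icc 0 1, isCompact_Icc, ?_⟩
  · rw [Measure.restrict_apply_univ]; simp
  · rw [Measure.restrict_apply isClosed_Icc.measurableSet.compl]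
    have : (Set.Icc (0 : ℝ) 1)ᶜ ∩ Set.Ioc 0 1 = ∅ := by
      ext x
      simp only [Set.mem_inter_iff, Set.mem_compl_iff, Set.mem_empty_iff_false, iff_false, not_and]
      exact fun h1 h2 => h1 (Set.Ioc_subset_Icc_self h2)
    rw [this, measure_empty]

/-- An average of bounded quantities is bounded. -/
lemma abs_integral_mul_le {ν : Measure β} {w A : β → ℝ} {M : ℝ} (hw : Integrable w ν)
    (hA : ∀ᵐ b ∂ν, |A b| ≤ M) : |∫ b, w b * A b ∂ν| ≤ M * ∫ b, |w b| ∂ν := by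
  rw [← integral_const_mul, ← Real.norm_eq_abs]
  refine norm_integral_le_of_norm_le (hw.abs.const_mul M) ?_
  filter_upwards [hA] with b hb
  rw [Real.norm_eq_abs, abs_mul, mul_comm]
  gcongr

/-- Mean value estimate for weighted differences along segments. -/
lemma abs_integral_sub_le {μ : Measure α} (hμ : CompactlyCarried μ) {q : E3 → ℝ}
    (hq : ContDiff ℝ 1 q) {ξ v : α → E3} (hξ : Continuous ξ) (hv : Continuous v)
    {g : α → ℝ} (hg : Continuous g) {M : ℝ}
    (hM : ∀ t ∈ Set.Ioc (0 : ℝ) 1,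
      |∑ i, ∫ a, pd i q (ξ a + t • v a) * (v a i * g a) ∂μ| ≤ M) :
    |∫ a, (q (ξ a + v a) - q (ξ a)) * g a ∂μ| ≤ M := by
  have := hμ.finite
  have hpc : ∀ i, Continuous (pd i q) := fun i => continuous_pd i hq
  have hvi : ∀ i, Continuous fun a => v a i := fun i => by fun_prop
  have key : ∀ a, (q (ξ a + v a) - q (ξ a)) * g a
      = ∫ t in Set.Ioc (0 : ℝ) 1, ∑ i, pd i q (ξ a + t • v a) * (v a i * g a) := by
    intro a
    have hd : ∀ t ∈ Set.uIcc (0 : ℝ) 1, HasDerivAt (fun t : ℝ => q (ξ a + t • v a))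
        (∑ i, pd i q (ξ a + t • v a) * v a i) t := by
      intro t _
      have h1 : HasDerivAt (fun t : ℝ => ξ a + t • v a) (v a) t := by
        simpa using ((hasDerivAt_id t).smul_const (v a)).const_add (ξ a)
      have h2 := (hq.differentiable (by simp) (ξ a + t • v a)).hasFDerivAt.comp_hasDerivAt t h1
      rw [fderiv_apply_eq_sum] at h2
      rw [Finset.sum_congr rfl fun i _ => mul_comm (pd i q (ξ a + t • v a)) (v a i)]
      exact h2
    have hc : Continuous fun t : ℝ => ∑ i, pd i q (ξ a + t • v a) * v a i := by
      fun_prop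
    have := intervalIntegral.integral_eq_sub_of_hasDerivAt hd (hc.intervalIntegrable _ _)
    rw [intervalIntegral.integral_of_le zero_le_one] at this
    simp only [one_smul, zero_smul, add_zero] at this
    rw [← this, ← integral_mul_const]
    refine integral_congr_ae (ae_of_all _ fun t => ?_)
    simp only [Finset.sum_mul]
    exact Finset.sum_congr rfl fun i _ => by ring
  have hF : Continuous fun p : α × ℝ => ∑ i, pd i q (ξ p.1 + p.2 • v p.1) * (v p.1 i * g p.1) := by
    fun_prop
  calc |∫ a, (q (ξ a + v a) - q (ξ a)) * g a ∂μ|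
      = |∫ t in Set.Ioc (0 : ℝ) 1, (1 : ℝ) *
          ∑ i, ∫ a, pd i q (ξ a + t • v a) * (v a i * g a) ∂μ| := by
        simp only [key]
        rw [hμ.integral_swap compactlyCarried_restrict_Ioc (F := fun a t =>
          ∑ i, pd i q (ξ a + t • v a) * (v a i * g a)) hF]
        congr 1
        refine integral_congr_ae (ae_of_all _ fun t => ?_)
        simp only [one_mul]
        rw [integral_finsetSum]
        intro i _
        exact hμ.integrable (by fun_prop)
    _ ≤ M * ∫ t in Set.Ioc (0 : ℝ) 1, |(1 : ℝ)| :=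
        abs_integral_mul_le (integrable_const _)
          ((ae_restrict_iff' measurableSet_Ioc).2 (ae_of_all _ hM))
    _ = M := by simp

/-- Transfer of a divergence onto a mollification kernel. -/
lemma abs_integral_kernel_le {μ : Measure α} (hμ : CompactlyCarried μ) {ψ : E3 → ℝ} {ε : ℝ}
    (hψ : ContDiff ℝ 1 ψ) (hψ0 : ∀ z, 0 ≤ ψ z) (hψs : ∀ z, z ∉ ball3 ε → ψ z = 0)
    (hψ1 : ∫ z, ψ z = 1) {C : ℝ} (hψC : ∀ k, ∫ z, |pd k ψ z| ≤ C)
    {P N : E3 → ℝ} {A : Fin 3 → E3 → ℝ} (hN : Continuous N)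
    (hA : ∀ k, ContDiff ℝ 1 (A k)) (hP : ∀ x, P x = ∑ k, pd k (A k) x + N x)
    {ξ : α → E3} (hξ : Continuous ξ) {h : α → ℝ} (hh : Continuous h) {M₁ M₂ : ℝ} (hM₁ : 0 ≤ M₁)
    (h₁ : ∀ k, ∀ z ∈ ball3 ε, |∫ a, A k (ξ a - z) * h a ∂μ| ≤ M₁)
    (h₂ : ∀ z ∈ ball3 ε, |∫ a, N (ξ a - z) * h a ∂μ| ≤ M₂) :
    |∫ z, ψ z * ∫ a, P (ξ a - z) * h a ∂μ| ≤ 3 * (C * M₁) + M₂ := by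
  have := hμ.finite
  have hν := compactlyCarried_restrict_ball3 ε
  have hψc := hψ.continuous
  have hpψ : ∀ k, Continuous (pd k ψ) := fun k => continuous_pd k hψ
  have hpA : ∀ k, Continuous (pd k (A k)) := fun k => continuous_pd k (hA k)
  have hAc : ∀ k, Continuous (A k) := fun k => (hA k).continuous
  have hpψs : ∀ k z, z ∉ ball3 ε → pd k ψ z = 0 := fun k z hz =>
    pd_eq_zero_of_nonneg_of_eq_zero hψ0 k (hψs z hz)
  have hcs : HasCompactSupport ψ := HasCompactSupport.intro (isCompact_closedBall (0 : E3) ε)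
    fun x hx => hψs x fun h' => hx (ball_subset_closedBall h')
  have hloc : ∀ {G : E3 → ℝ}, (∀ z, z ∉ ball3 ε → G z = 0) → ∫ z in ball3 ε, G z = ∫ z, G z :=
    fun hG => setIntegral_eq_integral_of_forall_compl_eq_zero hG
  have hibp : ∀ k a, ∫ z in ball3 ε, ψ z * pd k (A k) (ξ a - z)
      = ∫ z in ball3 ε, pd k ψ z * A k (ξ a - z) := by
    intro k a
    rw [hloc (fun z hz => by rw [hψs z hz, zero_mul]),
      hloc (fun z hz => by rw [hpψs k z hz, zero_mul])]
    have hg1 : ContDiff ℝ 1 fun z => A k (ξ a - z) :=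
      (hA k).comp (contDiff_const.sub contDiff_id)
    have e1 : ∀ z, pd k (fun z => A k (ξ a - z)) z = - pd k (A k) (ξ a - z) := by
      intro z
      have h2 := (((hA k).differentiable (by simp)) (ξ a - z)).hasFDerivAt.comp z
        ((hasFDerivAt_id (𝕜 := ℝ) z).const_sub (ξ a))
      have h3 := h2.fderiv
      simp only [pd]
      change fderiv ℝ (A k ∘ fun z => ξ a - z) z _ = _
      erw [h3]
      simp
    have := integral_pd_mul k hg1 hψ hcs
    simp only [e1, neg_mul, integral_neg, neg_inj] at this
    rw [show (∫ z, ψ z * pd k (A k) (ξ a - z)) = ∫ z, pd k (A k) (ξ a - z) * ψ z by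
      simp only [mul_comm], this]
    simp only [mul_comm]
  have hNcont : Continuous N := hN
  have hPc : Continuous P := by
    have : P = fun x => ∑ k, pd k (A k) x + N x := funext hP
    rw [this]; fun_prop
  have swap : ∀ {w G : E3 → ℝ}, Continuous w → Continuous G →
      ∫ z in ball3 ε, w z * ∫ a, G (ξ a - z) * h a ∂μ
        = ∫ a, (∫ z in ball3 ε, w z * G (ξ a - z)) * h a ∂μ := by
    intro w G hw hG
    have := hμ.integral_swap hν (F := fun a z => w z * G (ξ a - z) * h a) (by fun_prop)
    simp only [integral_mul_const] at this
    rw [this]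
    refine integral_congr_ae (ae_of_all _ fun z => ?_)
    simp only [mul_assoc, integral_const_mul]
  have e : ∫ z, ψ z * ∫ a, P (ξ a - z) * h a ∂μ
      = ∑ k, (∫ z in ball3 ε, pd k ψ z * ∫ a, A k (ξ a - z) * h a ∂μ)
        + ∫ z in ball3 ε, ψ z * ∫ a, N (ξ a - z) * h a ∂μ := by
    have e2 : ∀ z, ∫ a, P (ξ a - z) * h a ∂μ
        = ∑ k, (∫ a, pd k (A k) (ξ a - z) * h a ∂μ) + ∫ a, N (ξ a - z) * h a ∂μ := by
      intro z
      rw [← integral_finsetSum, ← integral_add]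
      · refine integral_congr_ae (ae_of_all _ fun a => ?_)
        simp only [hP, add_mul, Finset.sum_mul]
      · exact hμ.integrable (by fun_prop)
      · exact hμ.integrable (by fun_prop)
      · intro k _; exact hμ.integrable (by fun_prop)
    have hcont : ∀ {G : E3 → ℝ}, Continuous G → Continuous fun z => ∫ a, G (ξ a - z) * h a ∂μ := by
      intro G hG
      exact hμ.continuous_integral (by fun_prop)
    rw [← hloc (fun z hz => by rw [hψs z hz, zero_mul])]
    simp only [e2, mul_add, Finset.mul_sum]
    rw [integral_add, integral_finsetSum]
    · congr 1
      refine Finset.sum_congr rfl fun k _ => ?_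
      rw [swap hψc (hpA k), swap (hpψ k) (hAc k)]
      simp only [hibp]
    · intro k _
      exact hν.integrable (hψc.mul (hcont (hpA k)))
    · exact hν.integrable (continuous_finsetSum _ fun k _ => hψc.mul (hcont (hpA k)))
    · exact hν.integrable (hψc.mul (hcont hN))
  rw [e]
  refine (abs_add_le _ _).trans (add_le_add ?_ ?_)
  · refine (Finset.abs_sum_le_sum_abs _ _).trans ?_
    refine (Finset.sum_le_sum (g := fun _ => C * M₁) fun k _ => ?_).trans (by simp)
    refine (abs_integral_mul_le (hν.integrable (hpψ k))
      ((ae_restrict_iff' isOpen_ball.measurableSet).2 (ae_of_all _ (h₁ k)))).trans ?_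
    rw [hloc (fun z hz => by rw [hpψs k z hz, abs_zero]), mul_comm]
    gcongr
    exact hψC k
  · refine (abs_integral_mul_le (hν.integrable hψc)
      ((ae_restrict_iff' isOpen_ball.measurableSet).2 (ae_of_all _ h₂))).trans ?_
    rw [hloc (fun z hz => by rw [hψs z hz, abs_zero])]
    simp only [abs_of_nonneg (hψ0 _), hψ1, mul_one, le_refl]

/-- Mollification kernels at every scale. -/
lemma exists_kernel : ∃ C : ℝ, 1 ≤ C ∧ ∀ ε : ℝ, 0 < ε → ∃ ψ : E3 → ℝ,
    ContDiff ℝ (⊤ : ℕ∞) ψ ∧ (∀ z, 0 ≤ ψ z) ∧ (∀ z, z ∉ ball3 ε → ψ z = 0) ∧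
    ∫ z, ψ z = 1 ∧ ∀ k, ∫ z, |pd k ψ z| ≤ C / ε := by
  obtain ⟨C, hC1, hC⟩ := exists_cutoff
  refine ⟨16 * C, by linarith, fun ε hε => ?_⟩
  obtain ⟨φ, hφ, h0, h1, hin, hout, hd, -⟩ := hC (ε / 2) ε (by linarith) (by linarith)
  have hout' : ∀ z, z ∉ ball3 ε → φ z = 0 := fun z hz => hout z (by simpa [ball3] using hz)
  have hφ1 : ContDiff ℝ 1 φ := hφ.of_le (by simp)
  have hcs : HasCompactSupport φ := HasCompactSupport.intro (isCompact_closedBall (0 : E3) ε)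
    fun x hx => hout' x fun h' => hx (ball_subset_closedBall h')
  set I := ∫ z, φ z with hI
  have hV : (volume (ball3 ε)).toReal = 8 * (volume (ball3 (ε / 2))).toReal := by
    rw [volume_ball3_toReal hε.le, volume_ball3_toReal (by linarith)]; ring
  have hVpos : 0 < (volume (ball3 (ε / 2))).toReal := by
    rw [volume_ball3_toReal (by linarith)]; positivity
  have hIV : (volume (ball3 (ε / 2))).toReal ≤ I := by
    have e1 : ∫ z in ball3 (ε / 2), φ z = (volume (ball3 (ε / 2))).toReal := by
      rw [setIntegral_congr_fun (s := ball3 (ε / 2)) (g := fun _ => (1 : ℝ)) isOpen_ball.measurableSet]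
      · simp [measureReal_def]
      · intro z hz
        refine hin z ?_
        have : ‖z‖ < ε / 2 := by simpa [ball3] using hz
        exact this.le
    rw [← e1]
    exact setIntegral_le_integral (hφ.continuous.integrable_of_hasCompactSupport hcs)
      (ae_of_all _ h0)
  have hIpos : 0 < I := hVpos.trans_le hIV
  refine ⟨fun z => I⁻¹ * φ z, contDiff_const.mul hφ, fun z => by have := h0 z; positivity,
    fun z hz => by simp only [hout' z hz, mul_zero], ?_, fun k => ?_⟩
  · rw [integral_const_mul, inv_mul_cancel₀ hIpos.ne']
  · have e1 : ∀ z, pd k (fun z => I⁻¹ * φ z) z = I⁻¹ * pd k φ z := by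
      intro z
      rw [pd_mul k (f := fun _ => I⁻¹) (by fun_prop)
        ((hφ1.differentiable (by simp)).differentiableAt), pd_const]
      ring
    have hz : ∀ z, z ∉ ball3 ε → |pd k φ z| = 0 := fun z hz => by
      rw [pd_eq_zero_of_nonneg_of_eq_zero h0 k (hout' z hz), abs_zero]
    simp only [e1, abs_mul, integral_const_mul]
    rw [← setIntegral_eq_integral_of_forall_compl_eq_zero hz, abs_of_pos (inv_pos.2 hIpos)]
    have e2 : ∫ z in ball3 ε, |pd k φ z| ≤ C / (ε - ε / 2) * (volume (ball3 ε)).toReal := by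
      rw [← measureReal_def, mul_comm, ← smul_eq_mul, ← setIntegral_const]
      exact integral_mono (integrableOn_of_subset_ball3 (subset_refl _)
        (continuous_pd k hφ1).abs) (integrableOn_of_subset_ball3 (subset_refl _)
        continuous_const) fun z => hd k z
    calc I⁻¹ * ∫ z in ball3 ε, |pd k φ z|
        ≤ I⁻¹ * (C / (ε - ε / 2) * (8 * I)) := by
          refine mul_le_mul_of_nonneg_left (e2.trans ?_) (by positivity)
          rw [hV]
          have : 0 ≤ C / (ε - ε / 2) := div_nonneg (by linarith) (by linarith)
          gcongr
      _ = _ := by field_simp; ring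

end CarriedMeasures
section PressureSource

/-- Bounds on the ball of radius `r` for a source `∑ₖ ∂ₖ Aₖ + ∑ₗ aₗ cₗ`. -/
structure SourceData {ι : Type} [Fintype ι] (r YA YD Y₃ Y₆ : ℝ) (P : E3 → ℝ)
    (A : Fin 3 → E3 → ℝ) (a c : ι → E3 → ℝ) : Prop where
  smooth_A : ∀ k, ContDiff ℝ 1 (A k)
  cont_a : ∀ l, Continuous (a l)
  cont_c : ∀ l, Continuous (c l)
  eq : ∀ x, P x = ∑ k, pd k (A k) x + ∑ l, a l x * c l x
  A_le : ∀ k, ∫ x in ball3 r, A k x ^ 2 ≤ YA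
  c_le : ∀ l, ∫ x in ball3 r, c l x ^ 2 ≤ YD
  a_le₃ : ∀ l, ∫ x in ball3 r, |a l x| ^ 3 ≤ Y₃
  a_le₆ : ∀ l, ∫ x in ball3 r, a l x ^ 6 ≤ Y₆

/-- Averages of nonnegative functions over the `ε`-translates of `ξ` are controlled by integrals
over the ball of radius `r`. -/
def Carries {α : Type*} [MeasurableSpace α] (μ : Measure α) (ξ : α → E3) (ε r : ℝ) : Prop :=
  ∀ N : E3 → ℝ, Continuous N → (∀ x, 0 ≤ N x) → ∀ z ∈ ball3 ε,
    ∫ a, N (ξ a - z) ∂μ ≤ ∫ x in ball3 r, N x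

lemma rpow_two_rpow_half {x : ℝ} (hx : 0 ≤ x) : (x ^ 2) ^ (1 / 2 : ℝ) = x := by
  rw [← Real.sqrt_eq_rpow, Real.sqrt_sq hx]

lemma abs_eq_rpow_mul_rpow {s x : ℝ} (hs : 3 < s) :
    |x| = (|x| ^ 3) ^ (2 / 3 - 2 / s) * (x ^ 6) ^ (1 / s - 1 / 6) := by
  rw [show x ^ 6 = |x| ^ 6 by rw [← Even.pow_abs (by decide)]]
  rcases (abs_nonneg x).eq_or_lt with h | h
  · rw [← h]
    have : (2 / 3 - 2 / s) ≠ 0 := by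
      have : 2 / s < 2 / 3 := by gcongr
      linarith
    rw [zero_pow (by norm_num), Real.zero_rpow this, zero_mul]
  · rw [← Real.rpow_natCast, ← Real.rpow_natCast, ← Real.rpow_mul h.le, ← Real.rpow_mul h.le,
      ← Real.rpow_add h]
    have : ((3 : ℕ) : ℝ) * (2 / 3 - 2 / s) + ((6 : ℕ) : ℝ) * (1 / s - 1 / 6) = 1 := by
      push_cast; field_simp; ring
    rw [this, Real.rpow_one]

namespace SourceData

variable {ι : Type} [Fintype ι] {r YA YD Y₃ Y₆ : ℝ} {P : E3 → ℝ}
    {A : Fin 3 → E3 → ℝ} {a c : ι → E3 → ℝ}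

lemma YA_nonneg (H : SourceData r YA YD Y₃ Y₆ P A a c) : 0 ≤ YA :=
  (integral_nonneg fun _ => sq_nonneg _).trans (H.A_le 0)

/-- Dual bound for the mollified source against a weight in `L² ∩ Lˢ`. -/
lemma abs_integral_le (H : SourceData r YA YD Y₃ Y₆ P A a c)
    {α : Type*} [TopologicalSpace α] [T2Space α] [SecondCountableTopology α]
    [MeasurableSpace α] [BorelSpace α] {μ : Measure α} (hμ : CompactlyCarried μ)
    {ξ : α → E3} (hξ : Continuous ξ) {ε : ℝ} (hc : Carries μ ξ ε r)
    {ψ : E3 → ℝ} (hψ : ContDiff ℝ 1 ψ) (hψ0 : ∀ z, 0 ≤ ψ z) (hψs : ∀ z, z ∉ ball3 ε → ψ z = 0)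
    (hψ1 : ∫ z, ψ z = 1) {C : ℝ} (hψC : ∀ k, ∫ z, |pd k ψ z| ≤ C)
    {s : ℝ} (hs : 3 < s) (hs6 : s ≤ 6) {h F : α → ℝ} {m X₂ Xs : ℝ} (hm : 0 < m)
    (hh : Continuous h) (hF : Continuous F) (hhF : ∀ᵐ a ∂μ, |h a| ≤ m * |F a|)
    (hX₂ : ∫ a, F a ^ 2 ∂μ ≤ X₂) (hXs : ∫ a, |F a| ^ s ∂μ ≤ Xs) :
    |∫ z, ψ z * ∫ a, P (ξ a - z) * h a ∂μ| ≤ m * (3 * (C * (X₂ ^ (1 / 2 : ℝ) * YA ^ (1 / 2 : ℝ)))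
      + Fintype.card ι * (Xs ^ (1 / s) * YD ^ (1 / 2 : ℝ) * Y₃ ^ (2 / 3 - 2 / s)
        * Y₆ ^ (1 / s - 1 / 6))) := by
  have := hμ.finite
  have hAc : ∀ k, Continuous (A k) := fun k => (H.smooth_A k).continuous
  have hac := H.cont_a
  have hcc := H.cont_c
  have hX₂0 : 0 ≤ X₂ := (integral_nonneg fun _ => sq_nonneg _).trans hX₂
  have hs0 : 0 < s := by linarith
  set h' : α → ℝ := fun a => max (-|F a|) (min |F a| (m⁻¹ * h a)) with hh'
  have hh'c : Continuous h' := by fun_prop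
  have hle : ∀ a, |h' a| ≤ |F a| := fun a => abs_le.2 ⟨le_max_left _ _,
    max_le (by linarith [abs_nonneg (F a)]) (min_le_left _ _)⟩
  have heq : ∀ᵐ a ∂μ, h a = m * h' a := by
    filter_upwards [hhF] with a ha
    have : |m⁻¹ * h a| ≤ |F a| := by
      rwa [abs_mul, abs_of_pos (inv_pos.2 hm), inv_mul_le_iff₀ hm]
    simp only [hh']
    rw [min_eq_right (abs_le.1 this).2, max_eq_right (abs_le.1 this).1, mul_inv_cancel_left₀ hm.ne']
  have e : ∫ z, ψ z * ∫ a, P (ξ a - z) * h a ∂μ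
      = m * ∫ z, ψ z * ∫ a, P (ξ a - z) * h' a ∂μ := by
    rw [← integral_const_mul]
    refine integral_congr_ae (ae_of_all _ fun z => ?_)
    dsimp only
    rw [mul_left_comm m, ← integral_const_mul m]
    congr 1
    refine integral_congr_ae ?_
    filter_upwards [heq] with a ha
    rw [ha]
    ring
  rw [e, abs_mul, abs_of_pos hm]
  refine mul_le_mul_of_nonneg_left ?_ hm.le
  refine abs_integral_kernel_le hμ hψ hψ0 hψs hψ1 hψC (by fun_prop) H.smooth_A H.eq hξ hh'c
    (mul_nonneg (Real.rpow_nonneg hX₂0 _) (Real.rpow_nonneg H.YA_nonneg _)) ?_ ?_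
  · intro k z hz
    refine abs_integral_le_holder2 (f₁ := fun a => F a ^ 2) (f₂ := fun a => A k (ξ a - z) ^ 2)
      (hμ.integrable (by fun_prop)) (hμ.integrable (by fun_prop)) (fun _ => sq_nonneg _)
      (fun _ => sq_nonneg _) (by norm_num) (by norm_num) (by norm_num) hX₂
      ((hc (fun x => A k x ^ 2) (by fun_prop) (fun _ => sq_nonneg _) z hz).trans (H.A_le k)) ?_
    intro a
    rw [← sq_abs (F a), ← sq_abs (A k _), rpow_two_rpow_half (abs_nonneg _),
      rpow_two_rpow_half (abs_nonneg _), abs_mul, mul_comm]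
    exact mul_le_mul_of_nonneg_right (hle a) (abs_nonneg _)
  · intro z hz
    have e2 : ∫ a', (∑ l, a l (ξ a' - z) * c l (ξ a' - z)) * h' a' ∂μ
        = ∑ l, ∫ a', a l (ξ a' - z) * c l (ξ a' - z) * h' a' ∂μ := by
      rw [← integral_finsetSum]
      · simp only [Finset.sum_mul]
      · intro l _
        exact hμ.integrable (by fun_prop)
    rw [e2]
    refine (Finset.abs_sum_le_sum_abs _ _).trans ?_
    rw [← nsmul_eq_mul]
    refine Finset.sum_le_card_nsmul _ _ _ fun l _ => ?_
    refine abs_integral_le_holder4 (f₁ := fun a => |F a| ^ s) (f₂ := fun x => c l (ξ x - z) ^ 2)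
      (f₃ := fun x => |a l (ξ x - z)| ^ 3) (f₄ := fun x => a l (ξ x - z) ^ 6)
      (hμ.integrable (hF.abs.rpow_const fun _ => Or.inr hs0.le))
      (hμ.integrable (by fun_prop)) (hμ.integrable (by fun_prop)) (hμ.integrable (by fun_prop))
      (fun _ => by positivity) (fun _ => sq_nonneg _) (fun _ => by positivity)
      (fun _ => by positivity) (by positivity) (by norm_num) ?_ ?_ ?_ hXs
      ((hc (fun x => c l x ^ 2) (by fun_prop) (fun _ => sq_nonneg _) z hz).trans (H.c_le l))
      ((hc (fun x => |a l x| ^ 3) (by fun_prop) (fun _ => by positivity) z hz).trans (H.a_le₃ l))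
      ((hc (fun x => a l x ^ 6) (by fun_prop) (fun _ => by positivity) z hz).trans (H.a_le₆ l)) ?_
    · have : 2 / s < 2 / 3 := by gcongr
      linarith
    · have : 1 / 6 ≤ 1 / s := by gcongr
      linarith
    · field_simp; ring
    · intro x
      rw [mul_assoc (_ * _), ← abs_eq_rpow_mul_rpow hs, ← sq_abs (c l _),
        rpow_two_rpow_half (abs_nonneg _), ← Real.rpow_mul (abs_nonneg _),
        mul_one_div_cancel hs0.ne', Real.rpow_one, abs_mul, abs_mul]
      have := mul_le_mul_of_nonneg_left (hle x)
        (mul_nonneg (abs_nonneg (a l (ξ x - z))) (abs_nonneg (c l (ξ x - z))))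
      linarith

end SourceData

lemma Carries.mono {α : Type*} [MeasurableSpace α] {μ : Measure α} {ξ : α → E3} {ε r r' : ℝ}
    (h : Carries μ ξ ε r) (hr : r ≤ r') : Carries μ ξ ε r' := fun N hN h0 z hz =>
  (h N hN h0 z hz).trans (setIntegral_mono_set (integrableOn_of_subset_ball3 subset_rfl hN)
    (ae_of_all _ h0) (ball_subset_ball hr).eventuallyLE)

lemma measurableSet_ball3 (r : ℝ) : MeasurableSet (ball3 r) := isOpen_ball.measurableSet

/-- Integrals along a dilated and translated ball. -/
lemma setIntegral_comp_smul_add_le {r r' τ : ℝ} {y : E3} (hτ : 1 / 2 ≤ τ)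
    (hsub : ∀ x ∈ ball3 r, τ • x + y ∈ ball3 r') {N : E3 → ℝ} (hN : Continuous N)
    (h0 : ∀ x, 0 ≤ N x) : ∫ x in ball3 r, N (τ • x + y) ≤ 8 * ∫ x in ball3 r', N x := by
  have hτ0 : 0 < τ := by linarith
  set G : E3 → ℝ := (ball3 r').indicator N with hG
  have hG0 : ∀ x, 0 ≤ G x := fun x => Set.indicator_nonneg (fun x _ => h0 x) x
  have hGi : Integrable G := (integrable_indicator_iff isOpen_ball.measurableSet).2
    (integrableOn_of_subset_ball3 subset_rfl hN)
  have h1 : Integrable fun x => G (τ • x + y) :=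
    (hGi.comp_add_right y).comp_smul hτ0.ne'
  have e : ∫ x, G (τ • x + y) = |(τ ^ 3)⁻¹| * ∫ x in ball3 r', N x := by
    have := Measure.integral_comp_smul (volume : Measure E3) (fun x => G (x + y)) τ
    rw [this, integral_add_right_eq_self, hG, integral_indicator (measurableSet_ball3 r')]
    simp
  have h2 : |(τ ^ 3)⁻¹| ≤ 8 := by
    rw [abs_of_pos (by positivity), inv_le_comm₀ (by positivity) (by norm_num)]
    calc (8 : ℝ)⁻¹ = (1 / 2) ^ 3 := by norm_num
      _ ≤ τ ^ 3 := by gcongr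
  calc ∫ x in ball3 r, N (τ • x + y) = ∫ x in ball3 r, G (τ • x + y) := by
        refine setIntegral_congr_fun isOpen_ball.measurableSet fun x hx => ?_
        simp only [hG, Set.indicator_of_mem (hsub x hx)]
    _ ≤ ∫ x, G (τ • x + y) := setIntegral_le_integral h1 (ae_of_all _ fun x => hG0 _)
    _ ≤ _ := by
        rw [e]
        exact mul_le_mul_of_nonneg_right h2 (setIntegral_nonneg isOpen_ball.measurableSet
          fun x _ => h0 x)

lemma sub_mem_ball3 {r ε : ℝ} {x z : E3} (hx : x ∈ ball3 r) (hz : z ∈ ball3 ε) :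
    x - z ∈ ball3 (r + ε) := by
  simp only [ball3, mem_ball_zero_iff] at *
  exact (norm_sub_le _ _).trans_lt (by linarith)

lemma setIntegral_comp_sub_le {r r' : ℝ} {y : E3}
    (hsub : ∀ x ∈ ball3 r, x - y ∈ ball3 r') {N : E3 → ℝ} (hN : Continuous N)
    (h0 : ∀ x, 0 ≤ N x) : ∫ x in ball3 r, N (x - y) ≤ ∫ x in ball3 r', N x := by
  set G : E3 → ℝ := (ball3 r').indicator N with hG
  have hG0 : ∀ x, 0 ≤ G x := fun x => Set.indicator_nonneg (fun x _ => h0 x) x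
  have hGi : Integrable G := (integrable_indicator_iff isOpen_ball.measurableSet).2
    (integrableOn_of_subset_ball3 subset_rfl hN)
  calc ∫ x in ball3 r, N (x - y) = ∫ x in ball3 r, G (x - y) := by
        refine setIntegral_congr_fun isOpen_ball.measurableSet fun x hx => ?_
        simp only [hG, Set.indicator_of_mem (hsub x hx)]
    _ ≤ ∫ x, G (x - y) := setIntegral_le_integral (hGi.comp_sub_right y)
        (ae_of_all _ fun x => hG0 _)
    _ = _ := by
        rw [integral_sub_right_eq_self, hG, integral_indicator (measurableSet_ball3 r')]

lemma carries_restrict_ball3 (r ε : ℝ) :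
    Carries ((volume : Measure E3).restrict (ball3 r)) (fun x => x) ε (r + ε) :=
  fun _ hN h0 _ hz => setIntegral_comp_sub_le (fun _ hx => sub_mem_ball3 hx hz) hN h0

/-- The normalised product measure on pairs of points of the ball of radius `r`. -/
def pairMeasure (r : ℝ) : Measure (E3 × E3) :=
  (8 * volume (ball3 r))⁻¹ •
    ((volume : Measure E3).restrict (ball3 r)).prod ((volume : Measure E3).restrict (ball3 r))

lemma compactlyCarried_pairMeasure {r : ℝ} (hr : 0 < r) : CompactlyCarried (pairMeasure r) := by
  have h := (compactlyCarried_restrict_ball3 r).prod (compactlyCarried_restrict_ball3 r)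
  have := h.finite
  obtain ⟨K, hK, h0⟩ := h.carried
  have hne : (8 * volume (ball3 r))⁻¹ ≠ ⊤ := by
    simp only [ne_eq, ENNReal.inv_eq_top, mul_eq_zero, not_or]
    exact ⟨by norm_num, (measure_ball_pos volume (0 : E3) hr).ne'⟩
  refine ⟨Measure.smul_finite _ hne, K, hK, ?_⟩
  rw [pairMeasure, Measure.smul_apply, h0, smul_zero]

lemma integral_pairMeasure {r : ℝ} {F : E3 → E3 → ℝ}
    (hF : Continuous fun q : E3 × E3 => F q.1 q.2) :
    ∫ q, F q.1 q.2 ∂(pairMeasure r)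
      = (8 * (volume (ball3 r)).toReal)⁻¹ * ∫ x in ball3 r, ∫ y in ball3 r, F x y := by
  have h := (compactlyCarried_restrict_ball3 r).prod (compactlyCarried_restrict_ball3 r)
  rw [pairMeasure, integral_smul_measure, integral_prod _ (h.integrable hF)]
  simp [ENNReal.toReal_inv, ENNReal.toReal_mul]

lemma ae_pairMeasure (r : ℝ) : ∀ᵐ q ∂(pairMeasure r), q.1 ∈ ball3 r ∧ q.2 ∈ ball3 r := by
  refine Measure.ae_smul_measure ?_ _
  rw [Measure.prod_restrict]
  exact ae_restrict_mem ((measurableSet_ball3 r).prod (measurableSet_ball3 r))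

lemma integral_fst_pairMeasure_le {r : ℝ} (hr : 0 < r) {F : E3 → ℝ} (hF : Continuous F)
    (h0 : ∀ x, 0 ≤ F x) : ∫ q, F q.1 ∂(pairMeasure r) ≤ ∫ x in ball3 r, F x := by
  have hV : 0 < (volume (ball3 r)).toReal :=
    ENNReal.toReal_pos (measure_ball_pos volume (0 : E3) hr).ne' measure_ball_lt_top.ne
  have hI : 0 ≤ ∫ x in ball3 r, F x := setIntegral_nonneg (measurableSet_ball3 r) fun x _ => h0 x
  rw [integral_pairMeasure (F := fun x _ => F x) (by fun_prop)]
  simp only [setIntegral_const, smul_eq_mul, measureReal_def, integral_const_mul]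
  rw [inv_mul_le_iff₀ (by positivity)]
  nlinarith [mul_nonneg hV.le hI]

lemma carries_pairMeasure {r : ℝ} (hr : 0 < r) {ε t : ℝ} (h0t : 0 ≤ t) (ht1 : t ≤ 1) :
    Carries (pairMeasure r) (fun q => q.2 + t • (q.1 - q.2)) ε (r + ε) := by
  intro N hN h0 z hz
  have hV : 0 < (volume (ball3 r)).toReal :=
    ENNReal.toReal_pos (measure_ball_pos volume (0 : E3) hr).ne' measure_ball_lt_top.ne
  have hmem : ∀ x ∈ ball3 r, ∀ y ∈ ball3 r, y + t • (x - y) - z ∈ ball3 (r + ε) := by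
    intro x hx y hy
    refine sub_mem_ball3 ?_ hz
    exact (convex_ball (0 : E3) r).add_smul_sub_mem hy hx ⟨h0t, ht1⟩
  have key : ∀ G : E3 → E3 → ℝ, (∀ y ∈ ball3 r, ∫ x in ball3 r, G y x
      ≤ 8 * ∫ x in ball3 (r + ε), N x) → (Continuous fun q : E3 × E3 => G q.1 q.2) →
      ∫ y in ball3 r, ∫ x in ball3 r, G y x
        ≤ 8 * (volume (ball3 r)).toReal * ∫ x in ball3 (r + ε), N x := by
    intro G hG hGc
    have hi := ((compactlyCarried_restrict_ball3 r).prod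
      (compactlyCarried_restrict_ball3 r)).integrable hGc
    have := (compactlyCarried_restrict_ball3 r).finite
    refine (setIntegral_mono_on hi.integral_prod_left (integrable_const _)
      isOpen_ball.measurableSet hG).trans ?_
    rw [setIntegral_const, smul_eq_mul, measureReal_def]
    exact le_of_eq (by ring)
  rw [integral_pairMeasure (F := fun x y => N (y + t • (x - y) - z)) (by fun_prop),
    inv_mul_le_iff₀ (by positivity)]
  rcases le_total (1 / 2) t with ht | ht
  · rw [(compactlyCarried_restrict_ball3 r).integral_swap (compactlyCarried_restrict_ball3 r)
      (F := fun x y => N (y + t • (x - y) - z)) (by fun_prop)]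
    refine key (fun y x => N (y + t • (x - y) - z)) (fun y hy => ?_) (by fun_prop)
    have e : ∀ x, y + t • (x - y) - z = t • x + (y - t • y - z) := fun x => by
      rw [smul_sub]; abel
    simp only [e]
    exact setIntegral_comp_smul_add_le ht (fun x hx => e x ▸ hmem x hx y hy) hN h0
  · refine key (fun x y => N (y + t • (x - y) - z)) (fun x hx => ?_) (by fun_prop)
    have e : ∀ y, y + t • (x - y) - z = (1 - t) • y + (t • x - z) := fun y => by
      rw [smul_sub, sub_smul, one_smul]; abel
    simp only [e]
    exact setIntegral_comp_smul_add_le (by linarith) (fun y hy => e y ▸ hmem x hx y hy) hN h0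

end PressureSource
section PressureTest

/-- Mean value estimate for differences mollified by a kernel. -/
lemma abs_integral_mollified_sub_le {α : Type*} [TopologicalSpace α] [T2Space α]
    [SecondCountableTopology α] [MeasurableSpace α] [BorelSpace α] {μ : Measure α}
    (hμ : CompactlyCarried μ) {q : E3 → ℝ} (hq : ContDiff ℝ 1 q) {ξ v : α → E3}
    (hξ : Continuous ξ) (hv : Continuous v) {h : α → ℝ} (hh : Continuous h)
    {ψ : E3 → ℝ} {ε : ℝ} (hψ : Continuous ψ) (hψs : ∀ z, z ∉ ball3 ε → ψ z = 0) {M : ℝ}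
    (hM : ∀ t ∈ Set.Ioc (0 : ℝ) 1, ∀ i,
      |∫ z, ψ z * ∫ a, pd i q (ξ a + t • v a - z) * (v a i * h a) ∂μ| ≤ M) :
    |∫ z, ψ z * ∫ a, (q (ξ a + v a - z) - q (ξ a - z)) * h a ∂μ| ≤ 3 * M := by
  have hν := compactlyCarried_restrict_ball3 ε
  have := hμ.finite
  have := hν.finite
  have hqc := hq.continuous
  have hpc : ∀ i, Continuous (pd i q) := fun i => continuous_pd i hq
  have hvi : ∀ i, Continuous fun a => v a i := fun i => by fun_prop
  have hloc : ∀ G : E3 → α → ℝ, (Continuous fun y : E3 × α => G y.1 y.2) →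
      ∫ z, ψ z * ∫ a, G z a ∂μ
        = ∫ y, ψ y.1 * G y.1 y.2 ∂(((volume : Measure E3).restrict (ball3 ε)).prod μ) := by
    intro G hG
    rw [integral_prod _ ((hν.prod hμ).integrable (by fun_prop)),
      ← setIntegral_eq_integral_of_forall_compl_eq_zero
        (fun z hz => by rw [hψs z hz, zero_mul] : ∀ z, z ∉ ball3 ε → ψ z * ∫ a, G z a ∂μ = 0)]
    simp only [integral_const_mul]
  rw [hloc _ (by fun_prop)]
  have := abs_integral_sub_le (hν.prod hμ) hq (ξ := fun y : E3 × α => ξ y.2 - y.1)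
    (v := fun y => v y.2) (g := fun y => ψ y.1 * h y.2) (by fun_prop) (by fun_prop) (by fun_prop)
    (M := 3 * M) (fun t ht => by
      refine (Finset.abs_sum_le_sum_abs _ _).trans ?_
      refine (Finset.sum_le_sum (g := fun _ => M) fun i _ => ?_).trans (by simp)
      refine le_of_eq_of_le ?_ (hM t ht i)
      rw [hloc _ (by fun_prop)]
      congr 1
      refine integral_congr_ae (ae_of_all _ fun y => ?_)
      dsimp only
      rw [show ξ y.2 - y.1 + t • v y.2 = ξ y.2 + t • v y.2 - y.1 by abel]
      ring)
  refine le_of_eq_of_le ?_ this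
  congr 1
  refine integral_congr_ae (ae_of_all _ fun y => ?_)
  dsimp only
  rw [show ξ y.2 - y.1 + v y.2 = ξ y.2 + v y.2 - y.1 by abel]
  ring

variable {r r' ε : ℝ} {ι : Type} [Fintype ι] {YA YD Y₃ Y₆ : ℝ} {p : E3 → ℝ}
  {A : Fin 3 → Fin 3 → E3 → ℝ} {a : ι → E3 → ℝ} {c : Fin 3 → ι → E3 → ℝ}

lemma SourceData.abs_integral_translate_le {P : E3 → ℝ} {A : Fin 3 → E3 → ℝ} {c : ι → E3 → ℝ}
    (H : SourceData r' YA YD Y₃ Y₆ P A a c) {g : E3 → ℝ} (hg : ContDiff ℝ 1 g)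
    (hg0 : ∀ x, x ∉ ball3 r → g x = 0) (hgp : ∀ i x, x ∉ ball3 r → pd i g x = 0) {h : E3}
    (hh : ∀ x ∈ ball3 r, x - h ∈ ball3 r') {Z₂ Z₆ : ℝ}
    (hZ₂ : ∀ i, ∫ x in ball3 r, pd i g x ^ 2 ≤ Z₂) (hZ₆ : ∫ x in ball3 r, g x ^ 6 ≤ Z₆) :
    |∫ x in ball3 r, P (x - h) * g x| ≤ 3 * (Z₂ ^ (1 / 2 : ℝ) * YA ^ (1 / 2 : ℝ))
      + Fintype.card ι * (YD ^ (1 / 2 : ℝ) * Y₃ ^ (1 / 3 : ℝ) * Z₆ ^ (1 / 6 : ℝ)) := by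
  have hAc : ∀ k, Continuous (A k) := fun k => (H.smooth_A k).continuous
  have hac := H.cont_a
  have hcc := H.cont_c
  have hgc := hg.continuous
  have hpA : ∀ k, Continuous (pd k (A k)) := fun k => continuous_pd k (H.smooth_A k)
  have hpg : ∀ k, Continuous (pd k g) := fun k => continuous_pd k hg
  have hi : ∀ {G : E3 → ℝ}, Continuous G → IntegrableOn G (ball3 r) := fun hG =>
    integrableOn_of_subset_ball3 subset_rfl hG
  have hcs : HasCompactSupport g := HasCompactSupport.intro (isCompact_closedBall (0 : E3) r)
    fun x hx => hg0 x fun h' => hx (ball_subset_closedBall h')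
  have e : ∫ x in ball3 r, P (x - h) * g x
      = - ∑ k, (∫ x in ball3 r, A k (x - h) * pd k g x)
        + ∑ l, ∫ x in ball3 r, a l (x - h) * c l (x - h) * g x := by
    have e1 : ∀ k, ∫ x in ball3 r, A k (x - h) * pd k g x
        = - ∫ x in ball3 r, pd k (A k) (x - h) * g x := by
      intro k
      rw [setIntegral_eq_integral_of_forall_compl_eq_zero
          (fun x hx => by rw [hgp k x hx, mul_zero]),
        setIntegral_eq_integral_of_forall_compl_eq_zero
          (fun x hx => by rw [hg0 x hx, mul_zero])]
      have := integral_pd_mul (f := fun x => A k (x - h)) k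
        ((H.smooth_A k).comp (contDiff_id.sub contDiff_const)) hg hcs
      simp only [pd_comp_sub] at this
      rw [this, neg_neg]
    simp only [e1, Finset.sum_neg_distrib, neg_neg]
    rw [← integral_finsetSum _ fun k _ => hi (by fun_prop),
      ← integral_finsetSum _ fun k _ => hi (by fun_prop),
      ← integral_add (hi (by fun_prop)) (hi (by fun_prop))]
    refine integral_congr_ae (ae_of_all _ fun x => ?_)
    dsimp only
    rw [H.eq, add_mul, Finset.sum_mul, Finset.sum_mul]
  have htr : ∀ N : E3 → ℝ, Continuous N → (∀ x, 0 ≤ N x) →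
      ∫ x in ball3 r, N (x - h) ≤ ∫ x in ball3 r', N x := fun N hN h0 =>
    setIntegral_comp_sub_le hh hN h0
  rw [e]
  refine (abs_add_le _ _).trans (add_le_add ?_ ?_)
  · rw [abs_neg]
    refine (Finset.abs_sum_le_sum_abs _ _).trans ?_
    refine (Finset.sum_le_sum (g := fun _ => Z₂ ^ (1 / 2 : ℝ) * YA ^ (1 / 2 : ℝ))
      fun k _ => ?_).trans (by simp)
    refine abs_integral_le_holder2 (f₁ := fun x => pd k g x ^ 2) (f₂ := fun x => A k (x - h) ^ 2)
      (hi (by fun_prop)) (hi (by fun_prop)) (fun _ => sq_nonneg _) (fun _ => sq_nonneg _)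
      (by norm_num) (by norm_num) (by norm_num) (hZ₂ k)
      ((htr (fun x => A k x ^ 2) (by fun_prop) fun _ => sq_nonneg _).trans (H.A_le k)) ?_
    intro x
    rw [← sq_abs (pd k g x), ← sq_abs (A k _), rpow_two_rpow_half (abs_nonneg _),
      rpow_two_rpow_half (abs_nonneg _), abs_mul, mul_comm]
  · refine (Finset.abs_sum_le_sum_abs _ _).trans ?_
    rw [← nsmul_eq_mul]
    refine Finset.sum_le_card_nsmul _ _ _ fun l _ => ?_
    refine abs_integral_le_holder3 (f₁ := fun x => c l (x - h) ^ 2)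
      (f₂ := fun x => |a l (x - h)| ^ 3) (f₃ := fun x => g x ^ 6)
      (hi (by fun_prop)) (hi (by fun_prop)) (hi (by fun_prop)) (fun _ => sq_nonneg _)
      (fun _ => by positivity) (fun _ => by positivity)
      (by norm_num) (by norm_num) (by norm_num) (by norm_num)
      ((htr (fun x => c l x ^ 2) (by fun_prop) fun _ => sq_nonneg _).trans (H.c_le l))
      ((htr (fun x => |a l x| ^ 3) (by fun_prop) fun _ => by positivity).trans (H.a_le₃ l)) hZ₆ ?_
    intro x
    rw [← sq_abs (c l _), rpow_two_rpow_half (abs_nonneg _),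
      show g x ^ 6 = |g x| ^ 6 by rw [← Even.pow_abs (by decide)],
      ← Real.rpow_natCast (|a l _|), ← Real.rpow_natCast (|g x|), ← Real.rpow_mul (abs_nonneg _),
      ← Real.rpow_mul (abs_nonneg _)]
    norm_num
    rw [mul_comm (|a l _|)]

/-- A pressure whose gradient is controlled on the ball of radius `r'`, tested against the
transport of a cut-off `χ` by a divergence-free field with potential `φ`. -/
structure PressureData (s r r' YA YD Y₃ Y₆ m X₂ Xs : ℝ) (p χ : E3 → ℝ) (u : Fin 3 → E3 → ℝ)
    (φ : Fin 3 → Fin 3 → E3 → ℝ) (A : Fin 3 → Fin 3 → E3 → ℝ) (a : ι → E3 → ℝ)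
    (c : Fin 3 → ι → E3 → ℝ) : Prop where
  pos_r : 0 < r
  pos_m : 0 < m
  source : ∀ j, SourceData r' YA YD Y₃ Y₆ (pd j p) (A j) a (c j)
  smooth_p : ContDiff ℝ (⊤ : ℕ∞) p
  smooth_χ : ContDiff ℝ (⊤ : ℕ∞) χ
  smooth_u : ∀ j, ContDiff ℝ (⊤ : ℕ∞) (u j)
  smooth_φ : ∀ i j, ContDiff ℝ (⊤ : ℕ∞) (φ i j)
  tsupport_χ : tsupport χ ⊆ ball3 r
  u_eq : ∀ j x, u j x = ∑ i, pd i (φ i j) x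
  div_u : ∀ x, ∑ j, pd j (u j) x = 0
  pd_χ_le : ∀ j x, |pd j χ x| ≤ m
  pd_pd_χ_le : ∀ i j x, 2 * r * |pd i (pd j χ) x| ≤ m
  φ_sq_le : ∀ i j, ∫ x in ball3 r, φ i j x ^ 2 ≤ X₂
  φ_rpow_le : ∀ i j, ∫ x in ball3 r, |φ i j x| ^ s ≤ Xs

namespace PressureData

variable {s m X₂ Xs : ℝ} {χ : E3 → ℝ} {u : Fin 3 → E3 → ℝ} {φ : Fin 3 → Fin 3 → E3 → ℝ}

lemma tsupport_pd_subset (f : E3 → ℝ) (i : Fin 3) : tsupport (pd i f) ⊆ tsupport f :=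
  closure_minimal (fun x hx => by
    by_contra h
    exact hx (pd_eq_zero_of_notMem_tsupport i h)) (isClosed_tsupport f)

lemma hasCompactSupport (H : PressureData s r r' YA YD Y₃ Y₆ m X₂ Xs p χ u φ A a c) :
    HasCompactSupport χ :=
  (isCompact_closedBall (0 : E3) r).of_isClosed_subset (isClosed_tsupport χ)
    (H.tsupport_χ.trans ball_subset_closedBall)

lemma eq_zero_of_tsupport {g : E3 → ℝ} (hg : tsupport g ⊆ ball3 r) {x : E3} (hx : x ∉ ball3 r) :
    g x = 0 := image_eq_zero_of_notMem_tsupport fun h => hx (hg h)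

lemma pd_eq_zero (H : PressureData s r r' YA YD Y₃ Y₆ m X₂ Xs p χ u φ A a c) (j : Fin 3) {x : E3}
    (hx : x ∉ ball3 r) : pd j χ x = 0 :=
  eq_zero_of_tsupport ((tsupport_pd_subset χ j).trans H.tsupport_χ) hx

lemma pd_pd_eq_zero (H : PressureData s r r' YA YD Y₃ Y₆ m X₂ Xs p χ u φ A a c) (i j : Fin 3)
    {x : E3} (hx : x ∉ ball3 r) : pd i (pd j χ) x = 0 :=
  eq_zero_of_tsupport ((tsupport_pd_subset _ i).trans
    ((tsupport_pd_subset χ j).trans H.tsupport_χ)) hx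

lemma integral_test_eq_zero (H : PressureData s r r' YA YD Y₃ Y₆ m X₂ Xs p χ u φ A a c) :
    ∫ x in ball3 r, ∑ j, u j x * pd j χ x = 0 := by
  have hu1 : ∀ j, ContDiff ℝ 1 (u j) := fun j => (H.smooth_u j).of_le (by simp)
  have hχ1 : ContDiff ℝ 1 χ := H.smooth_χ.of_le (by simp)
  have hcu : ∀ j, Continuous (u j) := fun j => (hu1 j).continuous
  have hpu : ∀ j, Continuous (pd j (u j)) := fun j => continuous_pd j (hu1 j)
  have hpχ : ∀ j, Continuous (pd j χ) := fun j => continuous_pd j hχ1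
  have hcχ := hχ1.continuous
  rw [setIntegral_eq_integral_of_forall_compl_eq_zero fun x hx => by
    simp [H.pd_eq_zero _ hx]]
  rw [integral_finsetSum _ (f := fun j x => u j x * pd j χ x) fun j _ => ((hcu j).mul (hpχ j)).integrable_of_hasCompactSupport
    (H.hasCompactSupport.pd j).mul_left]
  have e : ∀ j, ∫ x, u j x * pd j χ x = - ∫ x, pd j (u j) x * χ x := fun j => by
    rw [integral_pd_mul j (hu1 j) hχ1 H.hasCompactSupport, neg_neg]
  simp only [e, Finset.sum_neg_distrib]
  rw [← integral_finsetSum _ (f := fun j x => pd j (u j) x * χ x) fun j _ => ((hpu j).mul hcχ).integrable_of_hasCompactSupport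
    H.hasCompactSupport.mul_left]
  simp only [← Finset.sum_mul, H.div_u, zero_mul, integral_zero, neg_zero]

lemma integral_mul_test (H : PressureData s r r' YA YD Y₃ Y₆ m X₂ Xs p χ u φ A a c) {q : E3 → ℝ}
    (hq : ContDiff ℝ 1 q) : ∫ x in ball3 r, q x * ∑ j, u j x * pd j χ x
      = - ∑ i, ∑ j, ((∫ x in ball3 r, pd i q x * (φ i j x * pd j χ x))
        + ∫ x in ball3 r, q x * (φ i j x * pd i (pd j χ) x)) := by
  have hφ1 : ∀ i j, ContDiff ℝ 1 (φ i j) := fun i j => (H.smooth_φ i j).of_le (by simp)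
  have hχ1 : ∀ j, ContDiff ℝ 1 (pd j χ) := fun j => (contDiff_pd j H.smooth_χ).of_le (by simp)
  have hqc := hq.continuous
  have hpq : ∀ i, Continuous (pd i q) := fun i => continuous_pd i hq
  have hcφ : ∀ i j, Continuous (φ i j) := fun i j => (hφ1 i j).continuous
  have hpφ : ∀ i j, Continuous (pd i (φ i j)) := fun i j => continuous_pd i (hφ1 i j)
  have hcχ : ∀ j, Continuous (pd j χ) := fun j => (hχ1 j).continuous
  have hpχ : ∀ i j, Continuous (pd i (pd j χ)) := fun i j => continuous_pd i (hχ1 j)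
  have hi : ∀ {G : E3 → ℝ}, Continuous G → IntegrableOn G (ball3 r) := fun hG =>
    integrableOn_of_subset_ball3 subset_rfl hG
  have e : ∀ i j, (∫ x in ball3 r, pd i q x * (φ i j x * pd j χ x))
        + ∫ x in ball3 r, q x * (φ i j x * pd i (pd j χ) x)
      = - ∫ x in ball3 r, pd i (φ i j) x * (q x * pd j χ x) := by
    intro i j
    rw [← integral_add (hi (by fun_prop)) (hi (by fun_prop)),
      setIntegral_eq_integral_of_forall_compl_eq_zero
        (fun x hx => by rw [H.pd_eq_zero j hx, H.pd_pd_eq_zero i j hx]; ring),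
      setIntegral_eq_integral_of_forall_compl_eq_zero
        (fun x hx => by rw [H.pd_eq_zero j hx]; ring),
      integral_pd_mul i (hφ1 i j) (hq.mul (hχ1 j)) (H.hasCompactSupport.pd j).mul_left, neg_neg]
    refine integral_congr_ae (ae_of_all _ fun x => ?_)
    dsimp only
    rw [pd_mul i (hq.differentiable (by simp) x) ((hχ1 j).differentiable (by simp) x)]
    ring
  simp only [e, Finset.sum_neg_distrib, neg_neg]
  rw [Finset.sum_congr rfl fun i _ => (integral_finsetSum Finset.univ
      (f := fun j x => pd i (φ i j) x * (q x * pd j χ x)) fun j _ => hi (by fun_prop)).symm,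
    ← integral_finsetSum _ fun i _ => hi (by fun_prop)]
  refine integral_congr_ae (ae_of_all _ fun x => ?_)
  simp only [H.u_eq, Finset.mul_sum, Finset.sum_mul]
  rw [Finset.sum_comm]
  refine Finset.sum_congr rfl fun i _ => Finset.sum_congr rfl fun j _ => by ring

end PressureData

end PressureTest
namespace PressureData

variable {r r' ε : ℝ} {ι : Type} [Fintype ι] {YA YD Y₃ Y₆ : ℝ} {p : E3 → ℝ}
  {A : Fin 3 → Fin 3 → E3 → ℝ} {a : ι → E3 → ℝ} {c : Fin 3 → ι → E3 → ℝ}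
  {s m X₂ Xs : ℝ} {χ : E3 → ℝ} {u : Fin 3 → E3 → ℝ} {φ : Fin 3 → Fin 3 → E3 → ℝ}

/-- The part of the pressure pairing in which the pressure is mollified. -/
lemma abs_integral_mollified_le
    (H : PressureData s r r' YA YD Y₃ Y₆ m X₂ Xs p χ u φ A a c) (hs : 3 < s) (hs6 : s ≤ 6)
    {ψ : E3 → ℝ} (hψ : ContDiff ℝ 1 ψ) (hψ0 : ∀ z, 0 ≤ ψ z) (hψs : ∀ z, z ∉ ball3 ε → ψ z = 0)
    (hψ1 : ∫ z, ψ z = 1) {C : ℝ} (hψC : ∀ k, ∫ z, |pd k ψ z| ≤ C) (hε : r + ε ≤ r') :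
    |∫ z, ψ z * ∫ x in ball3 r, p (x - z) * ∑ j, u j x * pd j χ x| ≤
      225 * (m * (3 * (C * (X₂ ^ (1 / 2 : ℝ) * YA ^ (1 / 2 : ℝ)))
      + Fintype.card ι * (Xs ^ (1 / s) * YD ^ (1 / 2 : ℝ) * Y₃ ^ (2 / 3 - 2 / s)
        * Y₆ ^ (1 / s - 1 / 6)))) := by
  set M := m * (3 * (C * (X₂ ^ (1 / 2 : ℝ) * YA ^ (1 / 2 : ℝ)))
      + Fintype.card ι * (Xs ^ (1 / s) * YD ^ (1 / 2 : ℝ) * Y₃ ^ (2 / 3 - 2 / s)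
        * Y₆ ^ (1 / s - 1 / 6))) with hM
  have hs0 : 0 < s := by linarith
  have hp1 : ContDiff ℝ 1 p := H.smooth_p.of_le (by simp)
  have hpc := hp1.continuous
  have hψc := hψ.continuous
  have hpp : ∀ i, Continuous (pd i p) := fun i => continuous_pd i hp1
  have hcφ : ∀ i j, Continuous (φ i j) := fun i j => (H.smooth_φ i j).continuous
  have hχ1 : ∀ j, ContDiff ℝ 1 (pd j χ) := fun j => (contDiff_pd j H.smooth_χ).of_le (by simp)
  have hcχ : ∀ j, Continuous (pd j χ) := fun j => (hχ1 j).continuous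
  have hpχ : ∀ i j, Continuous (pd i (pd j χ)) := fun i j => continuous_pd i (hχ1 j)
  have hB := compactlyCarried_restrict_ball3 r
  have hQ := compactlyCarried_pairMeasure H.pos_r
  have hcs : HasCompactSupport ψ := HasCompactSupport.intro (isCompact_closedBall (0 : E3) ε)
    fun x hx => hψs x fun h' => hx (ball_subset_closedBall h')
  set I : Fin 3 → Fin 3 → E3 → ℝ := fun i j z =>
    ∫ x in ball3 r, pd i p (x - z) * (φ i j x * pd j χ x) with hI
  set L : Fin 3 → Fin 3 → E3 → ℝ := fun i j z =>
    ∫ y, (p (y.2 + (y.1 - y.2) - z) - p (y.2 - z)) * (φ i j y.1 * pd i (pd j χ) y.1)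
      ∂(pairMeasure r) with hL
  have hIc : ∀ i j, Continuous (I i j) := fun i j => hB.continuous_integral (by fun_prop)
  have hLc : ∀ i j, Continuous (L i j) := fun i j => hQ.continuous_integral (by fun_prop)
  have hIb : ∀ i j, |∫ z, ψ z * I i j z| ≤ M := fun i j =>
    (H.source i).abs_integral_le hB continuous_id ((carries_restrict_ball3 r ε).mono hε) hψ hψ0 hψs
      hψ1 hψC hs hs6 H.pos_m (by fun_prop) (hcφ i j) (ae_of_all _ fun x => by
        rw [abs_mul, mul_comm]
        exact mul_le_mul_of_nonneg_right (H.pd_χ_le j x) (abs_nonneg _))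
      (H.φ_sq_le i j) (H.φ_rpow_le i j)
  have hLb : ∀ i j, |∫ z, ψ z * L i j z| ≤ 3 * M := fun i j => by
    refine abs_integral_mollified_sub_le hQ hp1 (ξ := fun y : E3 × E3 => y.2)
      (v := fun y => y.1 - y.2) (h := fun y => φ i j y.1 * pd i (pd j χ) y.1) (by fun_prop)
      (by fun_prop) (by fun_prop) hψc hψs fun t ht k => ?_
    refine (H.source k).abs_integral_le hQ (ξ := fun y : E3 × E3 => y.2 + t • (y.1 - y.2))
      (by fun_prop) ((carries_pairMeasure H.pos_r ht.1.le ht.2).mono hε) hψ hψ0 hψs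
      hψ1 hψC hs hs6 H.pos_m (by fun_prop) (F := fun y => φ i j y.1) (by fun_prop) ?_
      ((integral_fst_pairMeasure_le H.pos_r (F := fun x => φ i j x ^ 2) (by fun_prop)
        fun _ => sq_nonneg _).trans (H.φ_sq_le i j))
      ((integral_fst_pairMeasure_le H.pos_r (F := fun x => |φ i j x| ^ s)
        ((hcφ i j).abs.rpow_const fun _ => Or.inr hs0.le)
        fun _ => by positivity).trans (H.φ_rpow_le i j))
    filter_upwards [ae_pairMeasure r] with y hy
    have h1 : ‖y.1 - y.2‖ ≤ 2 * r := by
      have := mem_ball_zero_iff.1 hy.1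
      have := mem_ball_zero_iff.1 hy.2
      linarith [norm_sub_le y.1 y.2]
    have h2 : |(y.1 - y.2) k| ≤ 2 * r := (PiLp.norm_apply_le (y.1 - y.2) k).trans h1
    rw [abs_mul, abs_mul]
    calc |(y.1 - y.2) k| * (|φ i j y.1| * |pd i (pd j χ) y.1|)
        ≤ (2 * r) * (|φ i j y.1| * |pd i (pd j χ) y.1|) := by gcongr
      _ = (2 * r * |pd i (pd j χ) y.1|) * |φ i j y.1| := by ring
      _ ≤ _ := mul_le_mul_of_nonneg_right (H.pd_pd_χ_le i j y.1) (abs_nonneg _)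
  have hg0 : ∑ i, ∑ j, ∫ x in ball3 r, φ i j x * pd i (pd j χ) x = 0 := by
    have := H.integral_mul_test (q := fun _ => 1) contDiff_const
    simp only [one_mul, pd_const, zero_mul, integral_zero, zero_add, H.integral_test_eq_zero] at this
    linarith
  have hV : 0 < (volume (ball3 r)).toReal :=
    ENNReal.toReal_pos (measure_ball_pos volume (0 : E3) H.pos_r).ne' measure_ball_lt_top.ne
  have hfin := hB.finite
  have e : ∀ z, ∫ x in ball3 r, p (x - z) * ∑ j, u j x * pd j χ x
      = - ∑ i, ∑ j, (I i j z + 8 * L i j z) := by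
    intro z
    rw [H.integral_mul_test (q := fun x => p (x - z)) (hp1.comp (contDiff_id.sub contDiff_const))]
    simp only [pd_comp_sub, Finset.sum_add_distrib]
    congr 2
    have e1 : ∀ i j, 8 * L i j z = (∫ x in ball3 r, p (x - z) * (φ i j x * pd i (pd j χ) x))
        - (volume (ball3 r)).toReal⁻¹ * (∫ y in ball3 r, p (y - z))
          * ∫ x in ball3 r, φ i j x * pd i (pd j χ) x := by
      intro i j
      simp only [hL]
      rw [integral_pairMeasure (F := fun x y => (p (y + (x - y) - z) - p (y - z))
        * (φ i j x * pd i (pd j χ) x)) (by fun_prop)]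
      have e2 : ∀ x, ∫ y in ball3 r, (p (y + (x - y) - z) - p (y - z))
          * (φ i j x * pd i (pd j χ) x)
          = (volume (ball3 r)).toReal * (p (x - z) * (φ i j x * pd i (pd j χ) x))
            - (∫ y in ball3 r, p (y - z)) * (φ i j x * pd i (pd j χ) x) := by
        intro x
        rw [integral_mul_const, integral_sub (hB.integrable (by fun_prop))
          (hB.integrable (by fun_prop))]
        simp only [add_sub_cancel, setIntegral_const, smul_eq_mul, measureReal_def]
        ring
      simp only [e2]
      rw [integral_sub (hB.integrable (by fun_prop)) (hB.integrable (by fun_prop)),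
        integral_const_mul, integral_const_mul]
      field_simp
    simp only [e1, Finset.sum_sub_distrib, ← Finset.mul_sum, hg0, mul_zero, sub_zero]
  have e3 : ∫ z, ψ z * ∫ x in ball3 r, p (x - z) * ∑ j, u j x * pd j χ x
      = - ∑ i, ∑ j, ((∫ z, ψ z * I i j z) + 8 * ∫ z, ψ z * L i j z) := by
    have hIntg : ∀ {G : E3 → ℝ}, Continuous G → Integrable fun z => ψ z * G z := fun hG =>
      (hψc.mul hG).integrable_of_hasCompactSupport hcs.mul_right
    have e4 : ∀ i j, (∫ z, ψ z * I i j z) + 8 * ∫ z, ψ z * L i j z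
        = ∫ z, ψ z * (I i j z + 8 * L i j z) := by
      intro i j
      rw [← integral_const_mul, ← integral_add (hIntg (hIc i j)) ((hIntg (hLc i j)).const_mul 8)]
      refine integral_congr_ae (ae_of_all _ fun z => ?_)
      dsimp only
      ring
    simp only [e, e4]
    rw [Finset.sum_congr rfl fun i _ => (integral_finsetSum Finset.univ
        (f := fun j z => ψ z * (I i j z + 8 * L i j z)) fun j _ => hIntg (by fun_prop)).symm,
      ← integral_finsetSum Finset.univ (f := fun i z => ∑ j, ψ z * (I i j z + 8 * L i j z))
        fun i _ => integrable_finsetSum _ fun j _ => hIntg (by fun_prop), ← integral_neg]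
    refine integral_congr_ae (ae_of_all _ fun z => ?_)
    simp only [Finset.mul_sum, mul_neg]
  rw [e3, abs_neg]
  have h25 : ∀ i j, |(∫ z, ψ z * I i j z) + 8 * ∫ z, ψ z * L i j z| ≤ 25 * M := fun i j => by
    refine (abs_add_le _ _).trans ?_
    rw [abs_mul, abs_of_pos (by norm_num : (0 : ℝ) < 8)]
    linarith [hIb i j, hLb i j]
  refine (Finset.abs_sum_le_sum_abs _ _).trans ?_
  refine (Finset.sum_le_sum (g := fun _ => 75 * M) fun i _ => ?_).trans
    (by simp; exact le_of_eq (by ring))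
  refine (Finset.abs_sum_le_sum_abs _ _).trans ?_
  refine (Finset.sum_le_sum (g := fun _ => 25 * M) fun j _ => h25 i j).trans
    (by simp; exact le_of_eq (by ring))

lemma contDiff_test (H : PressureData s r r' YA YD Y₃ Y₆ m X₂ Xs p χ u φ A a c) :
    ContDiff ℝ 1 fun x => ∑ j, u j x * pd j χ x := by
  have h1 : ∀ j, ContDiff ℝ 1 (u j) := fun j => (H.smooth_u j).of_le (by simp)
  have h2 : ∀ j, ContDiff ℝ 1 (pd j χ) := fun j => (contDiff_pd j H.smooth_χ).of_le (by simp)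
  exact ContDiff.sum fun j _ => (h1 j).mul (h2 j)

lemma tsupport_test (H : PressureData s r r' YA YD Y₃ Y₆ m X₂ Xs p χ u φ A a c) :
    tsupport (fun x => ∑ j, u j x * pd j χ x) ⊆ ball3 r := by
  refine (closure_minimal (fun x hx => ?_) (isClosed_tsupport χ)).trans H.tsupport_χ
  by_contra h
  exact hx (Finset.sum_eq_zero fun j _ => by
    rw [pd_eq_zero_of_notMem_tsupport j h, mul_zero])

/-- Bound for the pairing of the pressure with the transported cut-off. -/
lemma abs_integral_pressure_le
    (H : PressureData s r r' YA YD Y₃ Y₆ m X₂ Xs p χ u φ A a c) (hs : 3 < s) (hs6 : s ≤ 6)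
    (hε0 : 0 < ε) {ψ : E3 → ℝ} (hψ : ContDiff ℝ 1 ψ) (hψ0 : ∀ z, 0 ≤ ψ z)
    (hψs : ∀ z, z ∉ ball3 ε → ψ z = 0)
    (hψ1 : ∫ z, ψ z = 1) {C : ℝ} (hψC : ∀ k, ∫ z, |pd k ψ z| ≤ C) (hε : r + ε ≤ r') {Z₂ Z₆ : ℝ}
    (hZ₂ : ∀ i, ∫ x in ball3 r, pd i (fun y => ∑ j, u j y * pd j χ y) x ^ 2 ≤ Z₂)
    (hZ₆ : ∫ x in ball3 r, (∑ j, u j x * pd j χ x) ^ 6 ≤ Z₆) :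
    |∫ x in ball3 r, p x * ∑ j, u j x * pd j χ x| ≤
      225 * (m * (3 * (C * (X₂ ^ (1 / 2 : ℝ) * YA ^ (1 / 2 : ℝ)))
      + Fintype.card ι * (Xs ^ (1 / s) * YD ^ (1 / 2 : ℝ) * Y₃ ^ (2 / 3 - 2 / s)
        * Y₆ ^ (1 / s - 1 / 6))))
      + 3 * (ε * (3 * (Z₂ ^ (1 / 2 : ℝ) * YA ^ (1 / 2 : ℝ))
      + Fintype.card ι * (YD ^ (1 / 2 : ℝ) * Y₃ ^ (1 / 3 : ℝ) * Z₆ ^ (1 / 6 : ℝ)))) := by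
  set W := 3 * (Z₂ ^ (1 / 2 : ℝ) * YA ^ (1 / 2 : ℝ))
      + Fintype.card ι * (YD ^ (1 / 2 : ℝ) * Y₃ ^ (1 / 3 : ℝ) * Z₆ ^ (1 / 6 : ℝ)) with hW
  set g : E3 → ℝ := fun x => ∑ j, u j x * pd j χ x with hg
  have hg1 : ContDiff ℝ 1 g := H.contDiff_test
  have hgt := H.tsupport_test
  have hgc := hg1.continuous
  have hp1 : ContDiff ℝ 1 p := H.smooth_p.of_le (by simp)
  have hpc := hp1.continuous
  have hψc := hψ.continuous
  have hB := compactlyCarried_restrict_ball3 r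
  have hE := compactlyCarried_restrict_ball3 ε
  have hcs : HasCompactSupport ψ := HasCompactSupport.intro (isCompact_closedBall (0 : E3) ε)
    fun x hx => hψs x fun h' => hx (ball_subset_closedBall h')
  have hIntg : ∀ {G : E3 → ℝ}, Continuous G → Integrable fun z => ψ z * G z := fun hG =>
    (hψc.mul hG).integrable_of_hasCompactSupport hcs.mul_right
  have hI : Continuous fun z => ∫ x in ball3 r, p (x - z) * g x :=
    hB.continuous_integral (by fun_prop)
  have hD : Continuous fun z => ∫ x in ball3 r, (p x - p (x - z)) * g x :=
    hB.continuous_integral (by fun_prop)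
  have e : ∫ x in ball3 r, p x * g x = (∫ z, ψ z * ∫ x in ball3 r, p (x - z) * g x)
      + ∫ z, ψ z * ∫ x in ball3 r, (p x - p (x - z)) * g x := by
    rw [← integral_add (hIntg hI) (hIntg hD)]
    have : ∀ z, ψ z * (∫ x in ball3 r, p (x - z) * g x)
        + ψ z * (∫ x in ball3 r, (p x - p (x - z)) * g x)
        = ψ z * ∫ x in ball3 r, p x * g x := by
      intro z
      rw [← mul_add, ← integral_add (hB.integrable (by fun_prop)) (hB.integrable (by fun_prop))]
      congr 2
      funext x
      ring
    simp only [this, integral_mul_const, hψ1, one_mul]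
  rw [e]
  refine (abs_add_le _ _).trans (add_le_add
    (H.abs_integral_mollified_le hs hs6 hψ hψ0 hψs hψ1 hψC hε) ?_)
  rw [← setIntegral_eq_integral_of_forall_compl_eq_zero
    (fun z hz => by rw [hψs z hz, zero_mul] : ∀ z, z ∉ ball3 ε → ψ z * _ = 0)]
  have key : ∀ z ∈ ball3 ε, |∫ x in ball3 r, (p x - p (x - z)) * g x| ≤ 3 * (ε * W) := by
    intro z hz
    have hz' : ‖z‖ < ε := mem_ball_zero_iff.1 hz
    have := abs_integral_sub_le hB hp1 (ξ := fun x => x - z) (v := fun _ => z) (g := g)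
      (M := 3 * (ε * W)) (by fun_prop) (by fun_prop) hgc (fun t ht => by
        refine (Finset.abs_sum_le_sum_abs _ _).trans ?_
        refine (Finset.sum_le_sum (g := fun _ => ε * W) fun i _ => ?_).trans (by simp)
        have e1 : ∫ x in ball3 r, pd i p (x - z + t • z) * (z i * g x)
            = z i * ∫ x in ball3 r, pd i p (x - (1 - t) • z) * g x := by
          rw [← integral_const_mul]
          congr 1
          funext x
          rw [show x - z + t • z = x - (1 - t) • z by rw [sub_smul, one_smul]; abel]
          ring
        rw [e1, abs_mul]
        refine mul_le_mul ((PiLp.norm_apply_le z i).trans hz'.le) ?_ (abs_nonneg _) hε0.le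
        refine (H.source i).abs_integral_translate_le hg1 (fun x hx => eq_zero_of_tsupport hgt hx)
          (fun k x hx => eq_zero_of_tsupport ((tsupport_pd_subset g k).trans hgt) hx)
          (fun x hx => ball_subset_ball hε (sub_mem_ball3 hx ?_)) hZ₂ hZ₆
        refine mem_ball_zero_iff.2 (lt_of_le_of_lt ?_ hz')
        rw [norm_smul, Real.norm_eq_abs, abs_of_nonneg (by linarith [ht.2])]
        nlinarith [norm_nonneg z, ht.1])
    simpa only [sub_add_cancel] using this
  refine (abs_integral_mul_le (hE.integrable hψc)
    ((ae_restrict_iff' (measurableSet_ball3 ε)).2 (ae_of_all _ key))).trans ?_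
  rw [setIntegral_eq_integral_of_forall_compl_eq_zero (fun z hz => by rw [hψs z hz, abs_zero])]
  simp only [abs_of_nonneg (hψ0 _), hψ1, mul_one, le_refl]

end PressureData
section Exponents

variable {s K C M R κ D : ℝ}

lemma rpow_le_self_of_exponent_le_one {x p : ℝ} (hx : 1 ≤ x) (hp : p ≤ 1) : x ^ p ≤ x := by
  simpa using Real.rpow_le_rpow_of_exponent_le hx hp

lemma four_mul_rpow_half (hD : 0 ≤ D) : (4 * D) ^ (1 / 2 : ℝ) = 2 * D ^ (1 / 2 : ℝ) := by
  rw [Real.mul_rpow (by norm_num) hD, show (4 : ℝ) = 2 ^ 2 by norm_num,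
    rpow_two_rpow_half (by norm_num)]

/-- The scale of mollification balancing the linear part of the pressure. -/
def mollScale (s R κ D : ℝ) : ℝ := R ^ (5 / 6 - 1 / s) * κ⁻¹ * D ^ (-(5 / 12) : ℝ)

lemma mollScale_pos (hR : 1 ≤ R) (hκ : 1 ≤ κ) (hD : 1 ≤ D) : 0 < mollScale s R κ D := by
  unfold mollScale
  positivity

lemma mollScale_le (hs : 0 < s) (hR : 1 ≤ R) (hκ : 1 ≤ κ) (hD : 1 ≤ D) :
    mollScale s R κ D ≤ R / κ := by
  have h1 : R ^ (5 / 6 - 1 / s) ≤ R := rpow_le_self_of_exponent_le_one hR (by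
    have : 0 < 1 / s := by positivity
    linarith)
  have h2 : D ^ (-(5 / 12) : ℝ) ≤ 1 := Real.rpow_le_one_of_one_le_of_nonpos hD (by norm_num)
  unfold mollScale
  rw [div_eq_mul_inv]
  calc R ^ (5 / 6 - 1 / s) * κ⁻¹ * D ^ (-(5 / 12) : ℝ) ≤ R * κ⁻¹ * 1 := by gcongr
    _ = _ := mul_one _

lemma moll_linear_eq (hK : 1 ≤ K) (hR : 1 ≤ R) (hκ : 1 ≤ κ) (hD : 1 ≤ D) :
    2 * κ ^ 2 / R * (3 * (M / mollScale s R κ D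
      * (((5 * K * R ^ (11 / 6 - 1 / s)) ^ 2) ^ (1 / 2 : ℝ) * (4 * D) ^ (1 / 2 : ℝ))))
      = 60 * M * K * κ ^ 3 * D ^ (11 / 12 : ℝ) := by
  have hR0 : 0 < R := by linarith
  have hD0 : 0 < D := by linarith
  rw [rpow_two_rpow_half (by positivity), four_mul_rpow_half hD0.le, mollScale,
    show (11 / 6 - 1 / s : ℝ) = 1 + (5 / 6 - 1 / s) by ring, Real.rpow_add hR0, Real.rpow_one,
    show (1 / 2 : ℝ) = 11 / 12 + -(5 / 12) by norm_num, Real.rpow_add hD0]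
  have : 0 < R ^ (5 / 6 - 1 / s) := by positivity
  have : 0 < D ^ (-(5 / 12) : ℝ) := by positivity
  field_simp
  ring

lemma moll_nonlinear_le (hs : 3 < s) (hK : 1 ≤ K) (hC : 1 ≤ C) (hR : 1 ≤ R)
    (hκ : 1 ≤ κ) (hD : 1 ≤ D) :
    2 * κ ^ 2 / R * (6 * ((K * R ^ (s / 3 + 2)) ^ (1 / s) * D ^ (1 / 2 : ℝ)
      * (C * κ ^ 3 * R * D ^ (9 / (s + 6))) ^ (2 / 3 - 2 / s)
      * (C * κ ^ 12 * D ^ 3) ^ (1 / s - 1 / 6)))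
      ≤ 12 * K * C ^ 2 * κ ^ 17 * D ^ (9 / (s + 6)) := by
  have hR0 : 0 < R := by linarith
  have hD0 : 0 < D := by linarith
  have hs0 : 0 < s := by linarith
  have h2s : 0 < 2 / s := by positivity
  have h1s : 1 / s ≤ 1 := by rw [div_le_one hs0]; linarith
  have e1 : (K * R ^ (s / 3 + 2)) ^ (1 / s) = K ^ (1 / s) * R ^ (1 / 3 + 2 / s) := by
    rw [Real.mul_rpow (by positivity) (by positivity), ← Real.rpow_mul hR0.le]
    congr 2
    field_simp
  have e2 : (C * κ ^ 3 * R * D ^ (9 / (s + 6))) ^ (2 / 3 - 2 / s)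
      = (C * κ ^ 3) ^ (2 / 3 - 2 / s) * R ^ (2 / 3 - 2 / s)
        * D ^ (9 / (s + 6) * (2 / 3 - 2 / s)) := by
    rw [Real.mul_rpow (by positivity) (by positivity), Real.mul_rpow (by positivity) hR0.le,
      ← Real.rpow_mul hD0.le]
  have e3 : (C * κ ^ 12 * D ^ 3) ^ (1 / s - 1 / 6)
      = (C * κ ^ 12) ^ (1 / s - 1 / 6) * D ^ (3 * (1 / s - 1 / 6)) := by
    rw [Real.mul_rpow (by positivity) (by positivity), ← Real.rpow_natCast D 3,
      ← Real.rpow_mul hD0.le]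
    norm_num
  have e4 : R ^ (1 / 3 + 2 / s) * R ^ (2 / 3 - 2 / s) = R := by
    rw [← Real.rpow_add hR0]
    ring_nf
    exact Real.rpow_one R
  have e5 : D ^ (1 / 2 : ℝ) * D ^ (9 / (s + 6) * (2 / 3 - 2 / s)) * D ^ (3 * (1 / s - 1 / 6))
      = D ^ (9 / (s + 6)) := by
    rw [← Real.rpow_add hD0, ← Real.rpow_add hD0]
    congr 1
    field_simp
    ring
  have b1 : K ^ (1 / s) ≤ K := rpow_le_self_of_exponent_le_one hK h1s
  have b2 : (C * κ ^ 3) ^ (2 / 3 - 2 / s) ≤ C * κ ^ 3 :=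
    rpow_le_self_of_exponent_le_one (one_le_mul_of_one_le_of_one_le hC (one_le_pow₀ hκ)) (by linarith)
  have b3 : (C * κ ^ 12) ^ (1 / s - 1 / 6) ≤ C * κ ^ 12 :=
    rpow_le_self_of_exponent_le_one (one_le_mul_of_one_le_of_one_le hC (one_le_pow₀ hκ)) (by linarith)
  rw [e1, e2, e3]
  calc _ = 12 * κ ^ 2 / R * (R ^ (1 / 3 + 2 / s) * R ^ (2 / 3 - 2 / s))
        * (D ^ (1 / 2 : ℝ) * D ^ (9 / (s + 6) * (2 / 3 - 2 / s)) * D ^ (3 * (1 / s - 1 / 6)))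
        * (K ^ (1 / s) * (C * κ ^ 3) ^ (2 / 3 - 2 / s) * (C * κ ^ 12) ^ (1 / s - 1 / 6)) := by ring
    _ ≤ 12 * κ ^ 2 / R * R * D ^ (9 / (s + 6)) * (K * (C * κ ^ 3) * (C * κ ^ 12)) := by
        rw [e4, e5]
        gcongr
    _ = _ := by field_simp

lemma translate_linear_le (hs : 3 < s) (hC : 1 ≤ C) (hR : 1 ≤ R) (hκ : 1 ≤ κ) (hD : 1 ≤ D) :
    mollScale s R κ D * (3 * ((36 * C * κ ^ 6 / R ^ 2 * D) ^ (1 / 2 : ℝ) * (4 * D) ^ (1 / 2 : ℝ)))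
      ≤ 36 * C * κ ^ 2 * D ^ (11 / 12 : ℝ) := by
  have hR0 : 0 < R := by linarith
  have hD0 : 0 < D := by linarith
  have e1 : (36 * C * κ ^ 6 / R ^ 2 * D) ^ (1 / 2 : ℝ)
      = 6 * C ^ (1 / 2 : ℝ) * (κ ^ 3 / R) * D ^ (1 / 2 : ℝ) := by
    rw [show 36 * C * κ ^ 6 / R ^ 2 * D = (6 * (κ ^ 3 / R)) ^ 2 * (C * D) by field_simp; ring,
      Real.mul_rpow (by positivity) (by positivity), rpow_two_rpow_half (by positivity),
      Real.mul_rpow (by positivity) (by positivity)]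
    ring
  have e2 : D ^ (-(5 / 12) : ℝ) * (D ^ (1 / 2 : ℝ) * D ^ (1 / 2 : ℝ)) ≤ D ^ (11 / 12 : ℝ) := by
    rw [← Real.rpow_add hD0, ← Real.rpow_add hD0]
    exact Real.rpow_le_rpow_of_exponent_le hD (by norm_num)
  have e3 : R ^ (5 / 6 - 1 / s) ≤ R := rpow_le_self_of_exponent_le_one hR (by
    have : 0 < 1 / s := by positivity
    linarith)
  have e4 : C ^ (1 / 2 : ℝ) ≤ C := rpow_le_self_of_exponent_le_one hC (by norm_num)
  rw [e1, four_mul_rpow_half hD0.le, mollScale]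
  calc _ = 36 * (κ ^ 2 / R) * C ^ (1 / 2 : ℝ) * R ^ (5 / 6 - 1 / s)
        * (D ^ (-(5 / 12) : ℝ) * (D ^ (1 / 2 : ℝ) * D ^ (1 / 2 : ℝ))) := by field_simp; ring
    _ ≤ 36 * (κ ^ 2 / R) * C * R * D ^ (11 / 12 : ℝ) := by gcongr
    _ = _ := by field_simp

lemma translate_nonlinear_le (hs : 3 < s) (hs6 : s ≤ 6) (hC : 1 ≤ C) (hR : 1 ≤ R)
    (hκ : 1 ≤ κ) (hD : 1 ≤ D) :
    mollScale s R κ D * (6 * (D ^ (1 / 2 : ℝ)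
      * (C * κ ^ 3 * R * D ^ (9 / (s + 6))) ^ (1 / 3 : ℝ)
      * (729 * C * κ ^ 18 / R ^ 6 * D ^ 3) ^ (1 / 6 : ℝ)))
      ≤ 18 * C * κ ^ 3 * D ^ (11 / 12 : ℝ) := by
  have hR0 : 0 < R := by linarith
  have hD0 : 0 < D := by linarith
  have hs0 : 0 < s := by linarith
  have e1 : (C * κ ^ 3 * R * D ^ (9 / (s + 6))) ^ (1 / 3 : ℝ)
      = C ^ (1 / 3 : ℝ) * κ * R ^ (1 / 3 : ℝ) * D ^ (9 / (s + 6) * (1 / 3)) := by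
    rw [Real.mul_rpow (by positivity) (by positivity), Real.mul_rpow (by positivity) hR0.le,
      Real.mul_rpow (by positivity) (by positivity), ← Real.rpow_mul hD0.le,
      ← Real.rpow_natCast κ 3, ← Real.rpow_mul (by positivity)]
    norm_num
  have e2 : (729 * C * κ ^ 18 / R ^ 6 * D ^ 3) ^ (1 / 6 : ℝ)
      = 3 * C ^ (1 / 6 : ℝ) * (κ ^ 3 / R) * D ^ (1 / 2 : ℝ) := by
    rw [show 729 * C * κ ^ 18 / R ^ 6 * D ^ 3 = (3 * (κ ^ 3 / R)) ^ 6 * (C * D ^ 3) by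
        field_simp; ring,
      Real.mul_rpow (by positivity) (by positivity),
      Real.mul_rpow (by positivity) (by positivity), ← Real.rpow_natCast _ 6,
      ← Real.rpow_mul (by positivity), ← Real.rpow_natCast D 3, ← Real.rpow_mul (by positivity)]
    norm_num
    ring
  have e3 : D ^ (-(5 / 12) : ℝ) * (D ^ (1 / 2 : ℝ) * D ^ (9 / (s + 6) * (1 / 3) : ℝ)
      * D ^ (1 / 2 : ℝ)) ≤ D ^ (11 / 12 : ℝ) := by
    rw [← Real.rpow_add hD0, ← Real.rpow_add hD0, ← Real.rpow_add hD0]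
    refine Real.rpow_le_rpow_of_exponent_le hD ?_
    have : 9 / (s + 6) ≤ 1 := by rw [div_le_one (by linarith)]; linarith
    linarith
  have e4 : R ^ (5 / 6 - 1 / s) * R ^ (1 / 3 : ℝ) ≤ R := by
    rw [← Real.rpow_add hR0]
    refine rpow_le_self_of_exponent_le_one hR ?_
    have : 1 / 6 ≤ 1 / s := by gcongr
    linarith
  have e5 : C ^ (1 / 3 : ℝ) * C ^ (1 / 6 : ℝ) ≤ C := by
    rw [← Real.rpow_add (by linarith)]
    exact rpow_le_self_of_exponent_le_one hC (by norm_num)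
  rw [e1, e2, mollScale]
  calc _ = 18 * (κ ^ 3 / R) * (C ^ (1 / 3 : ℝ) * C ^ (1 / 6 : ℝ))
        * (R ^ (5 / 6 - 1 / s) * R ^ (1 / 3 : ℝ))
        * (D ^ (-(5 / 12) : ℝ) * (D ^ (1 / 2 : ℝ) * D ^ (9 / (s + 6) * (1 / 3) : ℝ)
          * D ^ (1 / 2 : ℝ))) := by field_simp; norm_num
    _ ≤ 18 * (κ ^ 3 / R) * C * R * D ^ (11 / 12 : ℝ) := by gcongr
    _ = _ := by field_simp

end Exponents
section Energy

variable {u w b : E3 → E3} {P : E3 → ℝ}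

lemma contDiff_coord {n : WithTop ℕ∞} (hu : ContDiff ℝ n u) (j : Fin 3) :
    ContDiff ℝ n (fun x => u x j) := by fun_prop

lemma sum_pd_mul_pd {f : E3 → ℝ} (hf : ContDiff ℝ (⊤ : ℕ∞) f) (x : E3) :
    ∑ k, pd k (fun y => f y * pd k f y) x = ∑ k, pd k f x ^ 2 + f x * lap f x := by
  have h1 := hf.differentiable (by simp)
  have h2 : ∀ k, Differentiable ℝ (pd k f) := fun k =>
    (contDiff_pd k hf).differentiable (by simp)
  simp only [lap, Finset.mul_sum, ← Finset.sum_add_distrib]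
  refine Finset.sum_congr rfl fun k _ => ?_
  rw [pd_mul k (h1 x) (h2 k x)]
  ring

lemma sum_pd_coord_mul {v : E3 → E3} {h : E3 → ℝ} {x : E3} (hv : DifferentiableAt ℝ v x)
    (hh : DifferentiableAt ℝ h x) : ∑ k, pd k (fun y => v y k * h y) x
      = vdiv v x * h x + ∑ k, v x k * pd k h x := by
  simp only [vdiv, Finset.sum_mul, ← Finset.sum_add_distrib]
  refine Finset.sum_congr rfl fun k _ => ?_
  rw [pd_mul k (by fun_prop) hh]

/-- The cross product of two fields. -/
def crossField (w u : E3 → E3) (k : Fin 3) (x : E3) : ℝ :=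
  ![w x 1 * u x 2 - w x 2 * u x 1, w x 2 * u x 0 - w x 0 * u x 2,
    w x 0 * u x 1 - w x 1 * u x 0] k

lemma contDiff_crossField {n : WithTop ℕ∞} (hw : ContDiff ℝ n w) (hu : ContDiff ℝ n u)
    (k : Fin 3) : ContDiff ℝ n (crossField w u k) := by
  unfold crossField
  fin_cases k <;> simp <;> fun_prop

lemma sum_pd_crossField {x : E3} (hw : DifferentiableAt ℝ w x) (hu : DifferentiableAt ℝ u x) :
    ∑ k, pd k (crossField w u k) x
      = ∑ j, u x j * curl3 w x j - ∑ j, w x j * curl3 u x j := by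
  have hw' : ∀ j, DifferentiableAt ℝ (fun y => w y j) x := fun j => by fun_prop
  have hu' : ∀ j, DifferentiableAt ℝ (fun y => u y j) x := fun j => by fun_prop
  have e : ∀ k i j i' j', pd k (fun y => w y i * u y j - w y i' * u y j') x
      = (pd k (fun y => w y i) x * u x j + w x i * pd k (fun y => u y j) x)
        - (pd k (fun y => w y i') x * u x j' + w x i' * pd k (fun y => u y j') x) := by
    intro k i j i' j'
    have hm : ∀ i j, DifferentiableAt ℝ (fun y => w y i * u y j) x := fun i j =>
      (hw' i).mul (hu' j)
    rw [pd_sub k (hm i j) (hm i' j'), pd_mul k (hw' i) (hu' j),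
      pd_mul k (hw' i') (hu' j')]
  have h0 : crossField w u 0 = fun y => w y 1 * u y 2 - w y 2 * u y 1 := rfl
  have h1 : crossField w u 1 = fun y => w y 2 * u y 0 - w y 0 * u y 2 := rfl
  have h2 : crossField w u 2 = fun y => w y 0 * u y 1 - w y 1 * u y 0 := rfl
  simp only [Fin.sum_univ_three, h0, h1, h2, e, curl3, Matrix.cons_val]
  ring

lemma sum_pd_advection (hu : ContDiff ℝ (⊤ : ℕ∞) u) (hdiv : ∀ x, vdiv u x = 0) (x : E3) :
    ∑ k, pd k (fun y => ∑ i, u y i * pd i (fun z => u z k) y) x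
      = ∑ k, ∑ i, pd k (fun y => u y i) x * pd i (fun y => u y k) x := by
  have h1 : ∀ j, ContDiff ℝ (⊤ : ℕ∞) (fun y => u y j) := fun j => contDiff_coord hu j
  have h2 : ∀ j, Differentiable ℝ (fun y => u y j) := fun j => (h1 j).differentiable (by simp)
  have h3 : ∀ i j, Differentiable ℝ (pd i (fun y => u y j)) := fun i j =>
    (contDiff_pd i (h1 j)).differentiable (by simp)
  have e : ∀ k, pd k (fun y => ∑ i, u y i * pd i (fun z => u z k) y) x
      = ∑ i, (pd k (fun y => u y i) x * pd i (fun y => u y k) x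
        + u x i * pd k (pd i (fun y => u y k)) x) := by
    intro k
    rw [pd_sum Finset.univ k (F := fun i y => u y i * pd i (fun z => u z k) y)
      fun i _ => (h2 i x).mul (h3 i k x)]
    exact Finset.sum_congr rfl fun i _ => pd_mul k (h2 i x) (h3 i k x)
  have h0 : ∑ k, ∑ i, u x i * pd k (pd i (fun y => u y k)) x = 0 := by
    rw [Finset.sum_comm]
    refine Finset.sum_eq_zero fun i _ => ?_
    rw [← Finset.mul_sum, show ∑ k, pd k (pd i (fun y => u y k)) x = 0 from ?_, mul_zero]
    have : pd i (fun y => ∑ k, pd k (fun z => u z k) y) x = 0 := by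
      have : (fun y => ∑ k, pd k (fun z => u z k) y) = fun _ => (0 : ℝ) := funext hdiv
      rw [this, pd_const]
    rw [pd_sum Finset.univ i (F := fun k y => pd k (fun z => u z k) y)
      fun k _ => h3 k k x] at this
    rw [← this]
    exact Finset.sum_congr rfl fun k _ => pd_comm k i (h1 k)
  simp only [e, Finset.sum_add_distrib, h0, add_zero]

/-- The kinetic energy density. -/
def energyDensity (u w b : E3 → E3) (x : E3) : ℝ :=
  1 / 2 * ∑ j, (u x j ^ 2 + w x j ^ 2 + b x j ^ 2)

/-- The dissipation density. -/
def dissipation (u w b : E3 → E3) (x : E3) : ℝ :=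
  gradSq u x + gradSq w x + gradSq b x + ∑ j, w x j ^ 2

/-- The energy flux without its pressure part. -/
def energyFlux (u w b : E3 → E3) (k : Fin 3) (x : E3) : ℝ :=
  -(∑ j, (u x j * pd k (fun y => u y j) x + w x j * pd k (fun y => w y j) x
      + b x j * pd k (fun y => b y j) x))
    + u x k * energyDensity u w b x - b x k * ∑ j, u x j * b x j - w x k * vdiv w x
    - crossField w u k x + 3 / 4 * ∑ i, u x i * pd i (fun y => u y k) x

end Energy

section EnergyBalance

variable {u w b : E3 → E3} {P : E3 → ℝ}

lemma contDiff_vdiv {v : E3 → E3} (hv : ContDiff ℝ (⊤ : ℕ∞) v) :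
    ContDiff ℝ (⊤ : ℕ∞) (vdiv v) :=
  ContDiff.sum fun i _ => contDiff_pd i (contDiff_coord hv i)

lemma contDiff_energyDensity {n : WithTop ℕ∞} (hu : ContDiff ℝ n u) (hw : ContDiff ℝ n w)
    (hb : ContDiff ℝ n b) : ContDiff ℝ n (energyDensity u w b) := by
  unfold energyDensity
  fun_prop

lemma contDiff_sum_mul_pd {v : E3 → E3} {f : E3 → ℝ} (hv : ContDiff ℝ (⊤ : ℕ∞) v)
    (hf : ContDiff ℝ (⊤ : ℕ∞) f) : ContDiff ℝ (⊤ : ℕ∞) (fun y => ∑ i, v y i * pd i f y) :=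
  ContDiff.sum fun i _ => (contDiff_coord hv i).mul (contDiff_pd i hf)

lemma contDiff_gradient_flux (hu : ContDiff ℝ (⊤ : ℕ∞) u) (hw : ContDiff ℝ (⊤ : ℕ∞) w)
    (hb : ContDiff ℝ (⊤ : ℕ∞) b) (k : Fin 3) : ContDiff ℝ (⊤ : ℕ∞) (fun y =>
      ∑ j, (u y j * pd k (fun z => u z j) y + w y j * pd k (fun z => w z j) y
        + b y j * pd k (fun z => b z j) y)) :=
  ContDiff.sum fun j _ => (((contDiff_coord hu j).mul (contDiff_pd k (contDiff_coord hu j))).add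
    ((contDiff_coord hw j).mul (contDiff_pd k (contDiff_coord hw j)))).add
    ((contDiff_coord hb j).mul (contDiff_pd k (contDiff_coord hb j)))

lemma contDiff_energyFlux (hu : ContDiff ℝ (⊤ : ℕ∞) u) (hw : ContDiff ℝ (⊤ : ℕ∞) w)
    (hb : ContDiff ℝ (⊤ : ℕ∞) b) (k : Fin 3) :
    ContDiff ℝ (⊤ : ℕ∞) (energyFlux u w b k) := by
  have h1 := contDiff_gradient_flux hu hw hb k
  have h2 := contDiff_energyDensity hu hw hb
  have h3 := contDiff_vdiv hw
  have h4 := contDiff_crossField hw hu k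
  have h5 := contDiff_sum_mul_pd hu (contDiff_coord hu k)
  have h6 : ContDiff ℝ (⊤ : ℕ∞) (fun y => ∑ j, u y j * b y j) := by fun_prop
  exact (((((h1.neg).add ((contDiff_coord hu k).mul h2)).sub ((contDiff_coord hb k).mul h6)).sub
    ((contDiff_coord hw k).mul h3)).sub h4).add (contDiff_const.mul h5)

lemma pd_energyDensity {x : E3} (k : Fin 3) (hu : DifferentiableAt ℝ u x)
    (hw : DifferentiableAt ℝ w x) (hb : DifferentiableAt ℝ b x) :
    pd k (energyDensity u w b) x = ∑ j, (u x j * pd k (fun y => u y j) x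
      + w x j * pd k (fun y => w y j) x + b x j * pd k (fun y => b y j) x) := by
  have hu' : ∀ j, DifferentiableAt ℝ (fun y => u y j) x := fun j => by fun_prop
  have hw' : ∀ j, DifferentiableAt ℝ (fun y => w y j) x := fun j => by fun_prop
  have hb' : ∀ j, DifferentiableAt ℝ (fun y => b y j) x := fun j => by fun_prop
  unfold energyDensity
  rw [pd_mul k (by fun_prop) (by fun_prop), pd_const,
    pd_sum Finset.univ k (F := fun j y => u y j ^ 2 + w y j ^ 2 + b y j ^ 2)
      fun j _ => by fun_prop, zero_mul, zero_add, Finset.mul_sum]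
  refine Finset.sum_congr rfl fun j _ => ?_
  rw [pd_add k (f := fun y => u y j ^ 2 + w y j ^ 2) (by fun_prop) (by fun_prop),
    pd_add k (by fun_prop) (by fun_prop),
    pd_pow k 2 (hu' j), pd_pow k 2 (hw' j), pd_pow k 2 (hb' j)]
  push_cast
  ring

lemma pd_sum_mul {x : E3} (k : Fin 3) (hu : DifferentiableAt ℝ u x)
    (hb : DifferentiableAt ℝ b x) : pd k (fun y => ∑ j, u y j * b y j) x
      = ∑ j, (pd k (fun y => u y j) x * b x j + u x j * pd k (fun y => b y j) x) := by
  rw [pd_sum Finset.univ k (F := fun j y => u y j * b y j) fun j _ => by fun_prop]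
  exact Finset.sum_congr rfl fun j _ => pd_mul k (by fun_prop) (by fun_prop)

lemma IsMMPSolution.sum_pd_energyFlux (h : IsMMPSolution u w b P) (x : E3) :
    ∑ k, pd k (fun y => energyFlux u w b k y + P y * u y k) x
      = -(gradSq u x + gradSq w x + gradSq b x) - vdiv w x ^ 2 - 2 * ∑ j, w x j ^ 2
        + 2 * ∑ j, w x j * curl3 u x j
        + 3 / 4 * ∑ k, ∑ i, pd k (fun y => u y i) x * pd i (fun y => u y k) x := by
  have hu := h.smooth_u
  have hw := h.smooth_w
  have hb := h.smooth_b
  have du : DifferentiableAt ℝ u x := (hu.differentiable (by simp)) x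
  have dw : DifferentiableAt ℝ w x := (hw.differentiable (by simp)) x
  have db : DifferentiableAt ℝ b x := (hb.differentiable (by simp)) x
  have d : ∀ {f : E3 → ℝ}, ContDiff ℝ (⊤ : ℕ∞) f → DifferentiableAt ℝ f x :=
    fun hf => (hf.differentiable (by simp)) x
  have g1 := fun k => contDiff_gradient_flux hu hw hb k
  have g2 : ∀ k, ContDiff ℝ (⊤ : ℕ∞) (fun y => u y k * energyDensity u w b y) := fun k =>
    (contDiff_coord hu k).mul (contDiff_energyDensity hu hw hb)
  have g3 : ∀ k, ContDiff ℝ (⊤ : ℕ∞) (fun y => b y k * ∑ j, u y j * b y j) := fun k => by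
    fun_prop
  have g4 : ∀ k, ContDiff ℝ (⊤ : ℕ∞) (fun y => w y k * vdiv w y) := fun k =>
    (contDiff_coord hw k).mul (contDiff_vdiv hw)
  have g5 := fun k => contDiff_crossField hw hu k
  have g6 := fun k => contDiff_sum_mul_pd hu (contDiff_coord hu k)
  have g7 : ∀ k, ContDiff ℝ (⊤ : ℕ∞) (fun y => u y k * P y) := fun k =>
    (contDiff_coord hu k).mul h.smooth_P
  have e : ∀ k, pd k (fun y => energyFlux u w b k y + P y * u y k) x
      = -(∑ j, pd k (fun y => u y j * pd k (fun z => u z j) y) x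
          + ∑ j, pd k (fun y => w y j * pd k (fun z => w z j) y) x
          + ∑ j, pd k (fun y => b y j * pd k (fun z => b z j) y) x)
        + pd k (fun y => u y k * energyDensity u w b y) x
        - pd k (fun y => b y k * ∑ j, u y j * b y j) x
        - pd k (fun y => w y k * vdiv w y) x - pd k (crossField w u k) x
        + 3 / 4 * pd k (fun y => ∑ i, u y i * pd i (fun z => u z k) y) x
        + pd k (fun y => u y k * P y) x := by
    intro k
    have c1 : ∀ v : E3 → E3, ContDiff ℝ (⊤ : ℕ∞) v → ∀ j, DifferentiableAt ℝ
        (fun y => v y j * pd k (fun z => v z j) y) x := fun v hv j =>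
      d ((contDiff_coord hv j).mul (contDiff_pd k (contDiff_coord hv j)))
    simp_rw [mul_comm (P _)]
    have f1 := d (g1 k).neg
    have f2 : DifferentiableAt ℝ _ x := f1.fun_add (d (g2 k))
    have f3 : DifferentiableAt ℝ _ x := f2.fun_sub (d (g3 k))
    have f4 : DifferentiableAt ℝ _ x := f3.fun_sub (d (g4 k))
    have f5 : DifferentiableAt ℝ _ x := f4.fun_sub (d (g5 k))
    have f6 : DifferentiableAt ℝ (fun y => 3 / 4 * ∑ i, u y i * pd i (fun z => u z k) y) x :=
      (d (g6 k)).const_mul _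
    unfold energyFlux
    rw [pd_add k (f5.fun_add f6) (d (g7 k)), pd_add k f5 f6, pd_sub k f4 (d (g5 k)),
      pd_sub k f3 (d (g4 k)), pd_sub k f2 (d (g3 k)), pd_add k f1 (d (g2 k)), pd_neg,
      pd_mul k (f := fun _ => (3 / 4 : ℝ)) (by fun_prop) (d (g6 k)), pd_const, zero_mul, zero_add,
      pd_sum Finset.univ k (F := fun j y => u y j * pd k (fun z => u z j) y
        + w y j * pd k (fun z => w z j) y + b y j * pd k (fun z => b z j) y)
        fun j _ => ((c1 u hu j).fun_add (c1 w hw j)).fun_add (c1 b hb j)]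
    simp only [← Finset.sum_add_distrib]
    congr 7
    refine Finset.sum_congr rfl fun j _ => ?_
    rw [pd_add k ((c1 u hu j).fun_add (c1 w hw j)) (c1 b hb j), pd_add k (c1 u hu j) (c1 w hw j)]
  have s1 : ∀ v : E3 → E3, ContDiff ℝ (⊤ : ℕ∞) v →
      ∑ k, ∑ j, pd k (fun y => v y j * pd k (fun z => v z j) y) x
        = gradSq v x + ∑ j, v x j * lap (fun y => v y j) x := by
    intro v hv
    rw [Finset.sum_comm, gradSq, ← Finset.sum_add_distrib]
    exact Finset.sum_congr rfl fun j _ => sum_pd_mul_pd (contDiff_coord hv j) x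
  simp only [e, Finset.sum_add_distrib, Finset.sum_sub_distrib, Finset.sum_neg_distrib,
    ← Finset.mul_sum, s1 u hu, s1 w hw, s1 b hb]
  rw [sum_pd_coord_mul du (d (contDiff_energyDensity hu hw hb)),
    sum_pd_coord_mul db (by fun_prop), sum_pd_coord_mul dw (d (contDiff_vdiv hw)),
    sum_pd_coord_mul du (d h.smooth_P), sum_pd_crossField dw du,
    sum_pd_advection hu h.div_u, h.div_u, h.div_b]
  simp only [pd_energyDensity _ du dw db, pd_sum_mul _ du db]
  have E1 := h.eq_u x
  have E2 := h.eq_w x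
  have E3 := h.eq_b x
  generalize gradSq u x = a1
  generalize gradSq w x = a2
  generalize gradSq b x = a3
  generalize vdiv w x = a4
  generalize curl3 u x = cu at *
  generalize curl3 w x = cw at *
  have U : ∑ j, u x j * (-(lap (fun y => u y j) x) + (∑ i, u x i * pd i (fun y => u y j) x)
      + pd j P x) = ∑ j, u x j * (cw j + ∑ i, b x i * pd i (fun y => b y j) x) :=
    Finset.sum_congr rfl fun j _ => by rw [E1 j]
  have W : ∑ j, w x j * (-(lap (fun y => w y j) x) + (∑ i, u x i * pd i (fun y => w y j) x))
      = ∑ j, w x j * (pd j (fun y => vdiv w y) x + cu j - 2 * w x j) :=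
    Finset.sum_congr rfl fun j _ => by rw [E2 j]
  have B : ∑ j, b x j * (-(lap (fun y => b y j) x) + (∑ i, u x i * pd i (fun y => b y j) x))
      = ∑ j, b x j * ∑ i, b x i * pd i (fun y => u y j) x :=
    Finset.sum_congr rfl fun j _ => by rw [E3 j]
  simp only [Fin.sum_univ_three] at U W B ⊢
  change _ = _
  have hv : ∀ i, pd i (fun y => vdiv w y) x = pd i (vdiv w) x := fun i => rfl
  simp only [hv] at W ⊢
  linear_combination U + W + B

lemma sum_curl3_sq (u : E3 → E3) (x : E3) : ∑ j, curl3 u x j ^ 2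
    = gradSq u x - ∑ k, ∑ i, pd k (fun y => u y i) x * pd i (fun y => u y k) x := by
  simp only [gradSq, Fin.sum_univ_three, curl3, Matrix.cons_val]
  ring

lemma gradSq_nonneg (u : E3 → E3) (x : E3) : 0 ≤ gradSq u x :=
  Finset.sum_nonneg fun _ _ => Finset.sum_nonneg fun _ _ => sq_nonneg _

lemma dissipation_nonneg (u w b : E3 → E3) (x : E3) : 0 ≤ dissipation u w b x :=
  add_nonneg (add_nonneg (add_nonneg (gradSq_nonneg u x) (gradSq_nonneg w x))
    (gradSq_nonneg b x)) (Finset.sum_nonneg fun _ _ => sq_nonneg _)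

lemma contDiff_gradSq (hu : ContDiff ℝ (⊤ : ℕ∞) u) : ContDiff ℝ (⊤ : ℕ∞) (gradSq u) :=
  ContDiff.sum fun j _ => ContDiff.sum fun i _ => (contDiff_pd i (contDiff_coord hu j)).pow 2

lemma contDiff_dissipation (hu : ContDiff ℝ (⊤ : ℕ∞) u) (hw : ContDiff ℝ (⊤ : ℕ∞) w)
    (hb : ContDiff ℝ (⊤ : ℕ∞) b) : ContDiff ℝ (⊤ : ℕ∞) (dissipation u w b) :=
  (((contDiff_gradSq hu).add (contDiff_gradSq hw)).add (contDiff_gradSq hb)).add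
    (ContDiff.sum fun j _ => (contDiff_coord hw j).pow 2)

lemma IsMMPSolution.dissipation_le (h : IsMMPSolution u w b P) (x : E3) :
    dissipation u w b x
      ≤ -(4 * ∑ k, pd k (fun y => energyFlux u w b k y + P y * u y k) x) := by
  rw [h.sum_pd_energyFlux, dissipation]
  have h1 : 2 * ∑ j, w x j * curl3 u x j
      ≤ 3 / 4 * ∑ j, curl3 u x j ^ 2 + 4 / 3 * ∑ j, w x j ^ 2 := by
    simp only [Finset.mul_sum, ← Finset.sum_add_distrib]
    refine Finset.sum_le_sum fun j _ => ?_
    nlinarith [sq_nonneg (3 / 2 * curl3 u x j - 2 * w x j)]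
  have h2 := sum_curl3_sq u x
  have h3 : 0 ≤ ∑ j, w x j ^ 2 := Finset.sum_nonneg fun _ _ => sq_nonneg _
  nlinarith [gradSq_nonneg w x, gradSq_nonneg b x, sq_nonneg (vdiv w x)]

lemma IsMMPSolution.integral_mul_dissipation_le (h : IsMMPSolution u w b P) {χ : E3 → ℝ}
    (hχ : ContDiff ℝ (⊤ : ℕ∞) χ) (hc : HasCompactSupport χ) (hχ0 : ∀ x, 0 ≤ χ x) :
    ∫ x, χ x * dissipation u w b x
      ≤ 4 * ∫ x, ∑ k, pd k χ x * (energyFlux u w b k x + P x * u x k) := by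
  have hY : ∀ k, ContDiff ℝ (⊤ : ℕ∞) (fun y => energyFlux u w b k y + P y * u y k) := fun k =>
    (contDiff_energyFlux h.smooth_u h.smooth_w h.smooth_b k).add
      (h.smooth_P.mul (contDiff_coord h.smooth_u k))
  have hp : ∀ k, ContDiff ℝ (⊤ : ℕ∞)
      (pd k (fun y => energyFlux u w b k y + P y * u y k)) := fun k => contDiff_pd k (hY k)
  have hd := contDiff_dissipation h.smooth_u h.smooth_w h.smooth_b
  have i1 : Integrable (fun x => χ x * dissipation u w b x) :=
    (hχ.continuous.mul hd.continuous).integrable_of_hasCompactSupport hc.mul_right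
  have i2 : ∀ k, Integrable (fun x =>
      pd k (fun y => energyFlux u w b k y + P y * u y k) x * χ x) := fun k =>
    ((hp k).continuous.mul hχ.continuous).integrable_of_hasCompactSupport hc.mul_left
  have i3 : ∀ k, Integrable (fun x => pd k χ x * (energyFlux u w b k x + P x * u x k)) :=
    fun k => ((contDiff_pd k hχ).continuous.mul (hY k).continuous).integrable_of_hasCompactSupport
      (hc.pd k).mul_right
  have e : ∀ k, ∫ x, pd k χ x * (energyFlux u w b k x + P x * u x k)
      = -∫ x, pd k (fun y => energyFlux u w b k y + P y * u y k) x * χ x := by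
    intro k
    rw [integral_pd_mul k ((hY k).of_le (by simp)) (hχ.of_le (by simp)) hc, neg_neg]
    exact integral_congr_ae (Eventually.of_forall fun x => mul_comm _ _)
  calc ∫ x, χ x * dissipation u w b x
      ≤ ∫ x, -4 * ∑ k, pd k (fun y => energyFlux u w b k y + P y * u y k) x * χ x := by
        refine integral_mono i1 ((integrable_finsetSum _ fun k _ => i2 k).const_mul _) fun x => ?_
        have := mul_le_mul_of_nonneg_left (h.dissipation_le x) (hχ0 x)
        simp only [← Finset.sum_mul]
        linarith
    _ = 4 * ∫ x, ∑ k, pd k χ x * (energyFlux u w b k x + P x * u x k) := by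
        rw [integral_const_mul, integral_finsetSum _ fun k _ => i2 k,
          integral_finsetSum _ fun k _ => i3 k]
        simp only [e, Finset.sum_neg_distrib]
        ring

end EnergyBalance

section FluxBound

variable {u w b : E3 → E3}

lemma sum_sq_pd_le_gradSq (v : E3 → E3) (k : Fin 3) (x : E3) :
    ∑ j, pd k (fun y => v y j) x ^ 2 ≤ gradSq v x :=
  Finset.sum_le_sum fun j _ => Finset.single_le_sum
    (f := fun i => pd i (fun y => v y j) x ^ 2) (fun _ _ => sq_nonneg _) (Finset.mem_univ k)

lemma sum_sq_pd_le_gradSq' (v : E3 → E3) (k : Fin 3) (x : E3) :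
    ∑ i, pd i (fun y => v y k) x ^ 2 ≤ gradSq v x :=
  Finset.single_le_sum (f := fun j => ∑ i, pd i (fun y => v y j) x ^ 2)
    (fun _ _ => Finset.sum_nonneg fun _ _ => sq_nonneg _) (Finset.mem_univ k)

lemma abs_mul_le_young {T : ℝ} (hT : 0 < T) (x y : ℝ) : |x * y| ≤ T * x ^ 2 + y ^ 2 / T := by
  have h : T * x ^ 2 + y ^ 2 / T = (((T * |x|) - |y|) ^ 2 + 2 * (T * (|x| * |y|))) / T := by
    rw [← sq_abs x, ← sq_abs y]
    field_simp
    ring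
  rw [h, le_div_iff₀ hT, abs_mul]
  nlinarith [sq_nonneg (T * |x| - |y|), mul_nonneg hT.le (mul_nonneg (abs_nonneg x) (abs_nonneg y))]

lemma abs_mul_mul_le_cubes (x y z : ℝ) : |x * (y * z)| ≤ |x| ^ 3 + |y| ^ 3 + |z| ^ 3 := by
  rw [abs_mul, abs_mul]
  have hx := abs_nonneg x
  have hy := abs_nonneg y
  have hz := abs_nonneg z
  generalize |x| = X at *
  generalize |y| = Y at *
  generalize |z| = Z at *
  have h : 0 ≤ (X + Y + Z) * ((X - Y) ^ 2 + (Y - Z) ^ 2 + (X - Z) ^ 2) := by positivity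
  nlinarith [pow_nonneg hx 3, pow_nonneg hy 3, pow_nonneg hz 3]

/-- The sum of the squares of all components. -/
def squareSum (u w b : E3 → E3) (x : E3) : ℝ := ∑ j, (u x j ^ 2 + w x j ^ 2 + b x j ^ 2)

/-- The sum of the cubes of all components. -/
def cubeSum (u w b : E3 → E3) (x : E3) : ℝ := ∑ j, (|u x j| ^ 3 + |w x j| ^ 3 + |b x j| ^ 3)

lemma abs_crossField_le {T : ℝ} (hT : 0 < T) (w u : E3 → E3) (k : Fin 3) (x : E3) :
    |crossField w u k x| ≤ 2 * (T * ∑ j, u x j ^ 2 + (∑ j, w x j ^ 2) / T) := by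
  have h : ∀ i j, |w x i * u x j| ≤ T * ∑ j, u x j ^ 2 + (∑ j, w x j ^ 2) / T := by
    intro i j
    rw [mul_comm]
    refine (abs_mul_le_young hT _ _).trans ?_
    have h1 : u x j ^ 2 ≤ ∑ j, u x j ^ 2 := Finset.single_le_sum
      (f := fun j => u x j ^ 2) (fun _ _ => sq_nonneg _) (Finset.mem_univ j)
    have h2 : w x i ^ 2 ≤ ∑ j, w x j ^ 2 := Finset.single_le_sum
      (f := fun j => w x j ^ 2) (fun _ _ => sq_nonneg _) (Finset.mem_univ i)
    gcongr
  have h' : ∀ i j i' j', |w x i * u x j - w x i' * u x j'|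
      ≤ 2 * (T * ∑ j, u x j ^ 2 + (∑ j, w x j ^ 2) / T) := fun i j i' j' =>
    (abs_sub _ _).trans (by linarith [h i j, h i' j'])
  unfold crossField
  fin_cases k <;> exact h' _ _ _ _

lemma abs_energyFlux_le {T : ℝ} (hT : 0 < T) (u w b : E3 → E3) (k : Fin 3) (x : E3) :
    |energyFlux u w b k x|
      ≤ 7 * (T * squareSum u w b x + dissipation u w b x / T) + 20 * cubeSum u w b x := by
  have gw := gradSq_nonneg w x
  have gu := gradSq_nonneg u x
  have gb := gradSq_nonneg b x
  have su : 0 ≤ ∑ j, u x j ^ 2 := Finset.sum_nonneg fun _ _ => sq_nonneg _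
  have sw : 0 ≤ ∑ j, w x j ^ 2 := Finset.sum_nonneg fun _ _ => sq_nonneg _
  have sb : 0 ≤ ∑ j, b x j ^ 2 := Finset.sum_nonneg fun _ _ => sq_nonneg _
  have hq : squareSum u w b x = ∑ j, u x j ^ 2 + ∑ j, w x j ^ 2 + ∑ j, b x j ^ 2 := by
    simp only [squareSum, Finset.sum_add_distrib]
  set A := T * squareSum u w b x + dissipation u w b x / T with hA
  have key : ∀ a c : ℝ, a ≤ squareSum u w b x → c ≤ dissipation u w b x → T * a + c / T ≤ A := by
    intro a c ha hc
    rw [hA]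
    gcongr
  have t1 : |∑ j, (u x j * pd k (fun y => u y j) x + w x j * pd k (fun y => w y j) x
      + b x j * pd k (fun y => b y j) x)| ≤ A := by
    refine le_trans ?_ (key (squareSum u w b x) (∑ j, (pd k (fun y => u y j) x ^ 2
      + pd k (fun y => w y j) x ^ 2 + pd k (fun y => b y j) x ^ 2)) le_rfl ?_)
    · refine (Finset.abs_sum_le_sum_abs _ _).trans ?_
      rw [squareSum, Finset.mul_sum, Finset.sum_div, ← Finset.sum_add_distrib]
      refine Finset.sum_le_sum fun j _ => ?_
      refine (abs_add_three _ _ _).trans ?_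
      have h1 := abs_mul_le_young hT (u x j) (pd k (fun y => u y j) x)
      have h2 := abs_mul_le_young hT (w x j) (pd k (fun y => w y j) x)
      have h3 := abs_mul_le_young hT (b x j) (pd k (fun y => b y j) x)
      rw [add_div, add_div]
      linarith
    · simp only [Finset.sum_add_distrib, dissipation]
      linarith [sum_sq_pd_le_gradSq u k x, sum_sq_pd_le_gradSq w k x, sum_sq_pd_le_gradSq b k x]
  have t4 : |w x k * vdiv w x| ≤ 3 * A := by
    rw [vdiv, Finset.mul_sum]
    refine (Finset.abs_sum_le_sum_abs _ _).trans ?_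
    have : ∀ i ∈ (Finset.univ : Finset (Fin 3)), |w x k * pd i (fun y => w y i) x| ≤ A := by
      intro i _
      refine (abs_mul_le_young hT _ _).trans (key _ _ ?_ ?_)
      · have : w x k ^ 2 ≤ ∑ j, w x j ^ 2 := Finset.single_le_sum
          (f := fun j => w x j ^ 2) (fun _ _ => sq_nonneg _) (Finset.mem_univ k)
        linarith
      · have h1 := sum_sq_pd_le_gradSq' w i x
        have : pd i (fun y => w y i) x ^ 2 ≤ ∑ l, pd l (fun y => w y i) x ^ 2 :=
          Finset.single_le_sum (f := fun l => pd l (fun y => w y i) x ^ 2)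
            (fun _ _ => sq_nonneg _) (Finset.mem_univ i)
        unfold dissipation
        linarith
    simpa using Finset.sum_le_card_nsmul _ _ _ this
  have t5 : |crossField w u k x| ≤ 2 * A := by
    refine (abs_crossField_le hT w u k x).trans ?_
    have := key (∑ j, u x j ^ 2) (∑ j, w x j ^ 2) (by linarith) (by unfold dissipation; linarith)
    linarith
  have t6 : |3 / 4 * ∑ i, u x i * pd i (fun y => u y k) x| ≤ A := by
    rw [abs_mul, abs_of_pos (by norm_num : (0 : ℝ) < 3 / 4)]
    have : |∑ i, u x i * pd i (fun y => u y k) x| ≤ A := by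
      refine le_trans ?_ (key (∑ j, u x j ^ 2) (∑ i, pd i (fun y => u y k) x ^ 2) (by linarith) ?_)
      · refine (Finset.abs_sum_le_sum_abs _ _).trans ?_
        rw [Finset.mul_sum, Finset.sum_div, ← Finset.sum_add_distrib]
        exact Finset.sum_le_sum fun j _ => abs_mul_le_young hT _ _
      · have := sum_sq_pd_le_gradSq' u k x
        unfold dissipation
        linarith
    linarith [abs_nonneg (∑ i, u x i * pd i (fun y => u y k) x)]
  have hc : ∀ j, |u x j| ^ 3 + |w x j| ^ 3 + |b x j| ^ 3 ≤ cubeSum u w b x := fun j =>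
    Finset.single_le_sum (f := fun j => |u x j| ^ 3 + |w x j| ^ 3 + |b x j| ^ 3)
      (fun _ _ => by positivity) (Finset.mem_univ j)
  have cu : ∀ j, |u x j| ^ 3 ≤ cubeSum u w b x := fun j => by
    linarith [hc j, pow_nonneg (abs_nonneg (w x j)) 3, pow_nonneg (abs_nonneg (b x j)) 3]
  have cb : ∀ j, |b x j| ^ 3 ≤ cubeSum u w b x := fun j => by
    linarith [hc j, pow_nonneg (abs_nonneg (w x j)) 3, pow_nonneg (abs_nonneg (u x j)) 3]
  have t2 : |u x k * energyDensity u w b x| ≤ 8 * cubeSum u w b x := by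
    have e : u x k * energyDensity u w b x = 1 / 2 * ∑ j, (u x k * (u x j * u x j)
        + u x k * (w x j * w x j) + u x k * (b x j * b x j)) := by
      simp only [energyDensity, Fin.sum_univ_three]
      ring
    rw [e, abs_mul, abs_of_pos (by norm_num : (0 : ℝ) < 1 / 2)]
    have : ∀ j ∈ (Finset.univ : Finset (Fin 3)), |u x k * (u x j * u x j)
        + u x k * (w x j * w x j) + u x k * (b x j * b x j)| ≤ 5 * cubeSum u w b x := by
      intro j _
      refine (abs_add_three _ _ _).trans ?_
      linarith [abs_mul_mul_le_cubes (u x k) (u x j) (u x j),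
        abs_mul_mul_le_cubes (u x k) (w x j) (w x j),
        abs_mul_mul_le_cubes (u x k) (b x j) (b x j), hc j, cu k]
    have h := (Finset.abs_sum_le_sum_abs (fun j => u x k * (u x j * u x j)
        + u x k * (w x j * w x j) + u x k * (b x j * b x j)) Finset.univ).trans
      (Finset.sum_le_card_nsmul _ _ _ this)
    simp only [Finset.card_univ, Fintype.card_fin, nsmul_eq_mul, Nat.cast_ofNat] at h
    linarith [(pow_nonneg (abs_nonneg (u x k)) 3).trans (cu k)]
  have t3 : |b x k * ∑ j, u x j * b x j| ≤ 9 * cubeSum u w b x := by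
    rw [Finset.mul_sum]
    refine (Finset.abs_sum_le_sum_abs _ _).trans ?_
    have : ∀ j ∈ (Finset.univ : Finset (Fin 3)), |b x k * (u x j * b x j)|
        ≤ 3 * cubeSum u w b x := fun j _ => by
      linarith [abs_mul_mul_le_cubes (b x k) (u x j) (b x j), cu j, cb j, cb k]
    have h := Finset.sum_le_card_nsmul _ _ _ this
    simp only [Finset.card_univ, Fintype.card_fin, nsmul_eq_mul, Nat.cast_ofNat] at h
    linarith
  have hc0 : 0 ≤ cubeSum u w b x := (pow_nonneg (abs_nonneg (u x k)) 3).trans (cu k)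
  unfold energyFlux
  rw [abs_le] at *
  constructor <;> linarith [t1.1, t1.2, t2.1, t2.2, t3.1, t3.2, t4.1, t4.2, t5.1, t5.2, t6.1, t6.2]

end FluxBound

section LocalBounds

variable {u w b : E3 → E3} {P : E3 → ℝ} {s K C R κ D r : ℝ}

lemma contDiff_squareSum (hu : ContDiff ℝ (⊤ : ℕ∞) u) (hw : ContDiff ℝ (⊤ : ℕ∞) w)
    (hb : ContDiff ℝ (⊤ : ℕ∞) b) : ContDiff ℝ (⊤ : ℕ∞) (squareSum u w b) := by
  unfold squareSum
  fun_prop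

lemma continuous_cubeSum (hu : Continuous u) (hw : Continuous w) (hb : Continuous b) :
    Continuous (cubeSum u w b) := by
  unfold cubeSum
  fun_prop

lemma integrableOn_ball3 {f : E3 → ℝ} (hf : Continuous f) : IntegrableOn f (ball3 r) :=
  integrableOn_of_subset_ball3 subset_rfl hf

lemma integral_flux_le (hu : ContDiff ℝ (⊤ : ℕ∞) u) (hw : ContDiff ℝ (⊤ : ℕ∞) w)
    (hb : ContDiff ℝ (⊤ : ℕ∞) b) {χ : E3 → ℝ} {m T Q Q₃ : ℝ} (hm : 0 ≤ m) (hT : 0 < T)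
    (hχ : ∀ k x, |pd k χ x| ≤ m) (hχ0 : ∀ k x, x ∉ ball3 r → pd k χ x = 0)
    (hQ : ∫ x in ball3 r, squareSum u w b x ≤ Q) (hD : ∫ x in ball3 r, dissipation u w b x ≤ D)
    (hQ₃ : ∫ x in ball3 r, cubeSum u w b x ≤ Q₃) (hχc : ContDiff ℝ (⊤ : ℕ∞) χ) :
    ∫ x, ∑ k, pd k χ x * energyFlux u w b k x ≤ 3 * m * (7 * (T * Q + D / T) + 20 * Q₃) := by
  have i1 := integrableOn_ball3 (r := r) (contDiff_squareSum hu hw hb).continuous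
  have i2 := integrableOn_ball3 (r := r) (contDiff_dissipation hu hw hb).continuous
  have i3 := integrableOn_ball3 (r := r)
    (continuous_cubeSum hu.continuous hw.continuous hb.continuous)
  have c0 : Continuous (fun x => ∑ k, pd k χ x * energyFlux u w b k x) :=
    continuous_finsetSum _ fun k _ => (contDiff_pd k hχc).continuous.mul
      (contDiff_energyFlux hu hw hb k).continuous
  have e : ∫ x, ∑ k, pd k χ x * energyFlux u w b k x
      = ∫ x in ball3 r, ∑ k, pd k χ x * energyFlux u w b k x :=
    (setIntegral_eq_integral_of_forall_compl_eq_zero fun x hx => by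
      simp [hχ0 _ x hx]).symm
  rw [e]
  calc ∫ x in ball3 r, ∑ k, pd k χ x * energyFlux u w b k x
      ≤ ∫ x in ball3 r, 3 * m * (7 * (T * squareSum u w b x + dissipation u w b x / T)
          + 20 * cubeSum u w b x) := by
        refine integral_mono (integrableOn_ball3 c0) ?_ fun x => ?_
        · exact ((((i1.const_mul T).add (i2.div_const T)).const_mul 7).add
            (i3.const_mul 20)).const_mul _
        · have h : ∀ k ∈ (Finset.univ : Finset (Fin 3)), pd k χ x * energyFlux u w b k x
              ≤ m * (7 * (T * squareSum u w b x + dissipation u w b x / T)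
                + 20 * cubeSum u w b x) := fun k _ => by
            refine (le_abs_self _).trans ?_
            rw [abs_mul]
            exact mul_le_mul (hχ k x) (abs_energyFlux_le hT u w b k x) (abs_nonneg _) hm
          have h' := Finset.sum_le_card_nsmul _ _ _ h
          simp only [Finset.card_univ, Fintype.card_fin, nsmul_eq_mul, Nat.cast_ofNat] at h'
          refine h'.trans_eq ?_
          ring
    _ = 3 * m * (7 * (T * (∫ x in ball3 r, squareSum u w b x)
          + (∫ x in ball3 r, dissipation u w b x) / T) + 20 * ∫ x in ball3 r, cubeSum u w b x) := by
        rw [integral_const_mul, integral_add _ (i3.const_mul 20), integral_const_mul,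
          integral_const_mul, integral_add (i1.const_mul T) (i2.div_const T), integral_const_mul,
          integral_div]
        exact ((i1.const_mul T).add (i2.div_const T)).const_mul 7
    _ ≤ _ := by gcongr

/-- `v` is the divergence of `φ`, whose components grow slowly on the ball of radius `R`. -/
structure IsPotential (s K : ℝ) (φ : Fin 3 → Fin 3 → E3 → ℝ) (v : E3 → E3) (R : ℝ) : Prop where
  smooth : ∀ i j, ContDiff ℝ (⊤ : ℕ∞) (φ i j)
  eq : ∀ j x, v x j = ∑ i, pd i (φ i j) x
  le : ∀ i j, ∫ x in ball3 R, |φ i j x| ^ s ≤ K * R ^ (s / 3 + 2)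

/-- The conclusions of the local estimates on the ball of radius `r`. -/
structure LocalBounds (s C R κ D r : ℝ) (v : E3 → E3) : Prop where
  sq_le : ∀ j, ∫ x in ball3 r, v x j ^ 2 ≤ C * κ ^ 2 * R ^ 2 * D ^ (1 / 2 : ℝ)
  cube_le : ∀ j, ∫ x in ball3 r, |v x j| ^ 3 ≤ C * κ ^ 3 * R * D ^ (9 / (s + 6))
  six_le : ∀ j, ∫ x in ball3 r, v x j ^ 6 ≤ C * κ ^ 12 * D ^ 3

lemma setIntegral_ball3_mono {r r' : ℝ} (h : r ≤ r') {f : E3 → ℝ} (hf : Continuous f)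
    (h0 : ∀ x, 0 ≤ f x) : ∫ x in ball3 r, f x ≤ ∫ x in ball3 r', f x :=
  setIntegral_mono_set (integrableOn_ball3 hf) (Eventually.of_forall h0)
    (Metric.ball_subset_ball h).eventuallyLE

lemma LocalBounds.mono {v : E3 → E3} {r r' : ℝ} (h : LocalBounds s C R κ D r' v) (hr : r ≤ r')
    (hv : Continuous v) : LocalBounds s C R κ D r v where
  sq_le j := (setIntegral_ball3_mono hr (by fun_prop) fun x => by positivity).trans (h.sq_le j)
  cube_le j := (setIntegral_ball3_mono hr (by fun_prop) fun x => by positivity).trans (h.cube_le j)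
  six_le j := (setIntegral_ball3_mono hr (by fun_prop) fun x => by positivity).trans (h.six_le j)

lemma setIntegral_le_integral_of_eq {r : ℝ} {f g : E3 → ℝ} (hg : Integrable g)
    (h0 : ∀ x, 0 ≤ g x) (h : ∀ x ∈ ball3 r, f x = g x) : ∫ x in ball3 r, f x ≤ ∫ x, g x := by
  rw [setIntegral_congr_fun (measurableSet_ball3 r) h]
  exact setIntegral_le_integral hg (Eventually.of_forall h0)

lemma exists_localBounds (hs : 3 < s) (hs6 : s ≤ 6) (hK : 1 ≤ K) : ∃ C : ℝ, 1 ≤ C ∧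
    ∀ {v : E3 → E3} {φ : Fin 3 → Fin 3 → E3 → ℝ} {η : E3 → ℝ} {R κ D r : ℝ}, 1 ≤ R → 1 ≤ κ →
      1 ≤ D → ContDiff ℝ (⊤ : ℕ∞) v → IsPotential s K φ v R → ContDiff ℝ (⊤ : ℕ∞) η →
      (∀ x, 0 ≤ η x) → (∀ x, η x ≤ 1) → (∀ x, x ∈ ball3 r → η x = 1) →
      (∀ x, x ∉ ball3 R → η x = 0) → (∀ i x, |pd i η x| ≤ κ / R) →
      ∫ x in ball3 R, gradSq v x ≤ D → LocalBounds s C R κ D r v := by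
  obtain ⟨C, hC, H⟩ := exists_local_estimates hs hs6 hK
  refine ⟨C, hC, fun {v φ η R κ D r} hR hκ hD hv hφ hη h0 h1 hη1 hη0 hd hG => ?_⟩
  have hR0 : 0 < R := by linarith
  have hvc := hv.continuous
  have hηc := hη.continuous
  have hcs : HasCompactSupport η := HasCompactSupport.intro (isCompact_closedBall (0 : E3) R)
    fun x hx => hη0 x fun hx' => hx (Metric.ball_subset_closedBall hx')
  have L : ∀ j, LocalData s K (fun i => φ i j) (fun x => v x j) η (ball3 R) R κ D := fun j =>
    { one_le_R := hR
      one_le_κ := hκ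
      le_D := (Real.rpow_le_one_of_one_le_of_nonpos hR (by norm_num)).trans hD
      smooth_φ := fun i => hφ.smooth i j
      smooth_f := contDiff_coord hv j
      div_eq := hφ.eq j
      smooth_η := hη
      η_nonneg := h0
      η_le_one := h1
      η_eq_zero := hη0
      subset_ball := subset_rfl
      meas_S := measurableSet_ball
      pd_η_le := hd
      φ_le := fun i => hφ.le i j
      grad_le := fun i => by
        refine (integral_mono (integrableOn_ball3
          ((contDiff_pd i (contDiff_coord hv j)).continuous.pow 2))
          (integrableOn_ball3 (contDiff_gradSq hv).continuous) fun x => ?_).trans hG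
        exact (Finset.single_le_sum (f := fun i => pd i (fun y => v y j) x ^ 2)
          (fun _ _ => sq_nonneg _) (Finset.mem_univ i)).trans (sum_sq_pd_le_gradSq' v j x) }
  have I : ∀ {g : E3 → ℝ}, Continuous g → (∀ x, η x = 0 → g x = 0) → Integrable g := by
    intro g hg hz
    refine hg.integrable_of_hasCompactSupport (hcs.mono fun x hx => ?_)
    exact fun h => hx (hz x h)
  refine ⟨fun j => ?_, fun j => ?_, fun j => ?_⟩
  · refine (setIntegral_le_integral_of_eq (g := fun x => (v x j * η x) ^ 2)
      (I (by fun_prop) fun x hx => by simp [hx]) (fun x => by positivity)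
      fun x hx => by simp [hη1 x hx]).trans ((H (L j)).1.trans ?_)
    have : R ^ (11 / 6 - 1 / s) ≤ R ^ 2 := by
      rw [← Real.rpow_natCast R 2]
      refine Real.rpow_le_rpow_of_exponent_le hR ?_
      have : 0 < 1 / s := by positivity
      push_cast
      linarith
    gcongr
  · exact (setIntegral_le_integral_of_eq (g := fun x => |v x j * η x| ^ 3)
      (I (by fun_prop) fun x hx => by simp [hx]) (fun x => by positivity)
      fun x hx => by simp [hη1 x hx]).trans (H (L j)).2.2.1
  · exact (setIntegral_le_integral_of_eq (g := fun x => (v x j * η x ^ 2) ^ 6)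
      (I (by fun_prop) fun x hx => by simp [hx]) (fun x => by positivity)
      fun x hx => by simp [hη1 x hx]).trans (H (L j)).2.2.2

lemma integral_squareSum_le (hu : Continuous u) (hw : Continuous w) (hb : Continuous b)
    (Lu : LocalBounds s C R κ D r u)
    (Lw : LocalBounds s C R κ D r w) (Lb : LocalBounds s C R κ D r b) :
    ∫ x in ball3 r, squareSum u w b x ≤ 9 * (C * κ ^ 2 * R ^ 2 * D ^ (1 / 2 : ℝ)) := by
  have i : ∀ {g : E3 → ℝ}, Continuous g → IntegrableOn g (ball3 r) := integrableOn_ball3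
  simp only [squareSum]
  rw [integral_finsetSum _ fun j _ => i (by fun_prop)]
  have h : ∀ j ∈ (Finset.univ : Finset (Fin 3)),
      ∫ x in ball3 r, (u x j ^ 2 + w x j ^ 2 + b x j ^ 2)
        ≤ 3 * (C * κ ^ 2 * R ^ 2 * D ^ (1 / 2 : ℝ)) := fun j _ => by
    rw [integral_add (i (by fun_prop)) (i (by fun_prop)), integral_add (i (by fun_prop))
      (i (by fun_prop))]
    linarith [Lu.sq_le j, Lw.sq_le j, Lb.sq_le j]
  have h' := Finset.sum_le_card_nsmul _ _ _ h
  simp only [Finset.card_univ, Fintype.card_fin, nsmul_eq_mul, Nat.cast_ofNat] at h'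
  linarith

lemma integral_cubeSum_le (hu : Continuous u) (hw : Continuous w) (hb : Continuous b)
    (Lu : LocalBounds s C R κ D r u)
    (Lw : LocalBounds s C R κ D r w) (Lb : LocalBounds s C R κ D r b) :
    ∫ x in ball3 r, cubeSum u w b x ≤ 9 * (C * κ ^ 3 * R * D ^ (9 / (s + 6))) := by
  have i : ∀ {g : E3 → ℝ}, Continuous g → IntegrableOn g (ball3 r) := integrableOn_ball3
  simp only [cubeSum]
  rw [integral_finsetSum _ fun j _ => i (by fun_prop)]
  have h : ∀ j ∈ (Finset.univ : Finset (Fin 3)),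
      ∫ x in ball3 r, (|u x j| ^ 3 + |w x j| ^ 3 + |b x j| ^ 3)
        ≤ 3 * (C * κ ^ 3 * R * D ^ (9 / (s + 6))) := fun j _ => by
    rw [integral_add (i (by fun_prop)) (i (by fun_prop)), integral_add (i (by fun_prop))
      (i (by fun_prop))]
    linarith [Lu.cube_le j, Lw.cube_le j, Lb.cube_le j]
  have h' := Finset.sum_le_card_nsmul _ _ _ h
  simp only [Finset.card_univ, Fintype.card_fin, nsmul_eq_mul, Nat.cast_ofNat] at h'
  linarith

lemma integral_flux_le_rpow (hu : ContDiff ℝ (⊤ : ℕ∞) u) (hw : ContDiff ℝ (⊤ : ℕ∞) w)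
    (hb : ContDiff ℝ (⊤ : ℕ∞) b) {χ : E3 → ℝ} (hχc : ContDiff ℝ (⊤ : ℕ∞) χ)
    (hC : 1 ≤ C) (hR : 1 ≤ R) (hκ : 1 ≤ κ) (hD1 : 1 ≤ D)
    (hχ : ∀ k x, |pd k χ x| ≤ κ / R) (hχ0 : ∀ k x, x ∉ ball3 r → pd k χ x = 0)
    (hD : ∫ x in ball3 r, dissipation u w b x ≤ D) (Lu : LocalBounds s C R κ D r u)
    (Lw : LocalBounds s C R κ D r w) (Lb : LocalBounds s C R κ D r b) :
    ∫ x, ∑ k, pd k χ x * energyFlux u w b k x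
      ≤ 210 * C * κ ^ 4 * D ^ (3 / 4 : ℝ) + 540 * C * κ ^ 4 * D ^ (9 / (s + 6)) := by
  have hR0 : 0 < R := by linarith
  have hD0 : 0 < D := by linarith
  have h := integral_flux_le (m := κ / R) (T := D ^ (1 / 4 : ℝ) / R) hu hw hb (by positivity)
    (by positivity) hχ hχ0 (integral_squareSum_le hu.continuous hw.continuous hb.continuous Lu Lw Lb) hD
    (integral_cubeSum_le hu.continuous hw.continuous hb.continuous Lu Lw Lb) hχc
  have e1 : D ^ (1 / 4 : ℝ) / R * (9 * (C * κ ^ 2 * R ^ 2 * D ^ (1 / 2 : ℝ)))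
      = 9 * C * κ ^ 2 * R * D ^ (3 / 4 : ℝ) := by
    rw [show (3 / 4 : ℝ) = 1 / 4 + 1 / 2 by norm_num, Real.rpow_add hD0]
    field_simp
  have e2 : D / (D ^ (1 / 4 : ℝ) / R) = R * D ^ (3 / 4 : ℝ) := by
    rw [show (3 / 4 : ℝ) = 1 - 1 / 4 by norm_num, Real.rpow_sub hD0, Real.rpow_one]
    field_simp
  rw [e1, e2] at h
  refine h.trans ?_
  have hCk : 1 ≤ C * κ ^ 2 := one_le_mul_of_one_le_of_one_le hC (one_le_pow₀ hκ)
  have hk : κ ^ 3 ≤ κ ^ 4 := pow_le_pow_right₀ hκ (by norm_num)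
  calc 3 * (κ / R) * (7 * (9 * C * κ ^ 2 * R * D ^ (3 / 4 : ℝ) + R * D ^ (3 / 4 : ℝ))
        + 20 * (9 * (C * κ ^ 3 * R * D ^ (9 / (s + 6)))))
      = 21 * κ * (9 * (C * κ ^ 2) + 1) * D ^ (3 / 4 : ℝ)
        + 540 * C * κ ^ 4 * D ^ (9 / (s + 6)) := by
        field_simp
        ring
    _ ≤ 21 * κ * (9 * (C * κ ^ 2) + C * κ ^ 2) * D ^ (3 / 4 : ℝ)
        + 540 * C * κ ^ 4 * D ^ (9 / (s + 6)) := by gcongr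
    _ = 210 * C * κ ^ 3 * D ^ (3 / 4 : ℝ) + 540 * C * κ ^ 4 * D ^ (9 / (s + 6)) := by ring
    _ ≤ _ := by gcongr

end LocalBounds

section PressureBound

variable {u w b : E3 → E3} {P χ : E3 → ℝ} {φ : Fin 3 → Fin 3 → E3 → ℝ}
  {s K C M R κ D r r' : ℝ}

/-- The matrix field whose divergence is the curl of `w`. -/
def curlPotential (w : E3 → E3) (j k : Fin 3) (x : E3) : ℝ :=
  ![![0, w x 2, -w x 1], ![-w x 2, 0, w x 0], ![w x 1, -w x 0, 0]] j k

lemma contDiff_curlPotential (hw : ContDiff ℝ (⊤ : ℕ∞) w) (j k : Fin 3) :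
    ContDiff ℝ (⊤ : ℕ∞) (curlPotential w j k) := by
  unfold curlPotential
  fin_cases j <;> fin_cases k <;> simp <;> fun_prop

lemma sum_pd_curlPotential (w : E3 → E3) (j : Fin 3) (x : E3) :
    ∑ k, pd k (curlPotential w j k) x = curl3 w x j := by
  have e : ∀ j k, curlPotential w j k = fun x =>
    ![![0, w x 2, -w x 1], ![-w x 2, 0, w x 0], ![w x 1, -w x 0, 0]] j k := fun _ _ => rfl
  fin_cases j <;> simp [e, Fin.sum_univ_three, curl3, pd_const, pd_neg] <;> ring

lemma curlPotential_sq_le (w : E3 → E3) (j k : Fin 3) (x : E3) :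
    curlPotential w j k x ^ 2 ≤ ∑ i, w x i ^ 2 := by
  rw [Fin.sum_univ_three]
  unfold curlPotential
  have h0 := sq_nonneg (w x 0)
  have h1 := sq_nonneg (w x 1)
  have h2 := sq_nonneg (w x 2)
  fin_cases j <;> fin_cases k <;> simp <;> linarith

lemma sq_pd_le_gradSq (v : E3 → E3) (j k : Fin 3) (x : E3) :
    pd k (fun y => v y j) x ^ 2 ≤ gradSq v x :=
  (Finset.single_le_sum (f := fun i => pd i (fun y => v y j) x ^ 2)
    (fun _ _ => sq_nonneg _) (Finset.mem_univ k)).trans (sum_sq_pd_le_gradSq' v j x)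

lemma gradSq_le_dissipation_left (u w b : E3 → E3) (x : E3) :
    gradSq u x + ∑ i, w x i ^ 2 ≤ dissipation u w b x := by
  unfold dissipation
  linarith [gradSq_nonneg w x, gradSq_nonneg b x]

lemma gradSq_le_dissipation_middle (u w b : E3 → E3) (x : E3) :
    gradSq w x ≤ dissipation u w b x := by
  unfold dissipation
  linarith [gradSq_nonneg u x, gradSq_nonneg b x,
    Finset.sum_nonneg fun i (_ : i ∈ Finset.univ) => sq_nonneg (w x i)]

lemma gradSq_le_dissipation_right (u w b : E3 → E3) (x : E3) :
    gradSq b x ≤ dissipation u w b x := by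
  unfold dissipation
  linarith [gradSq_nonneg u x, gradSq_nonneg w x,
    Finset.sum_nonneg fun i (_ : i ∈ Finset.univ) => sq_nonneg (w x i)]

lemma IsMMPSolution.pd_pressure_eq (h : IsMMPSolution u w b P) (j : Fin 3) (x : E3) :
    pd j P x = ∑ k, pd k (fun y => pd k (fun z => u z j) y + curlPotential w j k y) x
      + ∑ l : Fin 3 ⊕ Fin 3, Sum.elim (fun k y => b y k) (fun k y => u y k) l x
        * Sum.elim (fun k y => pd k (fun z => b z j) y) (fun k y => -pd k (fun z => u z j) y)
          l x := by
  have e : ∀ k, pd k (fun y => pd k (fun z => u z j) y + curlPotential w j k y) x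
      = pd k (fun y => pd k (fun z => u z j) y) x + pd k (curlPotential w j k) x := fun k =>
    pd_add k (((contDiff_pd k (contDiff_coord h.smooth_u j)).differentiable (by simp)) x)
      (((contDiff_curlPotential h.smooth_w j k).differentiable (by simp)) x)
  simp only [e, Finset.sum_add_distrib, sum_pd_curlPotential, Fintype.sum_sum_type, Sum.elim_inl,
    Sum.elim_inr, mul_neg, Finset.sum_neg_distrib]
  have := h.eq_u x j
  unfold lap at this
  linarith

lemma setIntegral_le_of_le_dissipation (h : IsMMPSolution u w b P) {f : E3 → ℝ}
    (hf : Continuous f) {c : ℝ} (hc : 0 ≤ c) (hfd : ∀ x, f x ≤ c * dissipation u w b x)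
    (hD : ∫ x in ball3 r, dissipation u w b x ≤ D) : ∫ x in ball3 r, f x ≤ c * D := by
  have hdc := (contDiff_dissipation h.smooth_u h.smooth_w h.smooth_b).continuous
  refine (integral_mono (integrableOn_ball3 hf) ((integrableOn_ball3 hdc).const_mul c)
    hfd).trans ?_
  rw [integral_const_mul]
  gcongr

lemma IsMMPSolution.sourceData (h : IsMMPSolution u w b P) (j : Fin 3)
    (hD0 : 0 ≤ D) (hD : ∫ x in ball3 r, dissipation u w b x ≤ D)
    (Lu : LocalBounds s C R κ D r u) (Lb : LocalBounds s C R κ D r b) :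
    SourceData r (4 * D) D (C * κ ^ 3 * R * D ^ (9 / (s + 6))) (C * κ ^ 12 * D ^ 3) (pd j P)
      (fun k y => pd k (fun z => u z j) y + curlPotential w j k y)
      (Sum.elim (fun k y => b y k) (fun k y => u y k))
      (Sum.elim (fun k y => pd k (fun z => b z j) y) (fun k y => -pd k (fun z => u z j) y)) where
  smooth_A k := ((contDiff_pd k (contDiff_coord h.smooth_u j)).add
    (contDiff_curlPotential h.smooth_w j k)).of_le (by simp)
  cont_a
    | .inl k => (contDiff_coord h.smooth_b k).continuous
    | .inr k => (contDiff_coord h.smooth_u k).continuous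
  cont_c
    | .inl k => (contDiff_pd k (contDiff_coord h.smooth_b j)).continuous
    | .inr k => (contDiff_pd k (contDiff_coord h.smooth_u j)).continuous.neg
  eq := h.pd_pressure_eq j
  A_le k := by
    have h2 : (2 : ℝ) * D ≤ 4 * D := by linarith
    refine (setIntegral_le_of_le_dissipation h (c := 2) ?_ (by norm_num) (fun x => ?_) hD).trans h2
    · exact ((contDiff_pd k (contDiff_coord h.smooth_u j)).add
        (contDiff_curlPotential h.smooth_w j k)).continuous.pow 2
    · have h1 := sq_pd_le_gradSq u j k x
      have h2 := curlPotential_sq_le w j k x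
      have h3 := gradSq_le_dissipation_left u w b x
      nlinarith [sq_nonneg (pd k (fun z => u z j) x - curlPotential w j k x)]
  c_le
    | .inl k => by
      have := setIntegral_le_of_le_dissipation h (c := 1) (f := fun x =>
        pd k (fun z => b z j) x ^ 2) ((contDiff_pd k (contDiff_coord h.smooth_b j)).continuous.pow 2)
        zero_le_one (fun x => by
          linarith [sq_pd_le_gradSq b j k x, gradSq_le_dissipation_right u w b x]) hD
      simpa using this
    | .inr k => by
      have := setIntegral_le_of_le_dissipation h (c := 1) (f := fun x =>
        pd k (fun z => u z j) x ^ 2) ((contDiff_pd k (contDiff_coord h.smooth_u j)).continuous.pow 2)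
        zero_le_one (fun x => by
          linarith [sq_pd_le_gradSq u j k x, gradSq_le_dissipation_left u w b x,
            Finset.sum_nonneg fun i (_ : i ∈ Finset.univ) => sq_nonneg (w x i)]) hD
      simpa using this
  a_le₃
    | .inl k => Lb.cube_le k
    | .inr k => Lu.cube_le k
  a_le₆
    | .inl k => Lb.six_le k
    | .inr k => Lu.six_le k

lemma sq_sum_add_le (a c : Fin 3 → ℝ) : (∑ j, (a j + c j)) ^ 2
    ≤ 6 * ∑ j, (a j ^ 2 + c j ^ 2) := by
  have h := sq_sum_le_card_mul_sum_sq (s := (Finset.univ : Finset (Fin 3)))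
    (f := fun j => a j + c j)
  have h' : ∑ j, (a j + c j) ^ 2 ≤ ∑ j, 2 * (a j ^ 2 + c j ^ 2) :=
    Finset.sum_le_sum fun j _ => by nlinarith [sq_nonneg (a j - c j)]
  rw [← Finset.mul_sum] at h'
  simp only [Finset.card_univ, Fintype.card_fin, Nat.cast_ofNat] at h
  linarith

lemma sum_pow_six_le (a : Fin 3 → ℝ) : (∑ j, a j) ^ 6 ≤ 243 * ∑ j, a j ^ 6 := by
  have h := pow_sum_div_card_le_sum_pow (s := (Finset.univ : Finset (Fin 3)))
    (f := fun j => |a j|) (fun _ _ => abs_nonneg _) 5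
  have he : Even 6 := by decide
  simp only [Finset.card_univ, Fintype.card_fin, Nat.cast_ofNat, Nat.reduceAdd, he.pow_abs] at h
  have h' : (∑ j, a j) ^ 6 ≤ (∑ j, |a j|) ^ 6 := by
    rw [← he.pow_abs]
    exact pow_le_pow_left₀ (abs_nonneg _) (Finset.abs_sum_le_sum_abs _ _) 6
  rw [div_le_iff₀ (by norm_num)] at h
  linarith

lemma integral_sq_pd_test_le (h : IsMMPSolution u w b P) (hχ : ContDiff ℝ (⊤ : ℕ∞) χ)
    (hC : 1 ≤ C) (hR : 1 ≤ R) (hκ : 1 ≤ κ) (hD1 : 1 ≤ D)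
    (hχ1 : ∀ k x, |pd k χ x| ≤ κ / R) (hχ2 : ∀ i k x, |pd i (pd k χ) x| ≤ (κ / R) ^ 2)
    (hD : ∫ x in ball3 r, dissipation u w b x ≤ D) (Lu : LocalBounds s C R κ D r u) (i : Fin 3) :
    ∫ x in ball3 r, pd i (fun y => ∑ j, u y j * pd j χ y) x ^ 2
      ≤ 36 * C * κ ^ 6 / R ^ 2 * D := by
  have hR0 : 0 < R := by linarith
  have hκ0 : 0 < κ := by linarith
  have hdc := (contDiff_dissipation h.smooth_u h.smooth_w h.smooth_b).continuous
  have hu := h.smooth_u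
  have huc := hu.continuous
  have hd : ∀ j, Differentiable ℝ (fun y => u y j) := fun j =>
    (contDiff_coord hu j).differentiable (by simp)
  have hχd : ∀ j, Differentiable ℝ (pd j χ) := fun j =>
    (contDiff_pd j hχ).differentiable (by simp)
  have hgc : Continuous (pd i (fun y => ∑ j, u y j * pd j χ y)) := (contDiff_pd i
    (ContDiff.sum fun j _ => (contDiff_coord hu j).mul (contDiff_pd j hχ))).continuous
  have hsq : ∀ {x y : ℝ}, |x| ≤ y → x ^ 2 ≤ y ^ 2 := fun {x y} hxy => by
    rw [← sq_abs]
    exact pow_le_pow_left₀ (abs_nonneg _) hxy 2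
  have hpt : ∀ x, pd i (fun y => ∑ j, u y j * pd j χ y) x ^ 2
      ≤ 6 * ((κ / R) ^ 2 * dissipation u w b x + ((κ / R) ^ 2) ^ 2 * ∑ j, u x j ^ 2) := by
    intro x
    rw [pd_sum Finset.univ i (F := fun j y => u y j * pd j χ y)
      fun j _ => (hd j x).mul (hχd j x)]
    have e : ∀ j, pd i (fun y => u y j * pd j χ y) x
        = pd i (fun y => u y j) x * pd j χ x + u x j * pd i (pd j χ) x := fun j =>
      pd_mul i (hd j x) (hχd j x)
    simp only [e]
    refine (sq_sum_add_le _ _).trans ?_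
    rw [Finset.sum_add_distrib]
    gcongr
    · calc ∑ j, (pd i (fun y => u y j) x * pd j χ x) ^ 2
          ≤ ∑ j, (κ / R) ^ 2 * pd i (fun y => u y j) x ^ 2 := by
            refine Finset.sum_le_sum fun j _ => ?_
            rw [mul_pow, mul_comm]
            exact mul_le_mul_of_nonneg_right (hsq (hχ1 j x)) (sq_nonneg _)
        _ ≤ _ := by
            rw [← Finset.mul_sum]
            have h1 := sum_sq_pd_le_gradSq u i x
            have h2 := gradSq_le_dissipation_left u w b x
            have h3 : 0 ≤ ∑ i, w x i ^ 2 := Finset.sum_nonneg fun _ _ => sq_nonneg _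
            gcongr
            linarith
    · rw [Finset.mul_sum]
      refine Finset.sum_le_sum fun j _ => ?_
      rw [mul_pow, mul_comm]
      exact mul_le_mul_of_nonneg_right (hsq (hχ2 i j x)) (sq_nonneg _)
  have hu2 : ∫ x in ball3 r, ∑ j, u x j ^ 2 ≤ 3 * (C * κ ^ 2 * R ^ 2 * D) := by
    rw [integral_finsetSum _ fun j _ => integrableOn_ball3 (by fun_prop)]
    have hb : ∀ j ∈ (Finset.univ : Finset (Fin 3)), ∫ x in ball3 r, u x j ^ 2
        ≤ C * κ ^ 2 * R ^ 2 * D := fun j _ => by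
      refine (Lu.sq_le j).trans ?_
      gcongr
      exact rpow_le_self_of_exponent_le_one hD1 (by norm_num)
    simpa using Finset.sum_le_card_nsmul _ _ _ hb
  have i2 : IntegrableOn (fun x => ∑ j, u x j ^ 2) (ball3 r) := integrableOn_ball3 (by fun_prop)
  calc ∫ x in ball3 r, pd i (fun y => ∑ j, u y j * pd j χ y) x ^ 2
      ≤ ∫ x in ball3 r, 6 * ((κ / R) ^ 2 * dissipation u w b x
          + ((κ / R) ^ 2) ^ 2 * ∑ j, u x j ^ 2) :=
        integral_mono (integrableOn_ball3 (hgc.pow 2))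
          ((((integrableOn_ball3 hdc).const_mul _).add (i2.const_mul _)).const_mul 6) hpt
    _ = 6 * ((κ / R) ^ 2 * (∫ x in ball3 r, dissipation u w b x)
          + ((κ / R) ^ 2) ^ 2 * ∫ x in ball3 r, ∑ j, u x j ^ 2) := by
        rw [integral_const_mul, integral_add ((integrableOn_ball3 hdc).const_mul _)
          (i2.const_mul _), integral_const_mul, integral_const_mul]
    _ ≤ 6 * ((κ / R) ^ 2 * D + ((κ / R) ^ 2) ^ 2 * (3 * (C * κ ^ 2 * R ^ 2 * D))) := by
        gcongr
    _ = (6 * κ ^ 2 + 18 * (C * κ ^ 6)) / R ^ 2 * D := by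
        field_simp
        ring
    _ ≤ 36 * C * κ ^ 6 / R ^ 2 * D := by
        have h1 : κ ^ 2 ≤ κ ^ 6 := pow_le_pow_right₀ hκ (by norm_num)
        have h2 : κ ^ 6 ≤ C * κ ^ 6 := le_mul_of_one_le_left (by positivity) hC
        have h3 : 0 ≤ C * κ ^ 6 := by positivity
        gcongr
        linarith

lemma integral_test_pow_six_le (hu : Continuous u) (hχ : ContDiff ℝ (⊤ : ℕ∞) χ)
    (hR : 0 < R) (hκ : 0 ≤ κ) (hχ1 : ∀ k x, |pd k χ x| ≤ κ / R)
    (Lu : LocalBounds s C R κ D r u) :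
    ∫ x in ball3 r, (∑ j, u x j * pd j χ x) ^ 6 ≤ 729 * C * κ ^ 18 / R ^ 6 * D ^ 3 := by
  have hc : ∀ j, Continuous (pd j χ) := fun j => (contDiff_pd j hχ).continuous
  have i6 : ∀ j, IntegrableOn (fun x => u x j ^ 6) (ball3 r) := fun j =>
    integrableOn_ball3 (by fun_prop)
  have hpt : ∀ x, (∑ j, u x j * pd j χ x) ^ 6 ≤ ∑ j, 243 * (κ / R) ^ 6 * u x j ^ 6 := by
    intro x
    refine (sum_pow_six_le _).trans ?_
    rw [Finset.mul_sum]
    refine Finset.sum_le_sum fun j _ => ?_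
    rw [mul_pow, mul_assoc, mul_comm (u x j ^ 6)]
    have h6 : pd j χ x ^ 6 ≤ (κ / R) ^ 6 := by
      rw [← Even.pow_abs (by decide : Even 6)]
      exact pow_le_pow_left₀ (abs_nonneg _) (hχ1 j x) 6
    gcongr
  calc ∫ x in ball3 r, (∑ j, u x j * pd j χ x) ^ 6
      ≤ ∫ x in ball3 r, ∑ j, 243 * (κ / R) ^ 6 * u x j ^ 6 :=
        integral_mono (integrableOn_ball3 (by fun_prop))
          (integrable_finsetSum _ fun j _ => (i6 j).const_mul _) hpt
    _ = ∑ j, 243 * (κ / R) ^ 6 * ∫ x in ball3 r, u x j ^ 6 := by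
        rw [integral_finsetSum _ fun j _ => (i6 j).const_mul _]
        simp only [integral_const_mul]
    _ ≤ ∑ j : Fin 3, 243 * (κ / R) ^ 6 * (C * κ ^ 12 * D ^ 3) := by
        gcongr with j
        exact Lu.six_le j
    _ = _ := by
        simp only [Finset.sum_const, Finset.card_univ, Fintype.card_fin, nsmul_eq_mul]
        push_cast
        field_simp
        ring

lemma IsMMPSolution.abs_integral_pressure_le (h : IsMMPSolution u w b P)
    (hφ : IsPotential s K φ u R) (hχ : ContDiff ℝ (⊤ : ℕ∞) χ) (hs : 3 < s) (hs6 : s ≤ 6)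
    (hK : 1 ≤ K) (hC : 1 ≤ C) (hR : 1 ≤ R) (hκ : 1 ≤ κ) (hD1 : 1 ≤ D)
    (hM : ∀ ε : ℝ, 0 < ε → ∃ ψ : E3 → ℝ, ContDiff ℝ (⊤ : ℕ∞) ψ ∧ (∀ z, 0 ≤ ψ z) ∧
      (∀ z, z ∉ ball3 ε → ψ z = 0) ∧ ∫ z, ψ z = 1 ∧ ∀ k, ∫ z, |pd k ψ z| ≤ M / ε)
    (hr : 0 < r) (hrr : r + R / κ ≤ r') (hr' : r' ≤ R) (hχs : tsupport χ ⊆ ball3 r)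
    (hχ1 : ∀ k x, |pd k χ x| ≤ κ / R) (hχ2 : ∀ i k x, |pd i (pd k χ) x| ≤ (κ / R) ^ 2)
    (hD : ∫ x in ball3 r', dissipation u w b x ≤ D)
    (Lu : LocalBounds s C R κ D r' u) (Lb : LocalBounds s C R κ D r' b) :
    |∫ x in ball3 r, P x * ∑ j, u x j * pd j χ x|
      ≤ 225 * (60 * M * K * κ ^ 3 * D ^ (11 / 12 : ℝ)
          + 12 * K * C ^ 2 * κ ^ 17 * D ^ (9 / (s + 6)))
        + 3 * (36 * C * κ ^ 2 * D ^ (11 / 12 : ℝ) + 18 * C * κ ^ 3 * D ^ (11 / 12 : ℝ)) := by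
  have hR0 : 0 < R := by linarith
  have hκ0 : 0 < κ := by linarith
  have hs0 : 0 < s := by linarith
  have hrR : r ≤ r' := by have : 0 < R / κ := by positivity
                          linarith
  have hd := (contDiff_dissipation h.smooth_u h.smooth_w h.smooth_b).continuous
  have hDr : ∫ x in ball3 r, dissipation u w b x ≤ D :=
    (setIntegral_ball3_mono hrR hd fun x => dissipation_nonneg u w b x).trans hD
  have Lu' := Lu.mono hrR h.smooth_u.continuous
  have hφc : ∀ i j, Continuous (φ i j) := fun i j => (hφ.smooth i j).continuous
  have hφs : ∀ i j, ∫ x in ball3 r, |φ i j x| ^ s ≤ K * R ^ (s / 3 + 2) := fun i j =>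
    (setIntegral_ball3_mono (hrR.trans hr') ((hφc i j).abs.rpow_const fun _ => Or.inr hs0.le)
      fun x => by positivity).trans (hφ.le i j)
  have H : PressureData s r r' (4 * D) D (C * κ ^ 3 * R * D ^ (9 / (s + 6))) (C * κ ^ 12 * D ^ 3)
      (2 * κ ^ 2 / R) ((5 * K * R ^ (11 / 6 - 1 / s)) ^ 2) (K * R ^ (s / 3 + 2)) P χ
      (fun j x => u x j) φ (fun j k y => pd k (fun z => u z j) y + curlPotential w j k y)
      (Sum.elim (fun k y => b y k) (fun k y => u y k))
      (fun j => Sum.elim (fun k y => pd k (fun z => b z j) y)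
        (fun k y => -pd k (fun z => u z j) y)) :=
    { pos_r := hr
      pos_m := by positivity
      source := fun j => h.sourceData j (by linarith) hD Lu Lb
      smooth_p := h.smooth_P
      smooth_χ := hχ
      smooth_u := contDiff_coord h.smooth_u
      smooth_φ := hφ.smooth
      tsupport_χ := hχs
      u_eq := hφ.eq
      div_u := h.div_u
      pd_χ_le := fun j x => (hχ1 j x).trans (by
        gcongr
        nlinarith)
      pd_pd_χ_le := fun i j x => by
        calc 2 * r * |pd i (pd j χ) x| ≤ 2 * R * (κ / R) ^ 2 := by
              gcongr
              · exact hrR.trans hr'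
              · exact hχ2 i j x
          _ = 2 * κ ^ 2 / R := by field_simp
      φ_sq_le := fun i j => setIntegral_sq_le_of_rpow hs hK hR
        (Metric.ball_subset_ball (hrR.trans hr')) (hφc i j) (hφs i j)
      φ_rpow_le := hφs }
  have hε := mollScale_pos (s := s) hR hκ hD1
  obtain ⟨ψ, hψ, hψ0, hψs, hψ1, hψM⟩ := hM _ hε
  have hεle := mollScale_le hs0 hR hκ hD1
  have key := H.abs_integral_pressure_le hs hs6 hε (hψ.of_le (by simp)) hψ0 hψs hψ1 hψM
    (by linarith) (integral_sq_pd_test_le h hχ hC hR hκ hD1 hχ1 hχ2 hDr Lu')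
    (integral_test_pow_six_le h.smooth_u.continuous hχ hR0 hκ0.le hχ1 Lu')
  simp only [Fintype.card_sum, Fintype.card_fin, Nat.reduceAdd, Nat.cast_ofNat, mul_add] at key
  have b1 := moll_linear_eq (s := s) (M := M) hK hR hκ hD1
  have b2 := moll_nonlinear_le hs hK hC hR hκ hD1
  have b3 := translate_linear_le hs hC hR hκ hD1
  have b4 := translate_nonlinear_le hs hs6 hC hR hκ hD1
  refine key.trans ?_
  linarith

end PressureBound

section EnergyStep

variable {s K : ℝ}

lemma exists_energy_step (hs : 3 < s) (hs6 : s ≤ 6) (hK : 1 ≤ K) : ∃ C : ℝ, 1 ≤ C ∧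
    ∀ {u w b : E3 → E3} {P : E3 → ℝ} {φ₁ φ₂ φ₃ : Fin 3 → Fin 3 → E3 → ℝ} {r R D : ℝ},
      IsMMPSolution u w b P → IsPotential s K φ₁ u R → IsPotential s K φ₂ w R →
      IsPotential s K φ₃ b R → 1 ≤ r → r < R → 1 ≤ D →
      ∫ x in ball3 R, dissipation u w b x ≤ D →
      ∫ x in ball3 r, dissipation u w b x
        ≤ C * (R / (R - r)) ^ 17 * D ^ max (11 / 12) (9 / (s + 6)) := by
  obtain ⟨C₀, hC₀, hcut⟩ := exists_cutoff
  obtain ⟨C, hC, hloc⟩ := exists_localBounds hs hs6 hK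
  obtain ⟨M, hM, hker⟩ := exists_kernel
  set A := 4 * ((210 * C + 540 * C) + (225 * (60 * M * K + 12 * K * C ^ 2)
    + 3 * (36 * C + 18 * C))) with hA
  have hA1 : 1 ≤ A := by
    have : 0 ≤ 225 * (60 * M * K + 12 * K * C ^ 2) := by positivity
    linarith
  refine ⟨A * (5 * C₀) ^ 17, one_le_mul_of_one_le_of_one_le hA1 (one_le_pow₀ (by linarith)), ?_⟩
  intro u w b P φ₁ φ₂ φ₃ r R D h p₁ p₂ p₃ hr hrR hD1 hD
  obtain ⟨d, hd⟩ : ∃ d, d = R - r := ⟨_, rfl⟩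
  have hd0 : 0 < d := by linarith
  have hR1 : 1 ≤ R := by linarith
  have hR0 : 0 < R := by linarith
  rw [← hd]
  obtain ⟨κ, hκ⟩ : ∃ κ, κ = 5 * C₀ * (R / d) := ⟨_, rfl⟩
  have hRd : 1 ≤ R / d := by
    rw [le_div_iff₀ hd0]
    linarith
  have hκ1 : 1 ≤ κ := by
    rw [hκ]
    exact one_le_mul_of_one_le_of_one_le (by linarith) hRd
  have hκR : κ / R = 5 * C₀ / d := by
    rw [hκ]
    field_simp
  have hRκ : R / κ ≤ d / 5 := by
    rw [hκ, div_le_iff₀ (by positivity)]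
    have : d / 5 * (5 * C₀ * (R / d)) = C₀ * R := by
      field_simp
    rw [this]
    nlinarith
  obtain ⟨χ, hχ, hχ0, -, hχin, hχout, hχ1, hχ2⟩ :=
    hcut r (r + d / 5) (by linarith) (by linarith)
  obtain ⟨η, hη, hη0, hη1, hηin, hηout, hηd, -⟩ :=
    hcut (r + d / 2) (r + 3 * d / 4) (by linarith) (by linarith)
  have hdis := contDiff_dissipation h.smooth_u h.smooth_w h.smooth_b
  have hLoc : ∀ {v : E3 → E3} {φ : Fin 3 → Fin 3 → E3 → ℝ}, ContDiff ℝ (⊤ : ℕ∞) v →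
      IsPotential s K φ v R → (∀ x, gradSq v x ≤ dissipation u w b x) →
      LocalBounds s C R κ D (r + d / 2) v := by
    intro v φ hv hp hg
    refine hloc hR1 hκ1 hD1 hv hp hη hη0 hη1 (fun x hx => hηin x ?_) (fun x hx => hηout x ?_)
      (fun i x => (hηd i x).trans ?_) (le_trans ?_ hD)
    · have : ‖x‖ < r + d / 2 := by simpa [ball3] using hx
      exact this.le
    · have : R ≤ ‖x‖ := by simpa [ball3] using hx
      linarith
    · rw [hκR, show r + 3 * d / 4 - (r + d / 2) = d / 4 by ring, div_div_eq_mul_div]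
      exact div_le_div_of_nonneg_right (by linarith) hd0.le
    · exact integral_mono (integrableOn_ball3 (contDiff_gradSq hv).continuous)
        (integrableOn_ball3 hdis.continuous) hg
  have Lu := hLoc h.smooth_u p₁ fun x => by
    linarith [gradSq_le_dissipation_left u w b x,
      Finset.sum_nonneg fun i (_ : i ∈ Finset.univ) => sq_nonneg (w x i)]
  have Lw := hLoc h.smooth_w p₂ fun x => gradSq_le_dissipation_middle u w b x
  have Lb := hLoc h.smooth_b p₃ fun x => gradSq_le_dissipation_right u w b x
  have hD' : ∀ t, t ≤ R → ∫ x in ball3 t, dissipation u w b x ≤ D := fun t ht =>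
    (setIntegral_ball3_mono ht hdis.continuous fun x => dissipation_nonneg u w b x).trans hD
  have hχ1' : ∀ k x, |pd k χ x| ≤ κ / R := fun k x => (hχ1 k x).trans_eq (by
    rw [hκR, add_sub_cancel_left]
    field_simp)
  have hχ2' : ∀ i k x, |pd i (pd k χ) x| ≤ (κ / R) ^ 2 := fun i k x => (hχ2 i k x).trans (by
    rw [hκR, add_sub_cancel_left, div_pow, div_pow, div_div_eq_mul_div]
    gcongr
    nlinarith)
  have hsupp : tsupport χ ⊆ closedBall (0 : E3) (r + d / 5) := by
    refine closure_minimal (fun x hx => ?_) isClosed_closedBall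
    by_contra hx'
    refine hx (hχout x ?_)
    have : r + d / 5 < ‖x‖ := by simpa using hx'
    exact this.le
  have hχs : tsupport χ ⊆ ball3 (r + d / 4) :=
    hsupp.trans (closedBall_subset_ball (by linarith))
  have hcs : HasCompactSupport χ := (isCompact_closedBall (0 : E3) (r + d / 5)).of_isClosed_subset
    (isClosed_tsupport χ) hsupp
  have hχz : ∀ k x, x ∉ ball3 (r + d / 4) → pd k χ x = 0 := fun k x hx =>
    pd_eq_zero_of_notMem_tsupport k fun hx' => hx (hχs hx')
  have hm : r + d / 4 ≤ r + d / 2 := by linarith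
  have b1 := integral_flux_le_rpow h.smooth_u h.smooth_w h.smooth_b hχ hC hR1 hκ1 hD1 hχ1' hχz
    (hD' _ (by linarith)) (Lu.mono hm h.smooth_u.continuous) (Lw.mono hm h.smooth_w.continuous)
    (Lb.mono hm h.smooth_b.continuous)
  have b2 := h.abs_integral_pressure_le p₁ hχ hs hs6 hK hC hR1 hκ1 hD1 hker
    (by linarith : 0 < r + d / 4) (by linarith : r + d / 4 + R / κ ≤ r + d / 2) (by linarith) hχs
    hχ1' hχ2' (hD' _ (by linarith)) Lu Lb
  have hX : ∀ g : E3 → ℝ, Continuous g → ∀ k, Integrable fun x => pd k χ x * g x := fun g hg k =>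
    ((contDiff_pd k hχ).continuous.mul hg).integrable_of_hasCompactSupport
      (HasCompactSupport.pd k hcs).mul_right
  have hsplit : ∫ x, ∑ k, pd k χ x * (energyFlux u w b k x + P x * u x k)
      = (∫ x, ∑ k, pd k χ x * energyFlux u w b k x)
        + ∫ x in ball3 (r + d / 4), P x * ∑ j, u x j * pd j χ x := by
    have e : ∫ x in ball3 (r + d / 4), P x * ∑ j, u x j * pd j χ x
        = ∫ x, ∑ k, pd k χ x * (P x * u x k) := by
      rw [setIntegral_eq_integral_of_forall_compl_eq_zero fun x hx => by simp [hχz _ x hx]]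
      refine integral_congr_ae (Eventually.of_forall fun x => ?_)
      simp only [Finset.mul_sum]
      exact Finset.sum_congr rfl fun k _ => by ring
    rw [e, ← integral_add]
    · refine integral_congr_ae (Eventually.of_forall fun x => ?_)
      simp only [← Finset.sum_add_distrib]
      exact Finset.sum_congr rfl fun k _ => by ring
    · exact integrable_finsetSum _ fun k _ =>
        hX _ (contDiff_energyFlux h.smooth_u h.smooth_w h.smooth_b k).continuous k
    · exact integrable_finsetSum _ fun k _ =>
        hX _ (h.smooth_P.continuous.mul (contDiff_coord h.smooth_u k).continuous) k
  have b0 : ∫ x in ball3 r, dissipation u w b x ≤ ∫ x, χ x * dissipation u w b x :=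
    setIntegral_le_integral_of_eq
      ((hχ.continuous.mul hdis.continuous).integrable_of_hasCompactSupport hcs.mul_right)
      (fun x => mul_nonneg (hχ0 x) (dissipation_nonneg u w b x)) fun x hx => by
        have : ‖x‖ < r := by simpa [ball3] using hx
        rw [hχin x this.le, one_mul]
  have b3 := h.integral_mul_dissipation_le hχ hcs hχ0
  rw [hsplit] at b3
  set γ := max (11 / 12) (9 / (s + 6)) with hγ
  have g1 : D ^ (3 / 4 : ℝ) ≤ D ^ γ :=
    Real.rpow_le_rpow_of_exponent_le hD1 (le_trans (by norm_num) (le_max_left _ _))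
  have g2 : D ^ (11 / 12 : ℝ) ≤ D ^ γ := Real.rpow_le_rpow_of_exponent_le hD1 (le_max_left _ _)
  have g3 : D ^ (9 / (s + 6)) ≤ D ^ γ := Real.rpow_le_rpow_of_exponent_le hD1 (le_max_right _ _)
  have k2 : κ ^ 2 ≤ κ ^ 17 := pow_le_pow_right₀ hκ1 (by norm_num)
  have k3 : κ ^ 3 ≤ κ ^ 17 := pow_le_pow_right₀ hκ1 (by norm_num)
  have k4 : κ ^ 4 ≤ κ ^ 17 := pow_le_pow_right₀ hκ1 (by norm_num)
  have hκ0 : 0 ≤ κ := by linarith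
  have hCp : 0 ≤ C := by linarith
  have hMp : 0 ≤ M := by linarith
  have hKp : 0 ≤ K := by linarith
  have hD0 : 0 ≤ D := by linarith
  have c1 : 210 * C * κ ^ 4 * D ^ (3 / 4 : ℝ) + 540 * C * κ ^ 4 * D ^ (9 / (s + 6))
      ≤ 210 * C * κ ^ 17 * D ^ γ + 540 * C * κ ^ 17 * D ^ γ := by gcongr
  have c2 : 225 * (60 * M * K * κ ^ 3 * D ^ (11 / 12 : ℝ)
        + 12 * K * C ^ 2 * κ ^ 17 * D ^ (9 / (s + 6)))
        + 3 * (36 * C * κ ^ 2 * D ^ (11 / 12 : ℝ) + 18 * C * κ ^ 3 * D ^ (11 / 12 : ℝ))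
      ≤ 225 * (60 * M * K * κ ^ 17 * D ^ γ + 12 * K * C ^ 2 * κ ^ 17 * D ^ γ)
        + 3 * (36 * C * κ ^ 17 * D ^ γ + 18 * C * κ ^ 17 * D ^ γ) := by gcongr
  have e : A * (5 * C₀) ^ 17 * (R / d) ^ 17 * D ^ γ = A * κ ^ 17 * D ^ γ := by
    rw [hκ, mul_pow (5 * C₀)]
    ring
  rw [e, hA]
  have b2' := (le_abs_self _).trans b2
  linarith

end EnergyStep

section Potential

lemma abs_le_frob (A : Fin 3 → Fin 3 → ℝ) (i j : Fin 3) : |A i j| ≤ frob A := by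
  rw [← Real.sqrt_sq_eq_abs]
  refine Real.sqrt_le_sqrt ?_
  exact (Finset.single_le_sum (f := fun j => A i j ^ 2) (fun _ _ => sq_nonneg _)
    (Finset.mem_univ j)).trans (Finset.single_le_sum (f := fun i => ∑ j, A i j ^ 2)
      (fun _ _ => Finset.sum_nonneg fun _ _ => sq_nonneg _) (Finset.mem_univ i))

lemma meanOsc_nonneg (Φ : E3 → Fin 3 → Fin 3 → ℝ) (s r : ℝ) : 0 ≤ meanOsc Φ s r :=
  Real.rpow_nonneg (mul_nonneg (by positivity)
    (integral_nonneg fun _ => Real.rpow_nonneg (Real.sqrt_nonneg _) _)) _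

lemma isPotential_sub_mavg {Φ : E3 → Fin 3 → Fin 3 → ℝ} {v : E3 → E3} {s C₀ r : ℝ}
    (hΦ : ∀ i j, ContDiff ℝ (⊤ : ℕ∞) (fun x => Φ x i j)) (hv : ∀ x j, mdiv Φ x j = v x j)
    (hs : 3 < s) (hC₀ : 0 < C₀) (hr : 1 < r)
    (hosc : meanOsc Φ s r ≤ C₀ * r ^ ((1 : ℝ) / 3 - 1 / s)) :
    IsPotential s (max 1 (5 * C₀ ^ s)) (fun i j x => Φ x i j - mavg Φ r i j) v r where
  smooth i j := (hΦ i j).sub contDiff_const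
  eq j x := by
    rw [← hv x j, mdiv]
    exact Finset.sum_congr rfl fun i _ => (pd_sub_const i _).symm
  le i j := by
    have hs0 : 0 < s := by linarith
    have hr0 : 0 < r := by linarith
    have hc : Continuous fun x => frob fun i j => Φ x i j - mavg Φ r i j := by
      have : ∀ i j, Continuous fun x => Φ x i j := fun i j => (hΦ i j).continuous
      unfold frob
      fun_prop
    have hf0 : ∀ x, 0 ≤ frob fun i j => Φ x i j - mavg Φ r i j := fun x => Real.sqrt_nonneg _
    set I := ∫ x in ball3 r, (frob fun i j => Φ x i j - mavg Φ r i j) ^ s with hI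
    have hI0 : 0 ≤ I := integral_nonneg fun x => Real.rpow_nonneg (hf0 x) _
    have hV0 : 0 < (volume (ball3 r)).toReal := by
      rw [volume_ball3_toReal hr0.le]
      positivity
    have h1 : ∫ x in ball3 r, |Φ x i j - mavg Φ r i j| ^ s ≤ I := by
      refine integral_mono (integrableOn_ball3 ?_) (integrableOn_ball3 ?_) fun x => ?_
      · exact ((hΦ i j).continuous.sub continuous_const).abs.rpow_const fun _ => Or.inr hs0.le
      · exact hc.rpow_const fun _ => Or.inr hs0.le
      · exact Real.rpow_le_rpow (abs_nonneg _)
          (abs_le_frob (fun i j => Φ x i j - mavg Φ r i j) i j) hs0.le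
    have h2 : (volume (ball3 r)).toReal⁻¹ * I ≤ C₀ ^ s * r ^ (s / 3 - 1) := by
      have h := Real.rpow_le_rpow (meanOsc_nonneg Φ s r) hosc hs0.le
      rw [meanOsc, ← Real.rpow_mul (by positivity), one_div_mul_cancel hs0.ne', Real.rpow_one,
        Real.mul_rpow hC₀.le (by positivity), ← Real.rpow_mul hr0.le] at h
      refine h.trans_eq ?_
      congr 2
      field_simp
    have h3 : I ≤ (volume (ball3 r)).toReal * (C₀ ^ s * r ^ (s / 3 - 1)) := by
      rwa [inv_mul_le_iff₀ hV0] at h2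
    have h4 : r ^ 3 * r ^ (s / 3 - 1) = r ^ (s / 3 + 2) := by
      rw [← Real.rpow_natCast, ← Real.rpow_add hr0]
      congr 1
      push_cast
      ring
    calc ∫ x in ball3 r, |Φ x i j - mavg Φ r i j| ^ s
        ≤ (volume (ball3 r)).toReal * (C₀ ^ s * r ^ (s / 3 - 1)) := h1.trans h3
      _ ≤ 5 * r ^ 3 * (C₀ ^ s * r ^ (s / 3 - 1)) := by
          gcongr
          exact volume_ball3_le hr0.le
      _ = 5 * C₀ ^ s * r ^ (s / 3 + 2) := by rw [← h4]; ring
      _ ≤ _ := by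
          gcongr
          exact le_max_right _ _

end Potential

section Iteration

lemma le_of_backward_recursion {A B γ L T : ℝ} {F : ℕ → ℝ} (hγ0 : 0 < γ)
    (hγ1 : γ < 1) (hA : 1 ≤ A) (hB : 1 < B) (hT : T = B ^ (1 - γ)⁻¹)
    (hL : L = (A * T ^ γ) ^ (1 - γ)⁻¹) (hF0 : ∀ j, 0 ≤ F j)
    (hF : ∀ j, F j ≤ A * B ^ j * F (j + 1) ^ γ) {m : ℝ} (hm : ∀ j, F j ≤ m) : F 0 ≤ L := by
  have hg : 0 < (1 - γ)⁻¹ := inv_pos.2 (by linarith)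
  have hg' : (1 - γ)⁻¹ * (1 - γ) = 1 := inv_mul_cancel₀ (by linarith)
  have hT1 : 1 < T := hT ▸ Real.one_lt_rpow hB hg
  have hT0 : 0 < T := by linarith
  have ht1 : 1 < T ^ γ := Real.one_lt_rpow hT1 hγ0
  have hL1 : 1 ≤ L := hL ▸ Real.one_le_rpow
    (one_le_mul_of_one_le_of_one_le hA ht1.le) hg.le
  have hL0 : 0 < L := by linarith
  have e1 : B * T ^ γ = T := by
    have : B = T ^ (1 - γ) := by
      rw [hT, ← Real.rpow_mul (by linarith), hg', Real.rpow_one]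
    nth_rewrite 1 [this]
    rw [← Real.rpow_add hT0]
    simp
  have e2 : A * T ^ γ * L ^ γ = L := by
    have : A * T ^ γ = L ^ (1 - γ) := by
      rw [hL, ← Real.rpow_mul (by positivity), hg', Real.rpow_one]
    rw [this, ← Real.rpow_add hL0]
    simp
  have step : ∀ j, F (j + 1) ≤ L * T ^ (j + 1) → F j ≤ L * T ^ j := by
    intro j hj
    calc F j ≤ A * B ^ j * F (j + 1) ^ γ := hF j
      _ ≤ A * B ^ j * (L * T ^ (j + 1)) ^ γ := by
          gcongr
          exact hF0 _
      _ = A * B ^ j * (L ^ γ * (T ^ γ) ^ (j + 1)) := by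
          rw [Real.mul_rpow hL0.le (by positivity), Real.rpow_pow_comm hT0.le]
      _ = (A * T ^ γ * L ^ γ) * (B * T ^ γ) ^ j := by ring
      _ = L * T ^ j := by rw [e1, e2]
  obtain ⟨J, hJ⟩ := pow_unbounded_of_one_lt m hT1
  have hJ' : F J ≤ L * T ^ J := by
    have : 0 < T ^ J := by positivity
    nlinarith [hm J]
  have down : ∀ k, F k ≤ L * T ^ k → F 0 ≤ L := by
    intro k
    induction k with
    | zero => intro h; simpa using h
    | succ k ih => exact fun h => ih (step k h)
  exact down J hJ'

lemma exists_bound_of_step {C γ : ℝ} (hγ0 : 0 < γ) (hγ1 : γ < 1) (hC : 1 ≤ C) {E : ℝ → ℝ}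
    (hE : Monotone E)
    (h : ∀ r R D, 1 < r → r < R → 1 ≤ D → E R ≤ D → E r ≤ C * (R / (R - r)) ^ 17 * D ^ γ) :
    ∃ L, ∀ ρ, 1 < ρ → E ρ ≤ L := by
  refine ⟨_, fun ρ hρ => le_trans ?_ (le_of_backward_recursion (A := C * 4 ^ 17) (B := 2 ^ 17)
    (F := fun j => max (E (ρ * (2 - 2⁻¹ ^ j))) 1) hγ0 hγ1
    (one_le_mul_of_one_le_of_one_le hC (by norm_num)) (by norm_num) rfl rfl
    (fun j => zero_le_one.trans (le_max_right _ _)) (fun j => ?_)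
    (m := max (E (ρ * 2)) 1) (fun j => ?_))⟩
  · rw [pow_zero, show ρ * (2 - 1) = ρ by ring]
    exact le_max_left _ _
  · have hp : (0 : ℝ) < 2⁻¹ ^ j := by positivity
    have hp1 : (2⁻¹ : ℝ) ^ j ≤ 1 := pow_le_one₀ (by norm_num) (by norm_num)
    have hpj : (2⁻¹ : ℝ) ^ (j + 1) = 2⁻¹ ^ j / 2 := by rw [pow_succ]; ring
    set D := max (E (ρ * (2 - 2⁻¹ ^ (j + 1)))) 1 with hD
    have hD1 : 1 ≤ D := le_max_right _ _
    have h2 : ((2 : ℝ) ^ 17) ^ j = (2 ^ j) ^ 17 := by rw [← pow_mul, ← pow_mul, mul_comm]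
    have h2j : (1 : ℝ) ≤ 2 ^ j := one_le_pow₀ (by norm_num)
    refine max_le ?_ ?_
    · refine (h (ρ * (2 - 2⁻¹ ^ j)) (ρ * (2 - 2⁻¹ ^ (j + 1))) D (by nlinarith) ?_ hD1
        (le_max_left _ _)).trans ?_
      · rw [hpj]
        nlinarith
      · rw [h2, mul_assoc C (4 ^ 17), ← mul_pow]
        have hq : ρ * (2 - 2⁻¹ ^ (j + 1))
            / (ρ * (2 - 2⁻¹ ^ (j + 1)) - ρ * (2 - 2⁻¹ ^ j)) ≤ 4 * 2 ^ j := by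
          rw [hpj, div_le_iff₀ (by nlinarith)]
          have : (2 : ℝ) ^ j * 2⁻¹ ^ j = 1 := by rw [← mul_pow]; norm_num
          have e : 4 * 2 ^ j * (ρ * (2 - 2⁻¹ ^ j / 2) - ρ * (2 - 2⁻¹ ^ j))
              = 2 * ρ * (2 ^ j * 2⁻¹ ^ j) := by ring
          rw [e, this]
          nlinarith
        have hq0 : 0 ≤ ρ * (2 - 2⁻¹ ^ (j + 1))
            / (ρ * (2 - 2⁻¹ ^ (j + 1)) - ρ * (2 - 2⁻¹ ^ j)) := by
          rw [hpj]
          exact div_nonneg (by nlinarith) (by nlinarith)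
        gcongr
    · have h3 : 1 ≤ D ^ γ := Real.one_le_rpow hD1 hγ0.le
      exact one_le_mul_of_one_le_of_one_le (one_le_mul_of_one_le_of_one_le
        (one_le_mul_of_one_le_of_one_le hC (by norm_num)) (one_le_pow₀ (by norm_num))) h3
  · refine max_le_max_right _ (hE ?_)
    have hp : (0 : ℝ) < 2⁻¹ ^ j := by positivity
    nlinarith

end Iteration

section Conclusion

variable {u w b v : E3 → E3} {P : E3 → ℝ} {s K : ℝ}

lemma gamma_lt_one (hs : 3 < s) : max (11 / 12 : ℝ) (9 / (s + 6)) < 1 := by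
  refine max_lt (by norm_num) ?_
  rw [div_lt_one (by linarith)]
  linarith

lemma IsMMPSolution.integrable_dissipation (h : IsMMPSolution u w b P) (hs : 3 < s) (hs6 : s ≤ 6)
    (hK : 1 ≤ K) (hu : ∀ R, 1 < R → ∃ φ, IsPotential s K φ u R)
    (hw : ∀ R, 1 < R → ∃ φ, IsPotential s K φ w R)
    (hb : ∀ R, 1 < R → ∃ φ, IsPotential s K φ b R) : Integrable (dissipation u w b) := by
  have hd := (contDiff_dissipation h.smooth_u h.smooth_w h.smooth_b).continuous
  have hd0 := dissipation_nonneg u w b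
  obtain ⟨C, hC, hstep⟩ := exists_energy_step hs hs6 hK
  obtain ⟨L, hL⟩ := exists_bound_of_step (E := fun r => ∫ x in ball3 r, dissipation u w b x)
    (lt_max_of_lt_left (by norm_num)) (gamma_lt_one hs) hC
    (fun r r' hr => setIntegral_ball3_mono hr hd hd0) fun r R D hr hrR hD1 hD => by
      obtain ⟨φ₁, h₁⟩ := hu R (hr.trans hrR)
      obtain ⟨φ₂, h₂⟩ := hw R (hr.trans hrR)
      obtain ⟨φ₃, h₃⟩ := hb R (hr.trans hrR)
      exact hstep h h₁ h₂ h₃ hr.le hrR hD1 hD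
  exact (aecover_ball (x := (0 : E3)) tendsto_id).integrable_of_integral_bounded_of_nonneg_ae L
    (fun r => integrableOn_ball3 hd) (Eventually.of_forall hd0)
    ((eventually_gt_atTop 1).mono fun ρ hρ => hL ρ hρ)

/-- The shell on which the cutoff of the annulus of radius `ρ` is supported. -/
def shell (ρ : ℝ) : Set E3 := ball3 (3 * ρ) \ ball3 (ρ / 2)

lemma tendsto_setIntegral_shell {f : E3 → ℝ} (hf : Integrable f) :
    Tendsto (fun ρ => ∫ x in shell ρ, f x) atTop (nhds 0) := by
  have hball : ∀ {g : ℝ → ℝ}, Tendsto g atTop atTop →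
      Tendsto (fun ρ => ∫ x in ball3 (g ρ), f x) atTop (nhds (∫ x, f x)) := fun hg =>
    (aecover_ball (x := (0 : E3)) hg).integral_tendsto_of_countably_generated hf
  have h := (hball (tendsto_id.const_mul_atTop (by norm_num : (0 : ℝ) < 3))).sub
    (hball (tendsto_id.atTop_div_const (by norm_num : (0 : ℝ) < 2)))
  rw [sub_self] at h
  refine h.congr' ((eventually_gt_atTop 0).mono fun ρ hρ => ?_)
  exact (setIntegral_sdiff (measurableSet_ball3 _) hf.integrableOn
    (ball_subset_ball (by dsimp; linarith))).symm

lemma exists_shell_cutoff : ∃ C : ℝ, 1 ≤ C ∧ ∀ ρ : ℝ, 0 < ρ → ∃ η : E3 → ℝ,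
    ContDiff ℝ (⊤ : ℕ∞) η ∧ (∀ x, 0 ≤ η x) ∧ (∀ x, η x ≤ 1) ∧
    (∀ x ∈ ball3 (2 * ρ) \ ball3 ρ, η x = 1) ∧ (∀ x, x ∉ shell ρ → η x = 0) ∧
    ∀ i x, |pd i η x| ≤ C / (3 * ρ) := by
  obtain ⟨C, hC, hcut⟩ := exists_cutoff
  refine ⟨9 * C, by linarith, fun ρ hρ => ?_⟩
  obtain ⟨α, hα, hα0, hα1, hαin, hαout, hαd, -⟩ := hcut (2 * ρ) (3 * ρ) (by linarith) (by linarith)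
  obtain ⟨β, hβ, hβ0, hβ1, hβin, hβout, hβd, -⟩ := hcut (ρ / 2) ρ (by linarith) (by linarith)
  refine ⟨fun x => α x * (1 - β x), hα.mul (contDiff_const.sub hβ),
    fun x => mul_nonneg (hα0 x) (by linarith [hβ1 x]), fun x => ?_, fun x hx => ?_,
    fun x hx => ?_, fun i x => ?_⟩
  · exact mul_le_one₀ (hα1 x) (by linarith [hβ1 x]) (by linarith [hβ0 x])
  · simp only [ball3, Set.mem_sdiff, mem_ball_zero_iff, not_lt] at hx
    simp [hαin x hx.1.le, hβout x hx.2]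
  · simp only [shell, ball3, Set.mem_sdiff, mem_ball_zero_iff, not_and, not_not] at hx
    rcases lt_or_ge ‖x‖ (3 * ρ) with h | h
    · simp [hβin x (hx h).le]
    · simp [hαout x h]
  · have e : pd i (fun x => α x * (1 - β x)) x = pd i α x * (1 - β x) + α x * (-pd i β x) := by
      rw [pd_mul i (hα.differentiable (by simp) x)
        ((contDiff_const.sub hβ).differentiable (by simp) x)]
      congr 2
      simp only [pd, fderiv_const_sub, neg_apply]
    rw [e]
    have h1 : |pd i α x * (1 - β x)| ≤ C / ρ := by
      rw [abs_mul]
      have : |1 - β x| ≤ 1 := by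
        rw [abs_le]
        constructor <;> linarith [hβ0 x, hβ1 x]
      have h' := hαd i x
      rw [show 3 * ρ - 2 * ρ = ρ by ring] at h'
      calc _ ≤ C / ρ * 1 := mul_le_mul h' this (abs_nonneg _) (by positivity)
        _ = _ := mul_one _
    have h2 : |α x * (-pd i β x)| ≤ 2 * C / ρ := by
      rw [abs_mul, abs_neg, abs_of_nonneg (hα0 x)]
      have h' := hβd i x
      rw [show C / (ρ - ρ / 2) = 2 * C / ρ by field_simp; norm_num] at h'
      calc _ ≤ 1 * (2 * C / ρ) := mul_le_mul (hα1 x) h' (abs_nonneg _) zero_le_one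
        _ = _ := one_mul _
    calc _ ≤ C / ρ + 2 * C / ρ := (abs_add_le _ _).trans (add_le_add h1 h2)
      _ = 9 * C / (3 * ρ) := by
        field_simp
        norm_num

lemma norm_pow_three_le (y : E3) : ‖y‖ ^ 3 ≤ 9 * ∑ j, |y j| ^ 3 := by
  have h1 : ‖y‖ ≤ ∑ j, |y j| := by
    refine le_of_sq_le_sq ?_ (Finset.sum_nonneg fun _ _ => abs_nonneg _)
    rw [EuclideanSpace.norm_sq_eq]
    simp only [Real.norm_eq_abs]
    simp only [Fin.sum_univ_three]
    nlinarith [mul_nonneg (abs_nonneg (y 0)) (abs_nonneg (y 1)),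
      mul_nonneg (abs_nonneg (y 0)) (abs_nonneg (y 2)),
      mul_nonneg (abs_nonneg (y 1)) (abs_nonneg (y 2))]
  have h2 := pow_sum_div_card_le_sum_pow (s := (Finset.univ : Finset (Fin 3)))
    (f := fun j => |y j|) (fun _ _ => abs_nonneg _) 2
  simp only [Finset.card_univ, Fintype.card_fin, Nat.cast_ofNat, Nat.reduceAdd] at h2
  have h3 := pow_le_pow_left₀ (norm_nonneg y) h1 3
  linarith

lemma tendsto_annulus_integral {d : E3 → ℝ} (hs : 3 < s) (hs6 : s ≤ 6) (hK : 1 ≤ K)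
    (hv : ContDiff ℝ (⊤ : ℕ∞) v) (hp : ∀ R, 1 < R → ∃ φ, IsPotential s K φ v R)
    (hd : Integrable d) (hvd : ∀ x, gradSq v x ≤ d x) :
    Tendsto (fun ρ => ρ⁻¹ * ∫ x in ball3 (2 * ρ) \ ball3 ρ, ‖v x‖ ^ 3) atTop (nhds 0) := by
  obtain ⟨C, hC, H⟩ := exists_local_estimates hs hs6 hK
  obtain ⟨κ, hκ, hcut⟩ := exists_shell_cutoff
  set D : ℝ → ℝ := fun ρ => (∫ x in shell ρ, d x) + (3 * ρ) ^ (-1 / 3 : ℝ) with hDdef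
  have hd0 : ∀ x, 0 ≤ d x := fun x => (gradSq_nonneg v x).trans (hvd x)
  have hD : Tendsto D atTop (nhds 0) := by
    have h1 : Tendsto (fun ρ : ℝ => (3 * ρ) ^ (-1 / 3 : ℝ)) atTop (nhds 0) := by
      rw [show (-1 / 3 : ℝ) = -(1 / 3) by norm_num]
      exact (tendsto_rpow_neg_atTop (by norm_num)).comp
        (tendsto_id.const_mul_atTop (by norm_num : (0 : ℝ) < 3))
    simpa using (tendsto_setIntegral_shell hd).add h1
  have hq : 0 < 9 / (s + 6) := by
    have : 0 < s + 6 := by linarith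
    positivity
  have hlim : Tendsto (fun ρ => 81 * (C * κ ^ 3) * D ρ ^ (9 / (s + 6))) atTop (nhds 0) := by
    have := (hD.rpow_const (Or.inr hq.le)).const_mul (81 * (C * κ ^ 3))
    rwa [Real.zero_rpow hq.ne', mul_zero] at this
  refine squeeze_zero' ((eventually_gt_atTop 0).mono fun ρ hρ => ?_) ?_ hlim
  · exact mul_nonneg (inv_nonneg.2 hρ.le) (integral_nonneg fun x => by positivity)
  filter_upwards [eventually_gt_atTop 1] with ρ hρ
  have hρ0 : 0 < ρ := by linarith
  obtain ⟨φ, hφ⟩ := hp (3 * ρ) (by linarith)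
  obtain ⟨η, hη, hη0, hη1, hηin, hηout, hηd⟩ := hcut ρ hρ0
  have hsub : shell ρ ⊆ ball3 (3 * ρ) := Set.sdiff_subset
  have hmS : MeasurableSet (shell ρ) := (measurableSet_ball3 _).diff (measurableSet_ball3 _)
  have hmA : MeasurableSet (ball3 (2 * ρ) \ ball3 ρ) :=
    (measurableSet_ball3 _).diff (measurableSet_ball3 _)
  have hIntg : ∀ {g : E3 → ℝ}, Continuous g → IntegrableOn g (ball3 (2 * ρ) \ ball3 ρ) :=
    fun hg => integrableOn_of_subset_ball3 Set.sdiff_subset hg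
  have hc := hv.continuous
  have hcη := hη.continuous
  have L : ∀ j, LocalData s K (fun i => φ i j) (fun x => v x j) η (shell ρ) (3 * ρ) κ (D ρ) :=
    fun j =>
    { one_le_R := by linarith
      one_le_κ := hκ
      le_D := le_add_of_nonneg_left (integral_nonneg hd0)
      smooth_φ := fun i => hφ.smooth i j
      smooth_f := contDiff_coord hv j
      div_eq := hφ.eq j
      smooth_η := hη
      η_nonneg := hη0
      η_le_one := hη1
      η_eq_zero := hηout
      subset_ball := hsub
      meas_S := hmS
      pd_η_le := hηd
      φ_le := fun i => hφ.le i j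
      grad_le := fun i => by
        have h1 : ∫ x in shell ρ, pd i (fun y => v y j) x ^ 2 ≤ ∫ x in shell ρ, d x :=
          integral_mono (integrableOn_of_subset_ball3 hsub
            ((contDiff_pd i (contDiff_coord hv j)).continuous.pow 2)) hd.integrableOn
            fun x => (sq_pd_le_gradSq v j i x).trans (hvd x)
        refine h1.trans (le_add_of_nonneg_right ?_)
        positivity }
  have hj : ∀ j, ∫ x in ball3 (2 * ρ) \ ball3 ρ, |v x j| ^ 3
      ≤ C * κ ^ 3 * (3 * ρ) * D ρ ^ (9 / (s + 6)) := by
    intro j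
    refine le_trans ?_ (H (L j)).2.2.1
    rw [setIntegral_congr_fun (g := fun x => |v x j * η x| ^ 3) hmA fun x hx => by
      simp [hηin x hx]]
    refine setIntegral_le_integral ?_ (Eventually.of_forall fun x => by positivity)
    refine Continuous.integrable_of_hasCompactSupport (by fun_prop)
      (HasCompactSupport.intro (isCompact_closedBall (0 : E3) (3 * ρ)) fun x hx => ?_)
    rw [hηout x fun hx' => hx (ball_subset_closedBall (hsub hx'))]
    simp
  have hsum : ∫ x in ball3 (2 * ρ) \ ball3 ρ, ‖v x‖ ^ 3
      ≤ 9 * ∑ j, ∫ x in ball3 (2 * ρ) \ ball3 ρ, |v x j| ^ 3 := by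
    rw [← integral_finsetSum _ fun j _ => hIntg (by fun_prop), ← integral_const_mul]
    exact integral_mono (hIntg (by fun_prop)) (hIntg (by fun_prop)) fun x => norm_pow_three_le (v x)
  have hsum' := Finset.sum_le_sum fun j (_ : j ∈ (Finset.univ : Finset (Fin 3))) => hj j
  rw [Finset.sum_const, Finset.card_univ, Fintype.card_fin, nsmul_eq_mul] at hsum'
  rw [inv_mul_le_iff₀ hρ0]
  push_cast at hsum'
  linarith

end Conclusion

/-- Decay of the scaled cubic annulus integral under the potential growth hypothesis. -/
theorem annulus_cubic_decay
    (u w b : E3 → E3) (P : E3 → ℝ) (hsol : IsMMPSolution u w b P)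
    (Φ Ψ Υ : E3 → Fin 3 → Fin 3 → ℝ)
    (hΦ : ∀ i j, ContDiff ℝ (⊤ : ℕ∞) (fun x => Φ x i j))
    (hΨ : ∀ i j, ContDiff ℝ (⊤ : ℕ∞) (fun x => Ψ x i j))
    (hΥ : ∀ i j, ContDiff ℝ (⊤ : ℕ∞) (fun x => Υ x i j))
    (hΦu : ∀ (x : E3) (j : Fin 3), mdiv Φ x j = u x j)
    (hΨb : ∀ (x : E3) (j : Fin 3), mdiv Ψ x j = b x j)
    (hΥw : ∀ (x : E3) (j : Fin 3), mdiv Υ x j = w x j)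
    (s : ℝ) (hs1 : 3 < s) (hs2 : s ≤ 6)
    (C₀ : ℝ) (hC₀ : 0 < C₀)
    (hosc : ∀ r : ℝ, 1 < r →
      meanOsc Φ s r + meanOsc Ψ s r + meanOsc Υ s r ≤ C₀ * r ^ ((1:ℝ)/3 - 1/s))
    : Tendsto
        (fun ρ : ℝ =>
          ρ⁻¹ * ∫ x in ball3 (2 * ρ) \ ball3 ρ, (‖u x‖ ^ 3 + ‖b x‖ ^ 3 + ‖w x‖ ^ 3))
        atTop (nhds 0) := by
  have hK : 1 ≤ max 1 (5 * C₀ ^ s) := le_max_left _ _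
  have pu : ∀ R, 1 < R → ∃ φ, IsPotential s (max 1 (5 * C₀ ^ s)) φ u R := fun R hR =>
    ⟨_, isPotential_sub_mavg hΦ hΦu hs1 hC₀ hR (by
      linarith [hosc R hR, meanOsc_nonneg Ψ s R, meanOsc_nonneg Υ s R])⟩
  have pb : ∀ R, 1 < R → ∃ φ, IsPotential s (max 1 (5 * C₀ ^ s)) φ b R := fun R hR =>
    ⟨_, isPotential_sub_mavg hΨ hΨb hs1 hC₀ hR (by
      linarith [hosc R hR, meanOsc_nonneg Φ s R, meanOsc_nonneg Υ s R])⟩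
  have pw : ∀ R, 1 < R → ∃ φ, IsPotential s (max 1 (5 * C₀ ^ s)) φ w R := fun R hR =>
    ⟨_, isPotential_sub_mavg hΥ hΥw hs1 hC₀ hR (by
      linarith [hosc R hR, meanOsc_nonneg Φ s R, meanOsc_nonneg Ψ s R])⟩
  have hd := hsol.integrable_dissipation hs1 hs2 hK pu pw pb
  have tu := tendsto_annulus_integral hs1 hs2 hK hsol.smooth_u pu hd fun x => by
    linarith [gradSq_le_dissipation_left u w b x,
      Finset.sum_nonneg fun i (_ : i ∈ Finset.univ) => sq_nonneg (w x i)]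
  have tb := tendsto_annulus_integral hs1 hs2 hK hsol.smooth_b pb hd
    fun x => gradSq_le_dissipation_right u w b x
  have tw := tendsto_annulus_integral hs1 hs2 hK hsol.smooth_w pw hd
    fun x => gradSq_le_dissipation_middle u w b x
  have h := (tu.add tb).add tw
  rw [add_zero, add_zero] at h
  refine h.congr fun ρ => ?_
  have hIntg : ∀ {v : E3 → E3}, ContDiff ℝ (⊤ : ℕ∞) v →
      IntegrableOn (fun x => ‖v x‖ ^ 3) (ball3 (2 * ρ) \ ball3 ρ) := fun hv =>
    integrableOn_of_subset_ball3 Set.sdiff_subset (hv.continuous.norm.pow 3)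
  rw [integral_add _ (hIntg hsol.smooth_w), integral_add (hIntg hsol.smooth_u) (hIntg hsol.smooth_b)]
  · ring
  · exact (hIntg hsol.smooth_u).add (hIntg hsol.smooth_b)
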